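/- Each of the rules ai↑, ss↑ and p↑ is admissible for GS; that is, for every instance of one of these rules with premise Q and conclusion Q' and every context C[·]_R, if C[Q]_R is provable in GS then C[Q']_R is provable in GS. -/

import Mathlib

namespace GSP

/-- Atoms: a propositional variable (coded by a natural number) with a polarity. -/
abbrev Atom := ℕ × Bool

/-- The dual atom. -/
def dualAtom (a : Atom) : Atom := (a.1, !a.2)

/-- A finite, simple, undirected graph whose vertices are labelled by atoms. -/
structure LGraph where
  V : Type
  [fintype : Fintype V]
  adj : V → V → Prop
  symm : ∀ {v w : V}, adj v w → adj w v
  irrefl : ∀ v : V, ¬ adj v v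
  label : V → Atom

attribute [instance] LGraph.fintype

namespace LGraph

/-- An isomorphism of labelled graphs: a vertex bijection preserving labels and
preserving and reflecting edges. -/
structure Iso (G H : LGraph) where
  toEquiv : G.V ≃ H.V
  adj_iff : ∀ v w : G.V, G.adj v w ↔ H.adj (toEquiv v) (toEquiv w)
  label_eq : ∀ v : G.V, H.label (toEquiv v) = G.label v

/-- `G ≅ H` : the graphs `G` and `H` are isomorphic. -/
def iso (G H : LGraph) : Prop := Nonempty (Iso G H)

/-- The empty graph. -/
def empty : LGraph where
  V := Empty
  adj _ _ := False
  symm h := h.elim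
  irrefl v := v.elim
  label v := v.elim

/-- The single-vertex graph labelled by the atom `a`. -/
def single (a : Atom) : LGraph where
  V := Unit
  adj _ _ := False
  symm h := h.elim
  irrefl _ h := h
  label _ := a

def parAdj (G H : LGraph) : G.V ⊕ H.V → G.V ⊕ H.V → Prop
  | .inl a, .inl b => G.adj a b
  | .inr a, .inr b => H.adj a b
  | _, _ => False

/-- The par `G ⅋ H` : disjoint union of `G` and `H`. -/
def par (G H : LGraph) : LGraph where
  V := G.V ⊕ H.V
  adj := parAdj G H
  symm := by
    rintro (a | a) (b | b) h
    · exact G.symm h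
    · exact h.elim
    · exact h.elim
    · exact H.symm h
  irrefl := by
    rintro (a | a) h
    · exact G.irrefl a h
    · exact H.irrefl a h
  label := Sum.elim G.label H.label

def tensorAdj (G H : LGraph) : G.V ⊕ H.V → G.V ⊕ H.V → Prop
  | .inl a, .inl b => G.adj a b
  | .inr a, .inr b => H.adj a b
  | .inl _, .inr _ => True
  | .inr _, .inl _ => True

/-- The tensor `G ⊗ H` : join of `G` and `H` (disjoint union plus all edges in between). -/
def tensor (G H : LGraph) : LGraph where
  V := G.V ⊕ H.V
  adj := tensorAdj G H
  symm := by
    rintro (a | a) (b | b) h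
    · exact G.symm h
    · exact trivial
    · exact trivial
    · exact H.symm h
  irrefl := by
    rintro (a | a) h
    · exact G.irrefl a h
    · exact H.irrefl a h
  label := Sum.elim G.label H.label

/-- The dual graph `Ḡ` : same vertices, complemented edges, dualized labels. -/
def dual (G : LGraph) : LGraph where
  V := G.V
  adj v w := v ≠ w ∧ ¬ G.adj v w
  symm h := ⟨fun e => h.1 e.symm, fun h' => h.2 (G.symm h')⟩
  irrefl _ h := h.1 rfl
  label v := dualAtom (G.label v)

def plugAdj (C : LGraph) (R : Set C.V) (X : LGraph) : C.V ⊕ X.V → C.V ⊕ X.V → Prop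
  | .inl a, .inl b => C.adj a b
  | .inr a, .inr b => X.adj a b
  | .inl a, .inr _ => a ∈ R
  | .inr _, .inl b => b ∈ R

/-- `C[X]_R` : the graph obtained from the context `C[·]_R` by inserting the graph `X`
as a module whose vertices are adjacent exactly to the vertices in `R`. -/
def plug (C : LGraph) (R : Set C.V) (X : LGraph) : LGraph where
  V := C.V ⊕ X.V
  adj := plugAdj C R X
  symm := by
    rintro (a | a) (b | b) h
    · exact C.symm h
    · exact h
    · exact h
    · exact X.symm h
  irrefl := by
    rintro (a | a) h
    · exact C.irrefl a h
    · exact X.irrefl a h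
  label := Sum.elim C.label X.label

def compAdj (G : LGraph) (H : G.V → LGraph) :
    (Σ v : G.V, (H v).V) → (Σ v : G.V, (H v).V) → Prop := fun x y =>
  (∃ (v : G.V) (a b : (H v).V), x = ⟨v, a⟩ ∧ y = ⟨v, b⟩ ∧ (H v).adj a b) ∨
    (x.1 ≠ y.1 ∧ G.adj x.1 y.1)

/-- The composition `G⟨H v₁, …, H vₙ⟩` of the family `H` via the graph `G`:
replace each vertex `v` of `G` by the graph `H v`. -/
def comp (G : LGraph) (H : G.V → LGraph) : LGraph where
  V := Σ v : G.V, (H v).V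
  adj := compAdj G H
  symm := by
    rintro x y (⟨v, a, b, hx, hy, hab⟩ | ⟨hne, hadj⟩)
    · exact Or.inl ⟨v, b, a, hy, hx, (H v).symm hab⟩
    · exact Or.inr ⟨hne.symm, G.symm hadj⟩
  irrefl := by
    rintro ⟨v, a⟩ (⟨w, x, y, hx, hy, hxy⟩ | ⟨hne, _⟩)
    · have h := hx.symm.trans hy
      obtain rfl : x = y := by simpa using h
      exact (H w).irrefl x hxy
    · exact hne rfl
  label x := (H x.1).label x.2

/-- A module of `G` : a set `M` of vertices such that every vertex outside `M`
is adjacent either to all vertices of `M` or to none of them. -/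
def IsModule (G : LGraph) (M : Set G.V) : Prop :=
  ∀ v ∉ M, ∀ x ∈ M, ∀ y ∈ M, (G.adj v x ↔ G.adj v y)

/-- A prime graph: at least 2 vertices and only trivial modules. -/
def Prime (G : LGraph) : Prop :=
  2 ≤ Fintype.card G.V ∧
    ∀ M : Set G.V, G.IsModule M → M = ∅ ∨ (∃ v, M = {v}) ∨ M = Set.univ

/-- `G` is `P₄`-free: no four distinct vertices induce a path on 4 vertices. -/
def P4Free (G : LGraph) : Prop :=
  ¬ ∃ v₁ v₂ v₃ v₄ : G.V,
      v₁ ≠ v₂ ∧ v₁ ≠ v₃ ∧ v₁ ≠ v₄ ∧ v₂ ≠ v₃ ∧ v₂ ≠ v₄ ∧ v₃ ≠ v₄ ∧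
      G.adj v₁ v₂ ∧ G.adj v₂ v₃ ∧ G.adj v₃ v₄ ∧
      ¬ G.adj v₁ v₃ ∧ ¬ G.adj v₁ v₄ ∧ ¬ G.adj v₂ v₄

end LGraph

open LGraph

/-- The `n`-fold tensor `X₁ ⊗ ⋯ ⊗ Xₙ`. -/
def bigTensor : (n : ℕ) → (Fin n → LGraph) → LGraph
  | 0, _ => LGraph.empty
  | n + 1, F => (F 0).tensor (bigTensor n fun i => F i.succ)

/-- The `n`-fold par `X₁ ⅋ ⋯ ⅋ Xₙ`. -/
def bigPar : (n : ℕ) → (Fin n → LGraph) → LGraph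
  | 0, _ => LGraph.empty
  | n + 1, F => (F 0).par (bigPar n fun i => F i.succ)

/-- The inference rules of system GS (premise, conclusion). -/
inductive GSRule : LGraph → LGraph → Prop
  /-- ai↓ : premise `∅`, conclusion `ā ⅋ a`. -/
  | ai (a : Atom) : GSRule LGraph.empty ((single (dualAtom a)).par (single a))
  /-- ss↓ : premise `B[A]_S`, conclusion `B ⅋ A`, for `A ≠ ∅` and `S ≠ ∅`. -/
  | ss (A B : LGraph) (S : Set B.V) :
      Nonempty A.V → S ≠ ∅ → GSRule (B.plug S A) (B.par A)
  /-- p↓ : premise `(M₁ ⅋ N₁) ⊗ ⋯ ⊗ (Mₙ ⅋ Nₙ)`, conclusion `P̄⟨M₁,…,Mₙ⟩ ⅋ P⟨N₁,…,Nₙ⟩`,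
  for `P` prime with `n = |V(P)| ≥ 4` and all `Mᵢ ≠ ∅`. -/
  | p (n : ℕ) (P : LGraph) (e : P.V ≃ Fin n) (M N : Fin n → LGraph) :
      P.Prime → 4 ≤ n → (∀ i, Nonempty (M i).V) →
      GSRule (bigTensor n fun i => (M i).par (N i))
        ((P.dual.comp fun v => M (e v)).par (P.comp fun v => N (e v)))

/-- The "up" rules ai↑, ss↑, p↑ (premise, conclusion). -/
inductive UpRule : LGraph → LGraph → Prop
  /-- ai↑ : premise `a ⊗ ā`, conclusion `∅`. -/
  | ai (a : Atom) : UpRule ((single a).tensor (single (dualAtom a))) LGraph.empty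
  /-- ss↑ : premise `B ⊗ A`, conclusion `B[A]_S`, for `A ≠ ∅` and `S ≠ V(B)`. -/
  | ss (A B : LGraph) (S : Set B.V) :
      Nonempty A.V → S ≠ Set.univ → UpRule (B.tensor A) (B.plug S A)
  /-- p↑ : premise `P⟨M₁,…,Mₙ⟩ ⊗ P̄⟨N₁,…,Nₙ⟩`, conclusion `(M₁ ⊗ N₁) ⅋ ⋯ ⅋ (Mₙ ⊗ Nₙ)`,
  for `P` prime with `n = |V(P)| ≥ 4` and all `Mᵢ ≠ ∅`. -/
  | p (n : ℕ) (P : LGraph) (e : P.V ≃ Fin n) (M N : Fin n → LGraph) :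
      P.Prime → 4 ≤ n → (∀ i, Nonempty (M i).V) →
      UpRule ((P.comp fun v => M (e v)).tensor (P.dual.comp fun v => N (e v)))
        (bigPar n fun i => (M i).tensor (N i))

/-- The rules of system SGS : the rules of GS together with their duals. -/
def SGSRule (G H : LGraph) : Prop := GSRule G H ∨ UpRule G H

/-- A single inference step in a system: inside some context, replace a module
isomorphic to the premise of a rule by the corresponding conclusion. -/
def Step (Rules : LGraph → LGraph → Prop) (G H : LGraph) : Prop :=
  ∃ (C : LGraph) (R : Set C.V) (p c : LGraph),
    Rules p c ∧ G.iso (C.plug R p) ∧ H.iso (C.plug R c)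

/-- A derivation in a system from `G` to `H` : a finite sequence of inference steps
and isomorphisms leading from `G` to `H`. -/
def Deriv (Rules : LGraph → LGraph → Prop) (G H : LGraph) : Prop :=
  Relation.ReflTransGen (fun X Y => X.iso Y ∨ Step Rules X Y) G H

/-- A graph is provable in a system if there is a derivation from `∅` to it. -/
def Provable (Rules : LGraph → LGraph → Prop) (G : LGraph) : Prop :=
  Deriv Rules LGraph.empty G

/-- Formulas: unit, positive and negative atoms, par and tensor. -/
inductive Formula where
  | unit : Formula
  | pos (a : ℕ) : Formula
  | neg (a : ℕ) : Formula
  | par (φ ψ : Formula) : Formula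
  | tens (φ ψ : Formula) : Formula

/-- The graph `[φ]` of a formula `φ`. -/
def Formula.graph : Formula → LGraph
  | .unit => LGraph.empty
  | .pos a => single (a, true)
  | .neg a => single (a, false)
  | .par φ ψ => φ.graph.par ψ.graph
  | .tens φ ψ => φ.graph.tensor ψ.graph

/-- Structural equivalence of formulas: the smallest congruence making `⅋` and `⊗`
associative and commutative with unit `∘`. -/
inductive Formula.equiv : Formula → Formula → Prop
  | refl (φ) : Formula.equiv φ φ
  | symm {φ ψ} : Formula.equiv φ ψ → Formula.equiv ψ φ
  | trans {φ ψ χ} : Formula.equiv φ ψ → Formula.equiv ψ χ → Formula.equiv φ χ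
  | parComm (φ ψ) : Formula.equiv (.par φ ψ) (.par ψ φ)
  | parAssoc (φ ψ χ) : Formula.equiv (.par φ (.par ψ χ)) (.par (.par φ ψ) χ)
  | parUnit (φ) : Formula.equiv (.par φ .unit) φ
  | tensComm (φ ψ) : Formula.equiv (.tens φ ψ) (.tens ψ φ)
  | tensAssoc (φ ψ χ) : Formula.equiv (.tens φ (.tens ψ χ)) (.tens (.tens φ ψ) χ)
  | tensUnit (φ) : Formula.equiv (.tens φ .unit) φ
  | parCongr {φ φ' ψ ψ'} : Formula.equiv φ φ' → Formula.equiv ψ ψ' →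
      Formula.equiv (.par φ ψ) (.par φ' ψ')
  | tensCongr {φ φ' ψ ψ'} : Formula.equiv φ φ' → Formula.equiv ψ ψ' →
      Formula.equiv (.tens φ ψ) (.tens φ' ψ')

/-- A formula is unit-free if it contains no occurrence of the unit `∘`. -/
def Formula.UnitFree : Formula → Prop
  | .unit => False
  | .pos _ => True
  | .neg _ => True
  | .par φ ψ => φ.UnitFree ∧ ψ.UnitFree
  | .tens φ ψ => φ.UnitFree ∧ ψ.UnitFree

/-- The sequent calculus MLL° (multiplicative linear logic with mix) on multisets
of formulas. -/
inductive MLL : Multiset Formula → Prop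
  | ax (a : ℕ) : MLL {Formula.pos a, Formula.neg a}
  | tens {Γ Δ : Multiset Formula} (φ ψ : Formula) :
      MLL (φ ::ₘ Γ) → MLL (ψ ::ₘ Δ) → MLL (Formula.tens φ ψ ::ₘ (Γ + Δ))
  | par {Γ : Multiset Formula} (φ ψ : Formula) :
      MLL (φ ::ₘ ψ ::ₘ Γ) → MLL (Formula.par φ ψ ::ₘ Γ)
  | mix {Γ Δ : Multiset Formula} : MLL Γ → MLL Δ → MLL (Γ + Δ)

section

namespace LGraph

theorem iso_of {G H : LGraph} (f : G.V → H.V) (hf : Function.Bijective f)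
    (ha : ∀ v w, G.adj v w ↔ H.adj (f v) (f w)) (hl : ∀ v, H.label (f v) = G.label v) :
    G.iso H :=
  ⟨⟨Equiv.ofBijective f hf, ha, hl⟩⟩

theorem iso.refl (G : LGraph) : G.iso G := ⟨⟨Equiv.refl _, fun _ _ => Iff.rfl, fun _ => rfl⟩⟩

theorem iso.symm {G H : LGraph} (h : G.iso H) : H.iso G := by
  obtain ⟨e, ha, hl⟩ := h
  refine ⟨⟨e.symm, fun v w => ?_, fun v => ?_⟩⟩
  · rw [ha]; simp
  · rw [← hl]; simp

theorem iso.trans {G H K : LGraph} (h : G.iso H) (h' : H.iso K) : G.iso K := by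
  obtain ⟨e, ha, hl⟩ := h
  obtain ⟨e', ha', hl'⟩ := h'
  refine ⟨⟨e.trans e', fun v w => ?_, fun v => ?_⟩⟩
  · rw [ha, ha']; simp
  · rw [← hl, ← hl']; simp

/-- induced subgraph -/
noncomputable def sub (G : LGraph) (s : Set G.V) : LGraph where
  V := s
  fintype := Fintype.ofFinite s
  adj x y := G.adj x y
  symm h := G.symm h
  irrefl v := G.irrefl v
  label v := G.label v

theorem iso_sub {H G : LGraph} {s : Set G.V} (f : H.V → G.V) (hi : Function.Injective f)
    (hr : ∀ y, y ∈ s ↔ ∃ x, f x = y) (ha : ∀ x y, H.adj x y ↔ G.adj (f x) (f y))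
    (hl : ∀ x, G.label (f x) = H.label x) : H.iso (sub G s) := by
  refine iso_of (H := sub G s) (fun x => ⟨f x, (hr _).2 ⟨x, rfl⟩⟩) ⟨?_, ?_⟩ ?_ ?_
  · intro x y h; exact hi (congrArg Subtype.val h)
  · rintro ⟨y, hy⟩
    obtain ⟨x, rfl⟩ := (hr y).1 hy
    exact ⟨x, rfl⟩
  · exact ha
  · exact hl

theorem sub_univ (G : LGraph) : G.iso (sub G Set.univ) :=
  iso_sub id Function.injective_id (by simp) (by simp) (by simp)

theorem sub_sub_iso {H G : LGraph} {s : Set G.V} {u : Set H.V} (f : H.V → G.V)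
    (hi : Set.InjOn f u)
    (hr : ∀ y, y ∈ s ↔ ∃ x ∈ u, f x = y)
    (ha : ∀ x ∈ u, ∀ y ∈ u, (H.adj x y ↔ G.adj (f x) (f y)))
    (hl : ∀ x ∈ u, G.label (f x) = H.label x) : (sub H u).iso (sub G s) := by
  refine iso_sub (H := sub H u) (fun x => f x.1) ?_ ?_ ?_ ?_
  · intro x y h; exact Subtype.ext (hi x.2 y.2 h)
  · intro y; rw [hr]
    constructor
    · rintro ⟨x, hx, h⟩; exact ⟨⟨x, hx⟩, h⟩
    · rintro ⟨x, h⟩; exact ⟨x.1, x.2, h⟩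
  · intro x y; exact ha _ x.2 _ y.2
  · intro x; exact hl _ x.2

theorem par_congr {G G' H H' : LGraph} (h : G.iso G') (h' : H.iso H') :
    (G.par H).iso (G'.par H') := by
  obtain ⟨e, ha, hl⟩ := h
  obtain ⟨e', ha', hl'⟩ := h'
  refine ⟨⟨Equiv.sumCongr e e', ?_, ?_⟩⟩
  · rintro (v | v) (w | w) <;>
      first | exact ha _ _ | exact ha' _ _ | exact Iff.rfl
  · rintro (v | v) 
    · exact hl _
    · exact hl' _

theorem par_comm (G H : LGraph) : (G.par H).iso (H.par G) := by
  refine ⟨⟨Equiv.sumComm _ _, ?_, ?_⟩⟩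
  · rintro (v | v) (w | w) <;> exact Iff.rfl
  · rintro (v | v) <;> rfl

theorem par_assoc (G H K : LGraph) : ((G.par H).par K).iso (G.par (H.par K)) := by
  refine ⟨⟨Equiv.sumAssoc _ _ _, ?_, ?_⟩⟩
  · rintro ((v | v) | v) ((w | w) | w) <;> exact Iff.rfl
  · rintro ((v | v) | v) <;> rfl

theorem plug_empty (C : LGraph) (R : Set C.V) : (C.plug R LGraph.empty).iso C := by
  refine iso.symm (iso_of Sum.inl ⟨Sum.inl_injective, ?_⟩ ?_ ?_)
  · rintro (v | v)
    · exact ⟨v, rfl⟩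
    · exact v.elim
  · intro v w; exact Iff.rfl
  · intro v; rfl

theorem plug_congr {C X Y : LGraph} (R : Set C.V) (h : X.iso Y) :
    (C.plug R X).iso (C.plug R Y) := by
  obtain ⟨e, ha, hl⟩ := h
  refine ⟨⟨Equiv.sumCongr (Equiv.refl _) e, ?_, ?_⟩⟩
  · rintro (v | v) (w | w) <;> first | exact ha _ _ | exact Iff.rfl
  · rintro (v | v) 
    · rfl
    · exact hl _

theorem par_eq_plug (B A : LGraph) : B.par A = B.plug ∅ A := by
  unfold par plug
  congr
  funext x y
  rcases x with x | x <;> rcases y with y | y <;> simp [parAdj, plugAdj]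

theorem tensor_eq_plug (B A : LGraph) : B.tensor A = B.plug Set.univ A := by
  unfold tensor plug
  congr

theorem par_empty (G : LGraph) : (G.par LGraph.empty).iso G := by
  rw [par_eq_plug]; exact plug_empty _ _

/-- empty context -/
theorem empty_plug (X : LGraph) (R : Set LGraph.empty.V) : (LGraph.empty.plug R X).iso X := by
  refine iso.symm (iso_of Sum.inr ⟨Sum.inr_injective, ?_⟩ ?_ ?_)
  · rintro (v | v)
    · exact v.elim
    · exact ⟨v, rfl⟩
  · intro v w; exact Iff.rfl
  · intro v; rfl

theorem mem1 {α β : Type} {R : Set α} {R' : Set β} {v : α} :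
    (Sum.inl v : α ⊕ β) ∈ (Sum.inl '' R ∪ Sum.inr '' R' : Set (α ⊕ β)) ↔ v ∈ R := by simp
theorem mem2 {α β : Type} {R : Set α} {R' : Set β} {v : β} :
    (Sum.inr v : α ⊕ β) ∈ (Sum.inl '' R ∪ Sum.inr '' R' : Set (α ⊕ β)) ↔ v ∈ R' := by simp
theorem mem3 {α β : Type} {R : Set α} {v : α} :
    (Sum.inl v : α ⊕ β) ∈ (Sum.inl '' R : Set (α ⊕ β)) ↔ v ∈ R := by simp
theorem mem4 {α β : Type} {R : Set α} {v : β} :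
    (Sum.inr v : α ⊕ β) ∈ (Sum.inl '' R : Set (α ⊕ β)) ↔ False := by simp

theorem plug_plug (C C' : LGraph) (R : Set C.V) (R' : Set C'.V) (p : LGraph) :
    (C.plug R (C'.plug R' p)).iso
      ((C.plug R C').plug (Sum.inl '' R ∪ Sum.inr '' R' : Set (C.V ⊕ C'.V)) p) := by
  refine ⟨⟨(Equiv.sumAssoc _ _ _).symm, ?_, ?_⟩⟩
  · rintro (v | v | v) (w | w | w) <;>
      first | exact Iff.rfl | exact mem1.symm | exact mem2.symm
  · rintro (v | v | v) <;> rfl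

theorem plug_par_left (C X Y : LGraph) (R : Set C.V) :
    ((C.plug R X).par Y).iso ((C.par Y).plug (Sum.inl '' R : Set (C.V ⊕ Y.V)) X) := by
  refine ⟨⟨(Equiv.sumAssoc _ _ _).trans
    (((Equiv.refl _).sumCongr (Equiv.sumComm _ _)).trans (Equiv.sumAssoc _ _ _).symm), ?_, ?_⟩⟩
  · rintro ((v | v) | v) ((w | w) | w) <;>
      first | exact Iff.rfl | exact mem3.symm | exact mem4.symm
  · rintro ((v | v) | v) <;> rfl

theorem plug_par_right (C X Y : LGraph) (R : Set C.V) :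
    (C.plug R (X.par Y)).iso ((C.plug R X).plug (Sum.inl '' R : Set (C.V ⊕ X.V)) Y) := by
  refine ⟨⟨(Equiv.sumAssoc _ _ _).symm, ?_, ?_⟩⟩
  · rintro (v | v | v) (w | w | w) <;>
      first | exact Iff.rfl | exact mem3.symm | exact mem4.symm
  · rintro (v | v | v) <;> rfl

theorem compAdj_same {Q : LGraph} {K : Q.V → LGraph} {v : Q.V} {a b : (K v).V} :
    (Q.comp K).adj ⟨v, a⟩ ⟨v, b⟩ ↔ (K v).adj a b := by
  constructor
  · rintro (⟨w, a', b', h1, h2, h3⟩ | ⟨h, _⟩)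
    · cases h1; cases h2; exact h3
    · exact absurd rfl h
  · intro h; exact Or.inl ⟨v, a, b, rfl, rfl, h⟩

theorem compAdj_diff {Q : LGraph} {K : Q.V → LGraph} {x y : (Q.comp K).V} (h : x.1 ≠ y.1) :
    (Q.comp K).adj x y ↔ Q.adj x.1 y.1 := by
  constructor
  · rintro (⟨w, a', b', h1, h2, h3⟩ | ⟨_, h'⟩)
    · exact absurd (by rw [h1, h2]) h
    · exact h'
  · intro h'; exact Or.inr ⟨h, h'⟩

end LGraph

/-- derivability in GS -/
abbrev D (X Y : LGraph) : Prop := Deriv GSRule X Y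

theorem D_iso {X Y : LGraph} (h : X.iso Y) : D X Y := Relation.ReflTransGen.single (Or.inl h)

theorem D_trans {X Y Z : LGraph} (h : D X Y) (h' : D Y Z) : D X Z :=
  Relation.ReflTransGen.trans h h'

theorem rule_D {p c : LGraph} (h : GSRule p c) : D p c :=
  Relation.ReflTransGen.single (Or.inr ⟨LGraph.empty, ∅, p, c, h,
    (empty_plug _ _).symm, (empty_plug _ _).symm⟩)

theorem D_plug {X Y : LGraph} (C : LGraph) (R : Set C.V) (h : D X Y) :
    D (C.plug R X) (C.plug R Y) := by
  refine Relation.ReflTransGen.lift (fun X => C.plug R X) ?_ _ _ h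
  rintro A B (h | ⟨C', R', p, c, hr, h1, h2⟩)
  · exact Or.inl (plug_congr R h)
  · refine Or.inr ⟨C.plug R C', (Sum.inl '' R ∪ Sum.inr '' R' : Set (C.V ⊕ C'.V)), p, c, hr, ?_, ?_⟩
    · exact (plug_congr R h1).trans (plug_plug _ _ _ _ _)
    · exact (plug_congr R h2).trans (plug_plug _ _ _ _ _)

theorem D_ss (A B : LGraph) (S : Set B.V) : D (B.plug S A) (B.par A) := by
  by_cases hS : S = ∅
  · subst hS; rw [par_eq_plug]; exact Relation.ReflTransGen.refl
  by_cases hA : Nonempty A.V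
  · exact rule_D (GSRule.ss A B S hA hS)
  · rw [par_eq_plug]
    refine D_iso ?_
    refine iso_of id Function.bijective_id ?_ ?_
    · rintro (v | v) (w | w)
      · exact Iff.rfl
      · exact (hA ⟨w⟩).elim
      · exact (hA ⟨v⟩).elim
      · exact (hA ⟨v⟩).elim
    · intro v; rfl

theorem D_plug_par (C X Y : LGraph) (R : Set C.V) :
    D (C.plug R (X.par Y)) ((C.plug R X).par Y) :=
  D_trans (D_iso (plug_par_right _ _ _ _)) (D_ss _ _ _)

def isoSetoid : Setoid LGraph := ⟨LGraph.iso, iso.refl, iso.symm, iso.trans⟩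

def LQ := Quotient isoSetoid

def q (G : LGraph) : LQ := Quotient.mk isoSetoid G

theorem q_eq {G H : LGraph} : q G = q H ↔ G.iso H := ⟨fun h => Quotient.exact h,
  fun h => Quotient.sound h⟩

theorem q_surj (k : LQ) : ∃ G, q G = k := Quotient.exists_rep k

noncomputable instance : CommMonoid LQ where
  mul := Quotient.map₂ LGraph.par (fun _ _ h _ _ h' => par_congr h h')
  one := q LGraph.empty
  mul_assoc a b c := by
    induction a using Quotient.inductionOn
    induction b using Quotient.inductionOn
    induction c using Quotient.inductionOn
    exact q_eq.2 (par_assoc _ _ _)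
  mul_comm a b := by
    induction a using Quotient.inductionOn
    induction b using Quotient.inductionOn
    exact q_eq.2 (par_comm _ _)
  one_mul a := by
    induction a using Quotient.inductionOn
    exact q_eq.2 ((par_comm _ _).trans (par_empty _))
  mul_one a := by
    induction a using Quotient.inductionOn
    exact q_eq.2 (par_empty _)

theorem q_mul (G H : LGraph) : q G * q H = q (G.par H) := rfl
theorem q_one : (1 : LQ) = q LGraph.empty := rfl

theorem q_of_isEmpty {G : LGraph} (h : IsEmpty G.V) : q G = 1 := by
  refine q_eq.2 (iso.symm (iso_of (fun v : Empty => v.elim) ⟨fun v => v.elim, fun v => h.elim v⟩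
    (fun v => v.elim) (fun v => v.elim)))

/-- provable classes -/
def pv : Set LQ := {k | ∃ X, q X = k ∧ Provable GSRule X}

theorem pv_iff {X : LGraph} : q X ∈ pv ↔ Provable GSRule X := by
  constructor
  · rintro ⟨Y, h, hY⟩
    exact D_trans hY (D_iso (q_eq.1 h))
  · intro h; exact ⟨X, rfl, h⟩

theorem one_pv : (1 : LQ) ∈ pv := pv_iff.2 Relation.ReflTransGen.refl

structure Closed (T : Set LQ) : Prop where
  der : ∀ {X Y : LGraph}, q X ∈ T → D X Y → q Y ∈ T
  kill : ∀ {C : LGraph} (R : Set C.V) {X : LGraph}, q X ∈ T → Provable GSRule C →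
    q (C.plug R X) ∈ T

inductive Cl (T : Set LQ) : Set LQ
  | base {k : LQ} : k ∈ T → Cl T k
  | der {X Y : LGraph} : Cl T (q X) → D X Y → Cl T (q Y)
  | kill {C : LGraph} (R : Set C.V) {X : LGraph} : Cl T (q X) → Provable GSRule C →
      Cl T (q (C.plug R X))

theorem Cl_closed (T : Set LQ) : Closed (Cl T) := ⟨Cl.der, Cl.kill⟩

theorem Cl_sub {T U : Set LQ} (hU : Closed U) (h : T ⊆ U) : Cl T ⊆ U := by
  intro k hk
  induction hk with
  | base h' => exact h h'
  | der _ hd ih => exact hU.der ih hd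
  | kill R _ hp ih => exact hU.kill R ih hp

theorem sub_Cl {T : Set LQ} : T ⊆ Cl T := fun _ h => Cl.base h

theorem pv_closed : Closed pv where
  der hX hD := pv_iff.2 (D_trans (pv_iff.1 hX) hD)
  kill {C} R {X} hX hC := by
    refine pv_iff.2 (D_trans hC (D_trans (D_iso (plug_empty C R).symm) (D_plug C R (pv_iff.1 hX))))

theorem D_par {X X' : LGraph} (Y : LGraph) (h : D X X') : D (X.par Y) (X'.par Y) := by
  have := D_plug Y ∅ h
  rw [← par_eq_plug, ← par_eq_plug] at this
  exact D_trans (D_iso (par_comm _ _)) (D_trans this (D_iso (par_comm _ _)))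

theorem Closed.shift {T : Set LQ} (hT : Closed T) (l : LQ) : Closed {k | k * l ∈ T} := by
  obtain ⟨Y, rfl⟩ := q_surj l
  constructor
  · intro X X' hX hD
    exact hT.der (X := X.par Y) hX (D_par Y hD)
  · intro C R X hX hC
    exact hT.der (hT.kill R (X := X.par Y) hX hC) (D_plug_par _ _ _ _)

theorem Closed.all {ι : Sort*} {T : ι → Set LQ} (hT : ∀ i, Closed (T i)) :
    Closed {k | ∀ i, k ∈ T i} :=
  ⟨fun h hD i => (hT i).der (h i) hD, fun R _ h hC i => (hT i).kill R (h i) hC⟩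

theorem Closed.imp {p : Prop} {T : Set LQ} (hT : p → Closed T) :
    Closed {k | p → k ∈ T} :=
  ⟨fun h hD i => (hT i).der (h i) hD, fun R _ h hC i => (hT i).kill R (h i) hC⟩

theorem Closed.mul_pv {T : Set LQ} (hT : Closed T) {k p : LQ} (hk : k ∈ T) (hp : p ∈ pv) :
    k * p ∈ T := by
  obtain ⟨X, rfl⟩ := q_surj k
  obtain ⟨C, rfl⟩ := q_surj p
  rw [mul_comm, q_mul, par_eq_plug]
  exact hT.kill _ hk (pv_iff.1 hp)

theorem K1g {T : Set LQ} (hT : Closed T) {C X : LGraph} (R : Set C.V) {l : LQ}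
    (hC : q C ∈ T) (hX : q X * l ∈ pv) : q (C.plug R X) * l ∈ T := by
  obtain ⟨Y, rfl⟩ := q_surj l
  have h1 : q (C.plug R LGraph.empty) ∈ T := by rwa [q_eq.2 (plug_empty C R)]
  exact hT.der h1 (D_trans (D_plug C R ((pv_iff (X := X.par Y)).1 hX)) (D_plug_par _ _ _ _))

theorem K2g {T : Set LQ} (hT : Closed T) {C X : LGraph} (R : Set C.V) {l : LQ}
    (hX : q X ∈ T) (hC : q C * l ∈ pv) : q (C.plug R X) * l ∈ T := by
  obtain ⟨Y, rfl⟩ := q_surj l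
  rw [q_mul, q_eq.2 (plug_par_left C X Y R)]
  exact hT.kill _ hX ((pv_iff (X := C.par Y)).1 hC)

/-! Set versions -/

/-- `x` is a module relative to `c`, disjoint from it -/
def Mod (G : LGraph) (x c : Set G.V) : Prop :=
  (∀ v ∈ x, v ∉ c) ∧ ∀ v ∈ c, ∀ y ∈ x, ∀ z ∈ x, (G.adj v y ↔ G.adj v z)

theorem sub_plug {G : LGraph} {t r : Set G.V} (h : Mod G t r) :
    (sub G (t ∪ r)).iso ((sub G r).plug {v | ∃ y ∈ t, G.adj v.1 y} (sub G t)) := by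
  apply iso.symm
  refine iso_sub (H := (sub G r).plug {v | ∃ y ∈ t, G.adj v.1 y} (sub G t))
    (Sum.elim Subtype.val Subtype.val) ?_ ?_ ?_ ?_
  · rintro (⟨v, hv⟩ | ⟨v, hv⟩) (⟨w, hw⟩ | ⟨w, hw⟩) (hh : v = w)
    · subst hh; rfl
    · subst hh; exact absurd hv (h.1 _ hw)
    · subst hh; exact absurd hw (h.1 _ hv)
    · subst hh; rfl
  · intro y
    constructor
    · rintro (hy | hy)
      · exact ⟨Sum.inr ⟨y, hy⟩, rfl⟩
      · exact ⟨Sum.inl ⟨y, hy⟩, rfl⟩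
    · rintro ⟨⟨v, hv⟩ | ⟨v, hv⟩, rfl⟩
      · exact Or.inr hv
      · exact Or.inl hv
  · rintro (⟨v, hv⟩ | ⟨v, hv⟩) (⟨w, hw⟩ | ⟨w, hw⟩)
    · exact Iff.rfl
    · exact ⟨fun ⟨y, hy, ha⟩ => (h.2 v hv y hy w hw).1 ha, fun ha => ⟨w, hw, ha⟩⟩
    · exact ⟨fun ⟨y, hy, ha⟩ => G.symm ((h.2 w hw y hy v hv).1 ha), fun ha => ⟨v, hv, G.symm ha⟩⟩
    · exact Iff.rfl
  · rintro (⟨v, hv⟩ | ⟨v, hv⟩) <;> rfl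

theorem K1 {T : Set LQ} (hT : Closed T) {H : LGraph} {u1 u2 : Set H.V} (hM : Mod H u1 u2) {l : LQ}
    (h2 : q (sub H u2) ∈ T) (h1 : q (sub H u1) * l ∈ pv) : q (sub H (u1 ∪ u2)) * l ∈ T := by
  rw [q_eq.2 (sub_plug hM)]; exact K1g hT _ h2 h1

theorem K2 {T : Set LQ} (hT : Closed T) {H : LGraph} {u1 u2 : Set H.V} (hM : Mod H u1 u2) {l : LQ}
    (h1 : q (sub H u1) ∈ T) (h2 : q (sub H u2) * l ∈ pv) : q (sub H (u1 ∪ u2)) * l ∈ T := by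
  rw [q_eq.2 (sub_plug hM)]; exact K2g hT _ h1 h2

theorem set_kill {T : Set LQ} (hT : Closed T) {H : LGraph} {u1 u2 : Set H.V} (hM : Mod H u1 u2)
    (h2 : q (sub H u2) ∈ T) (h1 : q (sub H u1) ∈ pv) : q (sub H (u1 ∪ u2)) ∈ T := by
  have := K1 hT hM (l := 1) h2 (by simpa using h1)
  simpa using this

theorem set_ss {T : Set LQ} (hT : Closed T) {H : LGraph} {t r : Set H.V} (hM : Mod H t r)
    (h : q (sub H (t ∪ r)) ∈ T) : q (sub H t) * q (sub H r) ∈ T := by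
  rw [q_eq.2 (sub_plug hM)] at h
  rw [mul_comm]
  exact hT.der h (D_ss _ _ _)

theorem q_sub_par {H : LGraph} {t r : Set H.V} (hd : ∀ v ∈ t, v ∉ r)
    (h : ∀ v ∈ t, ∀ w ∈ r, ¬ H.adj v w) :
    q (sub H (t ∪ r)) = q (sub H t) * q (sub H r) := by
  have hM : Mod H t r := ⟨hd, fun v hv y hy z hz =>
    iff_of_false (fun h' => h y hy v hv (H.symm h')) (fun h' => h z hz v hv (H.symm h'))⟩
  rw [q_eq.2 (sub_plug hM), mul_comm, q_mul, par_eq_plug]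
  congr
  ext v
  exact ⟨fun ⟨y, hy, h'⟩ => h y hy v.1 v.2 (H.symm h'), fun h' => h'.elim⟩

theorem q_sub_empty {H : LGraph} : q (sub H ∅) = 1 :=
  q_of_isEmpty ⟨fun v => v.2⟩

end

section

namespace LGraph

/-- adjacency (`b = true`) or non-adjacency (`b = false`) of distinct vertices -/
def E (G : LGraph) (b : Bool) (x y : G.V) : Prop := x ≠ y ∧ (G.adj x y ↔ b = true)

theorem E.symm {G : LGraph} {b : Bool} {x y : G.V} (h : G.E b x y) : G.E b y x :=
  ⟨h.1.symm, by rw [← h.2]; exact ⟨G.symm, G.symm⟩⟩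

theorem adj_comm {G : LGraph} {x y : G.V} : G.adj x y ↔ G.adj y x := ⟨G.symm, G.symm⟩

/-- the graph with edges `E b` -/
def pol (P : LGraph) (b : Bool) : LGraph where
  V := P.V
  adj := P.E b
  symm := E.symm
  irrefl _ h := h.1 rfl
  label := P.label

theorem E_true {P : LGraph} {x y : P.V} : P.E true x y ↔ P.adj x y :=
  ⟨fun h => h.2.2 rfl, fun h => ⟨fun e => P.irrefl x (by rw [← e] at h; exact h), by simp [h]⟩⟩

theorem E_false {P : LGraph} {x y : P.V} : P.E false x y ↔ (x ≠ y ∧ ¬ P.adj x y) := by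
  simp [E]

theorem E_not {P : LGraph} {b : Bool} {x y : P.V} (h : x ≠ y) : P.E (!b) x y ↔ ¬ P.E b x y := by
  cases b <;> simp [E, h]

/-- complete / edgeless graph -/
def kgr (V : Type) [Fintype V] (b : Bool) : LGraph where
  V := V
  adj x y := x ≠ y ∧ b = true
  symm h := ⟨h.1.symm, h.2⟩
  irrefl _ h := h.1 rfl
  label _ := (0, true)

theorem cs (Q : LGraph) (K : Q.V → LGraph) (v : Q.V) (a b : (K v).V) :
    (Q.comp K).adj ⟨v, a⟩ ⟨v, b⟩ ↔ (K v).adj a b := compAdj_same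

theorem cd (Q : LGraph) (K : Q.V → LGraph) {v w : Q.V} (h : v ≠ w) (a : (K v).V) (b : (K w).V) :
    (Q.comp K).adj ⟨v, a⟩ ⟨w, b⟩ ↔ Q.adj v w := compAdj_diff (x := ⟨v, a⟩) (y := ⟨w, b⟩) h

theorem sig_inj {α : Type} {β : α → Type} {v : α} {a b : β v}
    (h : (⟨v, a⟩ : Sigma β) = ⟨v, b⟩) : a = b := eq_of_heq (Sigma.mk.inj h).2

theorem comp_iso {Q Q' : LGraph} (e : Q.V ≃ Q'.V) {K : Q.V → LGraph} {K' : Q'.V → LGraph}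
    (hQ : ∀ v w, v ≠ w → (Q.adj v w ↔ Q'.adj (e v) (e w)))
    (hK : ∀ v, (K v).iso (K' (e v))) : (Q.comp K).iso (Q'.comp K') := by
  let i := fun v => Classical.choice (hK v)
  let F : (Q.comp K).V → (Q'.comp K').V := fun x => ⟨e x.1, (i x.1).toEquiv x.2⟩
  refine iso_of F ⟨?_, ?_⟩ ?_ ?_
  · rintro ⟨v, x⟩ ⟨w, y⟩ h
    have h1 : e v = e w := congrArg Sigma.fst h
    have h1' := e.injective h1
    subst h1'
    have h2 : (i v).toEquiv x = (i v).toEquiv y := sig_inj h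
    rw [(i v).toEquiv.injective h2]
  · rintro ⟨w, y⟩
    obtain ⟨v, rfl⟩ := e.surjective w
    exact ⟨⟨v, (i v).toEquiv.symm y⟩, congrArg (Sigma.mk (e v)) ((i v).toEquiv.apply_symm_apply y)⟩
  · rintro ⟨v, x⟩ ⟨w, y⟩
    by_cases h : v = w
    · subst h
      rw [compAdj_same]
      exact ((i v).adj_iff x y).trans compAdj_same.symm
    · exact (cd Q _ h _ _).trans ((hQ v w h).trans
        (cd Q' K' (fun h' => h (e.injective h')) _ _).symm)
  · rintro ⟨v, x⟩
    exact (i v).label_eq x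

end LGraph

/-- cross-fiber adjacency on `u` is given by `Q` -/
def Fib (H Q : LGraph) (h : H.V → Q.V) (u : Set H.V) : Prop :=
  ∀ x ∈ u, ∀ y ∈ u, h x ≠ h y → (H.adj x y ↔ Q.adj (h x) (h y))

theorem Fib.mono {H Q : LGraph} {h : H.V → Q.V} {u u' : Set H.V} (hf : Fib H Q h u) (hu : u' ⊆ u) :
    Fib H Q h u' := fun x hx y hy => hf x (hu hx) y (hu hy)

theorem Fib.mod {H Q : LGraph} {h : H.V → Q.V} {u : Set H.V} (hf : Fib H Q h u) {j : Q.V}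
    {J : Set Q.V} (hj : j ∉ J) : Mod H (u ∩ h ⁻¹' {j}) (u ∩ h ⁻¹' J) := by
  refine ⟨?_, ?_⟩
  · rintro v ⟨_, hv⟩ ⟨_, hv'⟩
    exact hj ((show h v = j from hv) ▸ hv')
  · rintro v ⟨hv, hv'⟩ y ⟨hy, hy'⟩ z ⟨hz, hz'⟩
    have hy'' : h y = j := hy'
    have hz'' : h z = j := hz'
    have : h v ≠ j := fun e => hj (e ▸ hv')
    rw [hf v hv y hy (by rwa [hy'']), hf v hv z hz (by rwa [hz'']), hy'', hz'']

theorem fib_kill {T : Set LQ} (hT : Closed T) {H Q : LGraph} {h : H.V → Q.V} {u : Set H.V}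
    (hf : Fib H Q h u) (I : Finset Q.V) (h1 : q (sub H (u ∩ h ⁻¹' (I : Set Q.V)ᶜ)) ∈ T)
    (h2 : ∀ j ∈ I, q (sub H (u ∩ h ⁻¹' {j})) ∈ pv) : q (sub H u) ∈ T := by
  classical
  induction I using Finset.induction_on with
  | empty => simpa using h1
  | insert j I hj ih =>
    refine ih ?_ (fun i hi => h2 i (Finset.mem_insert_of_mem hi))
    have := set_kill hT (hf.mod (j := j) (J := ((insert j I : Finset Q.V) : Set Q.V)ᶜ) (by simp)) h1
      (h2 j (Finset.mem_insert_self _ _))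
    convert this using 4
    ext x
    simp only [Finset.coe_insert, Set.mem_inter_iff, Set.mem_preimage, Set.mem_compl_iff,
      Finset.mem_coe, Set.mem_union, Set.mem_singleton_iff, Set.mem_insert_iff]
    by_cases hx : h x = j
    · simp [hx, hj]
    · simp [hx]

theorem comp_fib (Q : LGraph) (K : Q.V → LGraph) :
    Fib (Q.comp K) Q (fun x => x.1) Set.univ := fun _ _ _ _ h => compAdj_diff h

theorem comp_fiber (Q : LGraph) (K : Q.V → LGraph) (p : Q.V) :
    (K p).iso (sub (Q.comp K) (Set.univ ∩ (fun x => x.1) ⁻¹' {p})) := by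
  refine iso_sub (fun x => ⟨p, x⟩) ?_ ?_ ?_ ?_
  · intro x y h; exact sig_inj h
  · rintro ⟨w, y⟩
    constructor
    · rintro ⟨_, h⟩
      obtain rfl : w = p := h
      exact ⟨y, rfl⟩
    · rintro ⟨x, h⟩
      exact ⟨trivial, (congrArg Sigma.fst h).symm⟩
  · intro x y; exact compAdj_same.symm
  · intro x; rfl

theorem comp_kill {T : Set LQ} (hT : Closed T) {Q : LGraph} {K : Q.V → LGraph} (i : Q.V)
    (hi : q (K i) ∈ T) (h : ∀ j, j ≠ i → q (K j) ∈ pv) : q (Q.comp K) ∈ T := by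
  classical
  rw [q_eq.2 (sub_univ _)]
  refine fib_kill hT (comp_fib Q K) (Finset.univ.erase i) ?_ ?_
  · rw [q_eq.2 (comp_fiber Q K i)] at hi
    convert hi using 4
    ext x; simp
  · intro j hj
    rw [← q_eq.2 (comp_fiber Q K j)]
    exact h j (by simpa using hj)

theorem comp_kill_all {Q : LGraph} {K : Q.V → LGraph} 
    (h : ∀ j, q (K j) ∈ pv) : q (Q.comp K) ∈ pv := by
  classical
  rw [q_eq.2 (sub_univ _)]
  refine fib_kill pv_closed (comp_fib Q K) Finset.univ ?_ ?_
  · simp only [Finset.coe_univ, Set.compl_univ, Set.preimage_empty, Set.inter_empty]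
    rw [q_sub_empty]; exact one_pv
  · intro j hj
    rw [← q_eq.2 (comp_fiber Q K j)]
    exact h j

theorem sub_comp {G Q : LGraph} {f : G.V → Q.V} {u : Set G.V} (hf : Fib G Q f u) :
    (Q.comp (fun p => sub G (u ∩ f ⁻¹' {p}))).iso (sub G u) := by
  refine iso_sub (H := Q.comp (fun p => sub G (u ∩ f ⁻¹' {p}))) (fun x => x.2.1) ?_ ?_ ?_ ?_
  · rintro ⟨v, x, hx, hx'⟩ ⟨w, y, hy, hy'⟩ (h : x = y)
    subst h
    obtain rfl : f x = v := hx'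
    obtain rfl : f x = w := hy'
    rfl
  · intro y
    constructor
    · intro hy; exact ⟨⟨f y, y, hy, rfl⟩, rfl⟩
    · rintro ⟨⟨v, x, hx, hx'⟩, rfl⟩; exact hx
  · rintro ⟨v, x, hx, hx'⟩ ⟨w, y, hy, hy'⟩
    by_cases h : v = w
    · subst h
      exact compAdj_same
    · obtain rfl : f x = v := hx'
      obtain rfl : f y = w := hy'
      exact (cd Q _ h _ _).trans (hf x hx y hy h).symm
  · rintro ⟨v, x, hx, hx'⟩; rfl

theorem comp_par {T : Set LQ} (hT : Closed T) {Q : LGraph} {K M : Q.V → LGraph}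
    (h : q (Q.comp (fun v => (K v).par (M v))) ∈ T) : q (Q.comp K) * ∏ v, q (M v) ∈ T := by
  classical
  let H := Q.comp (fun v => (K v).par (M v))
  let w : Finset Q.V → Set H.V := fun I => {x | x.1 ∈ I → ∃ k, x.2 = Sum.inl k}
  have hcs : ∀ v (a b : (K v).V ⊕ (M v).V),
      H.adj ⟨v, a⟩ ⟨v, b⟩ ↔ ((K v).par (M v)).adj a b :=
    cs Q (fun v => (K v).par (M v))
  have key : ∀ I : Finset Q.V, q (sub H (w I)) * ∏ v ∈ I, q (M v) ∈ T := by
    intro I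
    induction I using Finset.induction_on with
    | empty =>
      have : w ∅ = Set.univ := by ext x; simp [w]
      rw [this, ← q_eq.2 (sub_univ H)]; simpa using h
    | insert j I hj ih =>
      let m : Set H.V := {x | x.1 = j ∧ ¬ ∃ k, x.2 = Sum.inl k}
      have hw : w I = m ∪ w (insert j I) := by
        ext x
        by_cases hx : x.1 = j
        · have : x.1 ∉ I := by rw [hx]; exact hj
          simp only [w, m, Set.mem_union, Finset.mem_insert]
          change (_ → _) ↔ (_ ∧ _) ∨ (_ → _)
          tauto
        · simp only [w, m, Set.mem_union, Finset.mem_insert]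
          change (_ → _) ↔ (_ ∧ _) ∨ (_ → _)
          tauto
      have hM : Mod H m (w (insert j I)) := by
        constructor
        · rintro x ⟨h1, h2⟩ h3
          exact h2 (h3 (by rw [h1]; exact Finset.mem_insert_self _ _))
        · rintro ⟨v, x⟩ hv ⟨y1, y⟩ ⟨hy1, hy⟩ ⟨z1, z⟩ ⟨hz1, hz⟩
          change y1 = j at hy1
          change z1 = j at hz1
          subst hy1
          subst hz1
          by_cases hvj : v = z1
          · subst hvj
            obtain ⟨k, rfl⟩ : ∃ k, x = Sum.inl k := hv (Finset.mem_insert_self _ _)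
            rcases y with y | y
            · exact absurd ⟨y, rfl⟩ hy
            rcases z with z | z
            · exact absurd ⟨z, rfl⟩ hz
            have hyz : ((K v).par (M v)).adj (Sum.inl k) (Sum.inr y) ↔
                ((K v).par (M v)).adj (Sum.inl k) (Sum.inr z) := Iff.rfl
            exact (hcs v _ _).trans (Iff.trans hyz (hcs v _ (Sum.inr z)).symm)
          · exact (cd Q _ hvj _ _).trans (cd Q _ hvj _ _).symm
      have hm : q (M j) = q (sub H m) := by
        refine q_eq.2 (iso_sub (fun x => ⟨j, Sum.inr x⟩) ?_ ?_ ?_ ?_)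
        · intro x y h; exact Sum.inr.inj (sig_inj (β := fun v => (K v).V ⊕ (M v).V) (v := j) h)
        · rintro ⟨v, y⟩
          constructor
          · rintro ⟨h1, h2⟩
            change v = j at h1
            subst h1
            rcases y with y | y
            · exact absurd ⟨y, rfl⟩ h2
            · exact ⟨y, rfl⟩
          · rintro ⟨x, hx⟩
            cases hx
            exact ⟨rfl, fun ⟨k, hk⟩ => by simp at hk⟩
        · intro x y; exact Iff.trans Iff.rfl (hcs j (Sum.inr x) (Sum.inr y)).symm
        · intro x; rfl
      rw [hw] at ih
      have := set_ss (hT.shift _) hM ih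
      rw [Finset.prod_insert hj, hm]
      change _ * _ * _ ∈ T at this
      convert this using 1
      ac_rfl
  have hK : q (Q.comp K) = q (sub H (w Finset.univ)) := by
    refine q_eq.2 (iso_sub (H := Q.comp K) (fun x => ⟨x.1, Sum.inl x.2⟩) ?_ ?_ ?_ ?_)
    · rintro ⟨v, x⟩ ⟨v', y⟩ h
      cases h; rfl
    · rintro ⟨v, y⟩
      constructor
      · intro hh
        obtain ⟨k, hk⟩ := hh (Finset.mem_univ _)
        change (K v).V at k
        obtain rfl : y = Sum.inl k := hk
        exact ⟨⟨v, k⟩, rfl⟩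
      · rintro ⟨x, hx⟩
        cases hx
        exact fun _ => ⟨_, rfl⟩
    · rintro ⟨v, x⟩ ⟨v', y⟩
      by_cases h : v = v'
      · subst h
        exact (cs Q _ v _ _).trans (Iff.trans Iff.rfl (hcs v (Sum.inl x) (Sum.inl y)).symm)
      · exact (cd Q _ h _ _).trans (cd Q _ h _ _).symm
    · intro x; rfl
  rw [hK]; exact key Finset.univ

theorem tensor_congr {A A' B B' : LGraph} (h : A.iso A') (h' : B.iso B') :
    (A.tensor B).iso (A'.tensor B') := by
  obtain ⟨e, ha, hl⟩ := h
  obtain ⟨e', ha', hl'⟩ := h'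
  refine ⟨⟨Equiv.sumCongr e e', ?_, ?_⟩⟩
  · rintro (v | v) (w | w) <;>
      first | exact ha _ _ | exact ha' _ _ | exact Iff.rfl
  · rintro (v | v)
    · exact hl _
    · exact hl' _

def succMap (n : ℕ) (b : Bool) (F : Fin (n + 1) → LGraph) :
    (F 0).V ⊕ ((kgr (Fin n) b).comp (fun i => F i.succ)).V → ((kgr (Fin (n + 1)) b).comp F).V
  | .inl x => ⟨(0 : Fin (n + 1)), x⟩
  | .inr x => ⟨Fin.succ x.1, x.2⟩

theorem succMap_bij (n : ℕ) (b : Bool) (F : Fin (n + 1) → LGraph) :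
    Function.Bijective (succMap n b F) := by
  constructor
  · rintro (x | ⟨i, x⟩) (y | ⟨j, y⟩) h
    · have : x = y := sig_inj h
      rw [this]
    · exact absurd (congrArg Sigma.fst h).symm (Fin.succ_ne_zero j)
    · exact absurd (congrArg Sigma.fst h) (Fin.succ_ne_zero i)
    · have := Fin.succ_injective _ (congrArg Sigma.fst h)
      change i = j at this
      subst this
      have : x = y := sig_inj h
      rw [this]
  · rintro ⟨i, x⟩
    change Fin (n + 1) at i
    induction i using Fin.cases with
    | zero => exact ⟨.inl x, rfl⟩
    | succ i => exact ⟨.inr ⟨i, x⟩, rfl⟩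

theorem big_adj (n : ℕ) (b : Bool) (F : Fin (n + 1) → LGraph) :
    (∀ x y : (F 0).V, ((kgr (Fin (n + 1)) b).comp F).adj (succMap n b F (.inl x))
      (succMap n b F (.inl y)) ↔ (F 0).adj x y) ∧
    (∀ x y, ((kgr (Fin (n + 1)) b).comp F).adj (succMap n b F (.inl x))
      (succMap n b F (.inr y)) ↔ b = true) ∧
    (∀ x y, ((kgr (Fin (n + 1)) b).comp F).adj (succMap n b F (.inr x))
      (succMap n b F (.inl y)) ↔ b = true) ∧
    (∀ x y, ((kgr (Fin (n + 1)) b).comp F).adj (succMap n b F (.inr x))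
      (succMap n b F (.inr y)) ↔ ((kgr (Fin n) b).comp (fun i => F i.succ)).adj x y) := by
  refine ⟨fun x y => cs (kgr (Fin (n + 1)) b) F (0 : Fin (n + 1)) x y, ?_, ?_, ?_⟩
  · rintro x ⟨j, y⟩
    refine (cd (kgr (Fin (n + 1)) b) F (v := (0 : Fin (n + 1))) (w := Fin.succ j)
      (Fin.succ_ne_zero j).symm x y).trans ?_
    exact ⟨fun h => h.2, fun h => ⟨(Fin.succ_ne_zero j).symm, h⟩⟩
  · rintro ⟨j, y⟩ x
    refine (cd (kgr (Fin (n + 1)) b) F (w := (0 : Fin (n + 1))) (v := Fin.succ j)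
      (Fin.succ_ne_zero j) y x).trans ?_
    exact ⟨fun h => h.2, fun h => ⟨(Fin.succ_ne_zero j), h⟩⟩
  · rintro ⟨i, x⟩ ⟨j, y⟩
    by_cases h : i = j
    · subst h
      exact (cs (kgr (Fin (n + 1)) b) F (Fin.succ i) x y).trans
        (cs (kgr (Fin n) b) (fun i => F (Fin.succ i)) i x y).symm
    · have h' : Fin.succ i ≠ Fin.succ j := fun h' => h (Fin.succ_injective _ h')
      refine (cd (kgr (Fin (n + 1)) b) F h' x y).trans (Iff.trans ?_
        (cd (kgr (Fin n) b) (fun i => F (Fin.succ i)) h x y).symm)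
      exact ⟨fun hh => ⟨h, hh.2⟩, fun hh => ⟨h', hh.2⟩⟩

theorem bigTensor_iso : ∀ (n : ℕ) (F : Fin n → LGraph),
    (bigTensor n F).iso ((kgr (Fin n) true).comp F)
  | 0, F => (q_eq.1 (q_of_isEmpty (G := (kgr (Fin 0) true).comp F) ⟨fun x => Fin.elim0 x.1⟩)).symm
  | n + 1, F => by
    refine (tensor_congr (iso.refl _) (bigTensor_iso n fun i => F i.succ)).trans ?_
    obtain ⟨h1, h2, h3, h4⟩ := big_adj n true F
    refine iso_of (G := (F 0).tensor _) (succMap n true F) (succMap_bij n true F) ?_ ?_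
    · rintro (x | x) (y | y)
      · exact (h1 x y).symm
      · exact iff_of_true trivial ((h2 x y).2 rfl)
      · exact iff_of_true trivial ((h3 x y).2 rfl)
      · exact (h4 x y).symm
    · rintro (x | ⟨i, x⟩) <;> rfl

theorem bigPar_iso : ∀ (n : ℕ) (F : Fin n → LGraph),
    (bigPar n F).iso ((kgr (Fin n) false).comp F)
  | 0, F => (q_eq.1 (q_of_isEmpty (G := (kgr (Fin 0) false).comp F) ⟨fun x => Fin.elim0 x.1⟩)).symm
  | n + 1, F => by
    refine (par_congr (iso.refl _) (bigPar_iso n fun i => F i.succ)).trans ?_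
    obtain ⟨h1, h2, h3, h4⟩ := big_adj n false F
    refine iso_of (G := (F 0).par _) (succMap n false F) (succMap_bij n false F) ?_ ?_
    · rintro (x | x) (y | y)
      · exact (h1 x y).symm
      · exact iff_of_false (fun h => h) (fun h => Bool.noConfusion ((h2 x y).1 h))
      · exact iff_of_false (fun h => h) (fun h => Bool.noConfusion ((h3 x y).1 h))
      · exact (h4 x y).symm
    · rintro (x | ⟨i, x⟩) <;> rfl

theorem p_rule0 {T : Set LQ} (hT : Closed T) {P : LGraph} (hP : P.Prime)
    (h4 : 4 ≤ Fintype.card P.V) {K L : P.V → LGraph} (hK : ∀ v, Nonempty (K v).V)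
    (h : q ((kgr P.V true).comp fun v => (K v).par (L v)) ∈ T) :
    q ((pol P false).comp K) * q ((pol P true).comp L) ∈ T := by
  let e := Fintype.equivFin P.V
  have hr := GSRule.p (Fintype.card P.V) P e (fun i => K (e.symm i)) (fun i => L (e.symm i)) hP h4
    (fun i => hK _)
  have h1 : q ((kgr P.V true).comp fun v => (K v).par (L v)) =
      q (bigTensor (Fintype.card P.V) fun i => (K (e.symm i)).par (L (e.symm i))) := by
    refine q_eq.2 (iso.trans ?_ (bigTensor_iso _ _).symm)
    refine comp_iso (Q := kgr P.V true) (Q' := kgr (Fin (Fintype.card P.V)) true) e ?_ ?_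
    · intro v w hvw
      exact iff_of_true ⟨hvw, rfl⟩ ⟨fun h => hvw (e.injective h), rfl⟩
    · intro v
      change P.V at v
      change ((K v).par (L v)).iso ((K (e.symm (e v))).par (L (e.symm (e v))))
      rw [e.symm_apply_apply]; exact iso.refl _
  rw [h1] at h
  have h2 := hT.der h (rule_D hr)
  rw [← q_mul] at h2
  convert h2 using 2
  · refine q_eq.2 (comp_iso (Q := pol P false) (Q' := P.dual) (Equiv.refl _) ?_ ?_)
    · intro v w _; exact E_false (P := P) (x := v) (y := w)
    · intro v
      change P.V at v
      change (K v).iso (K (e.symm (e v)))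
      rw [e.symm_apply_apply]; exact iso.refl _
  · refine q_eq.2 (comp_iso (Q := pol P true) (Q' := P) (Equiv.refl _) ?_ ?_)
    · intro v w _; exact E_true (P := P) (x := v) (y := w)
    · intro v
      change P.V at v
      change (L v).iso (L (e.symm (e v)))
      rw [e.symm_apply_apply]; exact iso.refl _

theorem p_rule {T : Set LQ} (hT : Closed T) {P : LGraph} (hP : P.Prime)
    (h4 : 4 ≤ Fintype.card P.V) {K L : P.V → LGraph} (hK : ∀ v, Nonempty (K v).V)
    (hL : ∀ v, Nonempty (L v).V) (b : Bool)
    (h : q ((kgr P.V true).comp fun v => (K v).par (L v)) ∈ T) :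
    q ((pol P (!b)).comp K) * q ((pol P b).comp L) ∈ T := by
  cases b with
  | true => exact p_rule0 hT hP h4 hK h
  | false =>
    rw [mul_comm]
    refine p_rule0 hT hP h4 hL ?_
    convert h using 1
    exact q_eq.2 (comp_iso (Q := kgr P.V true) (Q' := kgr P.V true) (Equiv.refl _)
      (fun _ _ _ => Iff.rfl) (fun v => par_comm _ _))

end

section

/-- `t` is separated from `s \ t` by all `b`-edges -/
def Sep (G : LGraph) (b : Bool) (s t : Set G.V) : Prop :=
  t ⊆ s ∧ t.Nonempty ∧ (s \ t).Nonempty ∧ ∀ x ∈ t, ∀ y ∈ s \ t, G.E b x y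

def Full (G : LGraph) (b : Bool) (t r : Set G.V) : Prop := ∀ x ∈ t, ∀ y ∈ r, G.E b x y

structure Decomp (G : LGraph) (s : Set G.V) (P : LGraph) (f : G.V → P.V) : Prop where
  prime : P.Prime
  card : 4 ≤ Fintype.card P.V
  surj : ∀ p, ∃ x ∈ s, f x = p
  fib : Fib G P f s

theorem E_excl {G : LGraph} {b : Bool} {x y : G.V} (h : G.E b x y) (h' : G.E (!b) x y) : False :=
  (E_not h.1).1 h' h

theorem E_or {G : LGraph} (b : Bool) {x y : G.V} (h : x ≠ y) : G.E b x y ∨ G.E (!b) x y := by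
  rw [E_not h]; tauto

theorem Sep.symm {G : LGraph} {b : Bool} {s t : Set G.V} (h : Sep G b s t) : Sep G b s (s \ t) := by
  obtain ⟨h1, h2, h3, h4⟩ := h
  have : s \ (s \ t) = t := by simpa using h1
  refine ⟨Set.sdiff_subset, h3, by rwa [this], ?_⟩
  rw [this]
  exact fun x hx y hy => (h4 y hy x hx).symm

theorem sep_excl {G : LGraph} {b : Bool} {s t t' : Set G.V} (h : Sep G b s t)
    (h' : Sep G (!b) s t') : False := by
  obtain ⟨h1, ⟨a, ha⟩, ⟨c, hc, hc'⟩, h4⟩ := h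
  obtain ⟨h1', ⟨a', ha'⟩, ⟨c', hc2, hc2'⟩, h4'⟩ := h'
  have key : ∀ x ∈ t', ∀ y ∈ s, y ∉ t' → (x ∈ t ↔ y ∈ t) := by
    intro x hx y hy hy'
    have e := h4' x hx y ⟨hy, hy'⟩
    constructor
    · intro hxt
      by_contra hyt
      exact E_excl (h4 x hxt y ⟨hy, hyt⟩) e
    · intro hyt
      by_contra hxt
      exact E_excl (h4 y hyt x ⟨h1' hx, hxt⟩) e.symm
  by_cases hat : a ∈ t' <;> by_cases hct : c ∈ t'
  · exact hc' ((key c hct c' hc2 hc2').2 ((key a hat c' hc2 hc2').1 ha))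
  · exact hc' ((key a hat c hc hct).1 ha)
  · exact hc' ((key c hct a (h1 ha) hat).2 ha)
  · exact hc' ((key a' ha' c hc hct).1 ((key a' ha' a (h1 ha) hat).2 ha))

theorem sep_excl' {G : LGraph} {b b' : Bool} {s t t' : Set G.V} (h : Sep G b s t)
    (h' : Sep G b' s t') : b = b' := by
  by_contra hne
  have : b' = !b := by cases b <;> cases b' <;> simp_all
  subst this
  exact sep_excl h h'

theorem Sep.mod {G : LGraph} {b : Bool} {s t : Set G.V} (h : Sep G b s t) : Mod G t (s \ t) := by
  refine ⟨fun v hv hv' => hv'.2 hv, fun v hv y hy z hz => ?_⟩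
  rw [(h.2.2.2 y hy v hv).symm.2, (h.2.2.2 z hz v hv).symm.2]

namespace Decomp
variable {G : LGraph} {s : Set G.V} {P : LGraph} {f : G.V → P.V}

theorem two (h : Decomp G s P f) (a c : P.V) : ∃ d, d ≠ a ∧ d ≠ c := by
  classical
  by_contra hn
  push Not at hn
  have : (Finset.univ : Finset P.V) ⊆ {a, c} := by
    intro d _
    by_cases hd : d = a
    · simp [hd]
    · simp [hn d hd]
  have h1 := Finset.card_le_card this
  have h2 : ({a, c} : Finset P.V).card ≤ 2 := Finset.card_le_two
  have h3 := h.card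
  rw [Finset.card_univ] at h1
  omega

theorem mod_fiber (h : Decomp G s P f) {x : Set G.V} (hx : x ⊆ s) (hM : Mod G x (s \ x))
    (hne : x ≠ s) : ∃ p, ∀ v ∈ x, f v = p := by
  have hmod : P.IsModule (f '' x) := by
    rintro v hv _ ⟨y, hy, rfl⟩ _ ⟨z, hz, rfl⟩
    obtain ⟨w, hw, rfl⟩ := h.surj v
    have hwx : w ∉ x := fun hwx => hv ⟨w, hwx, rfl⟩
    rw [← h.fib w hw y (hx hy) (fun e => hv ⟨y, hy, e.symm⟩),
      ← h.fib w hw z (hx hz) (fun e => hv ⟨z, hz, e.symm⟩)]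
    exact hM.2 w ⟨hw, hwx⟩ y hy z hz
  rcases h.prime.2 _ hmod with h0 | ⟨p, h0⟩ | h0
  · rw [Set.image_eq_empty] at h0
    have : 0 < Fintype.card P.V := by have := h.card; omega
    obtain ⟨p⟩ := Fintype.card_pos_iff.1 this
    exact ⟨p, by simp [h0]⟩
  · refine ⟨p, fun v hv => ?_⟩
    have : f v ∈ f '' x := ⟨v, hv, rfl⟩
    rw [h0] at this
    exact this
  · exfalso
    obtain ⟨w, hw, hwx⟩ : ∃ w ∈ s, w ∉ x := by
      by_contra hn
      push Not at hn
      exact hne (Set.Subset.antisymm hx hn)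
    have hmod2 : P.IsModule {f w}ᶜ := by
      intro v hv a ha c hc
      have hv : v = f w := by simpa using hv
      subst hv
      obtain ⟨y, hy, rfl⟩ : a ∈ f '' x := by rw [h0]; trivial
      obtain ⟨z, hz, rfl⟩ : c ∈ f '' x := by rw [h0]; trivial
      rw [← h.fib w hw y (hx hy) (fun e => ha e.symm),
        ← h.fib w hw z (hx hz) (fun e => hc e.symm)]
      exact hM.2 w ⟨hw, hwx⟩ y hy z hz
    rcases h.prime.2 _ hmod2 with h0 | ⟨p, h0⟩ | h0
    · obtain ⟨d, hd, _⟩ := h.two (f w) (f w)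
      have : d ∈ ({f w}ᶜ : Set P.V) := hd
      rw [h0] at this
      exact this
    · obtain ⟨d, hd, hd'⟩ := h.two (f w) p
      have : d ∈ ({f w}ᶜ : Set P.V) := hd
      rw [h0] at this
      exact hd' this
    · have : f w ∈ ({f w}ᶜ : Set P.V) := by rw [h0]; trivial
      exact this rfl

theorem not_sep (h : Decomp G s P f) {b : Bool} {t : Set G.V} (ht : Sep G b s t) : False := by
  have ht' := ht.symm
  have hne : ∀ {t}, Sep G b s t → t ≠ s := by
    rintro t ⟨_, _, h3, _⟩ rfl
    simp at h3
  obtain ⟨p, hp⟩ := h.mod_fiber ht.1 ht.mod (hne ht)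
  obtain ⟨p', hp'⟩ := h.mod_fiber ht'.1 ht'.mod (hne ht')
  obtain ⟨d, hd, hd'⟩ := h.two p p'
  obtain ⟨x, hx, rfl⟩ := h.surj d
  by_cases hxt : x ∈ t
  · exact hd (hp x hxt)
  · exact hd' (hp' x ⟨hx, hxt⟩)

theorem fiber_mod (h : Decomp G s P f) (p : P.V) :
    Mod G (s ∩ f ⁻¹' {p}) (s \ (s ∩ f ⁻¹' {p})) := by
  have := h.fib.mod (j := p) (J := {p}ᶜ) (by simp)
  convert this using 1
  ext x
  simp

theorem fiber_nonempty (h : Decomp G s P f) (p : P.V) : (s ∩ f ⁻¹' {p}).Nonempty := by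
  obtain ⟨x, hx, hxp⟩ := h.surj p
  exact ⟨x, hx, hxp⟩

theorem fiber_ne (h : Decomp G s P f) (p : P.V) : s ∩ f ⁻¹' {p} ≠ s := by
  obtain ⟨d, hd, _⟩ := h.two p p
  obtain ⟨x, hx, rfl⟩ := h.surj d
  intro e
  rw [← e] at hx
  exact hd hx.2

theorem fiber_ssub (h : Decomp G s P f) (p : P.V) : s ∩ f ⁻¹' {p} ⊂ s :=
  ⟨Set.inter_subset_left, fun h' => h.fiber_ne p (Set.Subset.antisymm Set.inter_subset_left h')⟩

theorem compl_ssub (h : Decomp G s P f) (p : P.V) : s \ f ⁻¹' {p} ⊂ s := by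
  refine ⟨Set.sdiff_subset, fun h' => ?_⟩
  obtain ⟨x, hx, hxp⟩ := h.surj p
  exact (h' hx).2 hxp

theorem same_fibers (h : Decomp G s P f) {P' : LGraph} {f' : G.V → P'.V} (h' : Decomp G s P' f')
    {x y : G.V} (hx : x ∈ s) (hy : y ∈ s) (e : f x = f y) : f' x = f' y := by
  obtain ⟨p, hp⟩ := h'.mod_fiber Set.inter_subset_left (h.fiber_mod (f y)) (h.fiber_ne _)
  rw [hp x ⟨hx, e⟩, hp y ⟨hy, rfl⟩]

theorem unique (h : Decomp G s P f) {P' : LGraph} {f' : G.V → P'.V} (h' : Decomp G s P' f') :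
    ∃ e : P.V ≃ P'.V, (∀ x ∈ s, f' x = e (f x)) ∧ ∀ v w, P.adj v w ↔ P'.adj (e v) (e w) := by
  choose g hg1 hg2 using h.surj
  have hbij : Function.Bijective (fun p => f' (g p)) := by
    constructor
    · intro p p' hpp
      have := h'.same_fibers h (hg1 p) (hg1 p') hpp
      rwa [hg2, hg2] at this
    · intro p
      obtain ⟨x, hx, rfl⟩ := h'.surj p
      exact ⟨f x, h.same_fibers h' (hg1 _) hx (hg2 _)⟩
  refine ⟨Equiv.ofBijective _ hbij, ?_, ?_⟩
  · intro x hx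
    exact h.same_fibers h' hx (hg1 _) (hg2 _).symm
  · intro v w
    by_cases hvw : v = w
    · subst hvw
      exact iff_of_false (P.irrefl _) (P'.irrefl _)
    · have h1 := h.fib (g v) (hg1 v) (g w) (hg1 w) (by rwa [hg2, hg2])
      have h2 := h'.fib (g v) (hg1 v) (g w) (hg1 w) (fun e => hvw (hbij.1 e))
      rw [hg2, hg2] at h1
      rw [← h1, h2]; rfl

end Decomp

/-! Existence of decompositions -/

theorem decomp_exists_aux {G : LGraph} {s : Set G.V} (n : ℕ) : ∀ (P : LGraph) (f : G.V → P.V),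
    Fintype.card P.V = n → 2 ≤ n → (∀ p, ∃ x ∈ s, f x = p) → Fib G P f s →
    (∃ b t, Sep G b s t) ∨ ∃ P f, Decomp G s P f := by
  classical
  induction n using Nat.strong_induction_on with
  | _ n ih =>
  intro P f hn h2 hs hf
  by_cases hP : P.Prime
  · by_cases h4 : 4 ≤ n
    · exact Or.inr ⟨P, f, hP, by omega, hs, hf⟩
    left
    have h3 : n = 2 ∨ n = 3 := by omega
    rcases h3 with rfl | rfl
    · rw [← Finset.card_univ, Finset.card_eq_two] at hn
      obtain ⟨a, c, hac, hu⟩ := hn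
      refine ⟨decide (P.adj a c), s ∩ f ⁻¹' {a}, Set.inter_subset_left, ?_, ?_, ?_⟩
      · obtain ⟨x, hx, h⟩ := hs a
        exact ⟨x, hx, h⟩
      · obtain ⟨x, hx, h⟩ := hs c
        exact ⟨x, hx, fun h' => hac (h'.2.symm.trans h)⟩
      · rintro x ⟨hx, hxa⟩ y ⟨hy, hya⟩
        have hxa : f x = a := hxa
        have hyc : f y = c := by
          have h1 : f y ∈ (Finset.univ : Finset P.V) := Finset.mem_univ _
          rw [hu] at h1
          simp only [Finset.mem_insert, Finset.mem_singleton] at h1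
          exact h1.resolve_left (fun h => hya ⟨hy, h⟩)
        refine ⟨?_, ?_⟩
        · rintro rfl; exact hac (hxa.symm.trans hyc)
        · rw [hf x hx y hy (by rw [hxa, hyc]; exact hac), hxa, hyc]; simp
    · exfalso
      rw [← Finset.card_univ, Finset.card_eq_three] at hn
      obtain ⟨a, b, c, hab, hac, hbc, hu⟩ := hn
      have hmem : ∀ v : P.V, v = a ∨ v = b ∨ v = c := by
        intro v
        have h1 : v ∈ (Finset.univ : Finset P.V) := Finset.mem_univ _
        rw [hu] at h1
        simpa using h1
      have key : ∀ a b c : P.V, a ≠ b → a ≠ c → b ≠ c → (∀ v : P.V, v = a ∨ v = b ∨ v = c) →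
          (P.adj a b ↔ P.adj a c) → False := by
        intro a b c hab hac hbc hm h
        have hM : P.IsModule {b, c} := by
          intro v hv x hx y hy
          have hva : v = a := by
            rcases hm v with h | h | h
            · exact h
            · exact absurd (by simp [h]) hv
            · exact absurd (by simp [h]) hv
          subst hva
          rcases hx with rfl | rfl <;> rcases hy with rfl | rfl <;> simp [h]
        rcases hP.2 _ hM with h0 | ⟨v, h0⟩ | h0
        · have : b ∈ ({b, c} : Set P.V) := by simp
          rw [h0] at this; exact this
        · have h1 : b ∈ ({b, c} : Set P.V) := by simp
          have h2 : c ∈ ({b, c} : Set P.V) := by simp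
          rw [h0] at h1 h2
          exact hbc (h1.trans h2.symm)
        · have : a ∈ ({b, c} : Set P.V) := by rw [h0]; trivial
          rcases this with h | h
          · exact hab h
          · exact hac h
      by_cases e1 : P.adj a b ↔ P.adj a c
      · exact key a b c hab hac hbc hmem e1
      by_cases e2 : P.adj b a ↔ P.adj b c
      · exact key b a c hab.symm hbc hac (fun v => by rcases hmem v with h | h | h <;> simp [h]) e2
      refine key c a b hac.symm hbc.symm hab (fun v => by rcases hmem v with h | h | h <;> simp [h]) ?_
      rw [adj_comm (x := c), adj_comm (x := c)]
      rw [adj_comm (x := b) (y := a)] at e2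
      tauto
  · have hnp : ∃ M : Set P.V, P.IsModule M ∧ ¬ (M = ∅ ∨ (∃ v, M = {v}) ∨ M = Set.univ) := by
      by_contra hn'
      push Not at hn'
      exact hP ⟨by omega, hn'⟩
    obtain ⟨M, hM, hnt⟩ := hnp
    push Not at hnt
    obtain ⟨hne, hns, hnu⟩ := hnt
    have hne' : M.Nonempty := by
      rw [Set.nonempty_iff_ne_empty]; simpa [Set.nonempty_iff_ne_empty] using hne
    obtain ⟨m, hm⟩ := hne'
    obtain ⟨m', hm', hmm'⟩ : ∃ m' ∈ M, m' ≠ m := by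
      by_contra hc
      push Not at hc
      exact hns m (Set.Subset.antisymm (fun x hx => hc x hx) (by simpa using hm))
    obtain ⟨w, hw⟩ : ∃ w, w ∉ M := by
      by_contra hc
      push Not at hc
      exact hnu (Set.eq_univ_of_forall hc)
    let r : Set P.V := {v | v ∈ M → v = m}
    have hmr : m ∈ r := fun _ => rfl
    let g : P.V → P.V := fun v => if v ∈ M then m else v
    have hgr : ∀ v, g v ∈ r := by
      intro v
      by_cases hv : v ∈ M
      · simp only [g, hv, if_true]; exact hmr
      · simp only [g, hv, if_false]; exact fun h => absurd h hv
    let f' : G.V → (sub P r).V := fun x => ⟨g (f x), hgr _⟩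
    have hcard : Fintype.card (sub P r).V < Fintype.card P.V := by
      refine Fintype.card_lt_of_injective_of_notMem (fun x : (sub P r).V => (x.1 : P.V))
        (fun x y h => Subtype.ext h) (b := m') ?_
      rintro ⟨x, hx⟩
      have : m' ∈ r := hx ▸ x.2
      exact hmm' (this hm')
    have hcard2 : 2 ≤ Fintype.card (sub P r).V := by
      have : Fintype.card Bool ≤ Fintype.card (sub P r).V := by
        refine Fintype.card_le_of_injective
          (fun b : Bool => (if b then ⟨m, hmr⟩ else ⟨w, fun h => absurd h hw⟩ : (sub P r).V)) ?_
        have hmw : m ≠ w := fun h => hw (h ▸ hm)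
        intro b b' h
        have h := congrArg (fun x : (sub P r).V => (x.1 : P.V)) h
        cases b <;> cases b'
        · rfl
        · exact absurd h.symm hmw
        · exact absurd h hmw
        · rfl
      simpa using this
    refine ih _ (by omega) (sub P r) f' rfl hcard2 ?_ ?_
    · rintro ⟨p, hp⟩
      obtain ⟨x, hx, rfl⟩ := hs p
      refine ⟨x, hx, Subtype.ext ?_⟩
      change g (f x) = f x
      by_cases h : f x ∈ M
      · simp only [g, h, if_true]; exact (hp h).symm
      · simp only [g, h, if_false]
    · intro x hx y hy hxy
      change G.adj x y ↔ P.adj (g (f x)) (g (f y))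
      have hxy : g (f x) ≠ g (f y) := fun h => hxy (Subtype.ext h)
      rw [hf x hx y hy (fun h => hxy (by rw [h]))]
      by_cases h1 : f x ∈ M <;> by_cases h2 : f y ∈ M
      · simp only [g, h1, h2, if_true] at hxy; exact absurd rfl hxy
      · simp only [g, h1, h2, if_true, if_false]
        rw [adj_comm, adj_comm (x := m)]
        exact hM _ h2 _ h1 _ hm
      · simp only [g, h1, h2, if_true, if_false]
        exact hM _ h1 _ h2 _ hm
      · simp only [g, h1, h2, if_false]

theorem decomp_exists {G : LGraph} (s : Set G.V) :
    s = ∅ ∨ (∃ v, s = {v}) ∨ (∃ b t, Sep G b s t) ∨ ∃ P f, Decomp G s P f := by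
  classical
  rcases Set.eq_empty_or_nonempty s with h | ⟨v, hv⟩
  · exact Or.inl h
  by_cases hs : ∃ v, s = {v}
  · exact Or.inr (Or.inl hs)
  right; right
  push Not at hs
  obtain ⟨w, hw, hwv⟩ : ∃ w ∈ s, w ≠ v := by
    by_contra hc
    push Not at hc
    exact hs v (Set.Subset.antisymm (fun x hx => hc x hx) (by simpa using hv))
  let f : G.V → (sub G s).V := fun x => if h : x ∈ s then ⟨x, h⟩ else ⟨v, hv⟩
  have hfx : ∀ x (h : x ∈ s), f x = ⟨x, h⟩ := fun x h => dif_pos h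
  refine decomp_exists_aux (Fintype.card (sub G s).V) (sub G s) f rfl ?_ ?_ ?_
  · have : Fintype.card Bool ≤ Fintype.card (sub G s).V := by
      refine Fintype.card_le_of_injective
        (fun b : Bool => (if b then ⟨v, hv⟩ else ⟨w, hw⟩ : (sub G s).V)) ?_
      intro b b' h
      have h := congrArg (fun x : (sub G s).V => (x.1 : G.V)) h
      cases b <;> cases b'
      · rfl
      · exact absurd h hwv
      · exact absurd h.symm hwv
      · rfl
    simpa using this
  · rintro ⟨p, hp⟩
    exact ⟨p, hp, hfx p hp⟩
  · intro x hx y hy _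
    rw [hfx x hx, hfx y hy]
    exact Iff.rfl

end

section

def atb (b : Bool) (a : Atom) : Atom := if b then dualAtom a else a

theorem Sep.ssub {G : LGraph} {b : Bool} {s t : Set G.V} (h : Sep G b s t) : t ⊂ s := by
  refine ⟨h.1, fun h' => ?_⟩
  obtain ⟨x, hx, hx'⟩ := h.2.2.1
  exact hx' (h' hx)

theorem Sep.ssub' {G : LGraph} {b : Bool} {s t : Set G.V} (h : Sep G b s t) : s \ t ⊂ s :=
  h.symm.ssub

open Classical in
/-- semantics; `true` is the positive one, `false` the negative one -/
noncomputable def Sem (G : LGraph) (s : Set G.V) (b : Bool) : Set LQ :=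
  if s = ∅ then pv
  else if ∃ v, s = {v} then Cl {k | ∃ v ∈ s, k = q (single (atb b (G.label v)))}
  else if ∃ t, Sep G (!b) s t then
    {H | ∀ t, ∀ _h : Sep G (!b) s t, ∀ L ∈ Sem G t (!b), H * L ∈ Sem G (s \ t) b}
  else if ∃ t, Sep G b s t then
    Cl {k | ∃ t, ∃ _h : Sep G b s t, ∃ K ∈ Sem G t b, ∃ L ∈ Sem G (s \ t) b, k = K * L}
  else
    Cl {k | (∃ (P : LGraph) (f : G.V → P.V), ∃ _h : Decomp G s P f, ∃ K : P.V → LGraph,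
        (∀ p, Nonempty (K p).V) ∧ (∀ p, q (K p) ∈ Sem G (s ∩ f ⁻¹' {p}) b) ∧
        k = q ((pol P (!b)).comp K)) ∨
      (∃ (P : LGraph) (f : G.V → P.V), ∃ _h : Decomp G s P f, ∃ p,
        ∃ K ∈ Sem G (s ∩ f ⁻¹' {p}) b, ∃ L ∈ Sem G (s \ f ⁻¹' {p}) b, k = K * L)}
termination_by s.ncard
decreasing_by
  · exact Set.ncard_lt_ncard _h.ssub (Set.toFinite _)
  · exact Set.ncard_lt_ncard _h.ssub' (Set.toFinite _)
  · exact Set.ncard_lt_ncard _h.ssub (Set.toFinite _)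
  · exact Set.ncard_lt_ncard _h.ssub' (Set.toFinite _)
  · exact Set.ncard_lt_ncard (_h.fiber_ssub _) (Set.toFinite _)
  · exact Set.ncard_lt_ncard (_h.fiber_ssub _) (Set.toFinite _)
  · exact Set.ncard_lt_ncard (_h.compl_ssub _) (Set.toFinite _)

variable {G : LGraph}

theorem Sem_empty {b : Bool} : Sem G ∅ b = pv := by rw [Sem]; simp

theorem Sem_single {v : G.V} {b : Bool} :
    Sem G {v} b = Cl {q (single (atb b (G.label v)))} := by
  rw [Sem, if_neg (Set.singleton_ne_empty v), if_pos ⟨v, rfl⟩]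
  congr 1
  ext k; simp

theorem Sep.ne {b : Bool} {s t : Set G.V} (h : Sep G b s t) : s ≠ ∅ ∧ ¬ ∃ v, s = {v} := by
  obtain ⟨h1, ⟨x, hx⟩, ⟨y, hy, hy'⟩, h4⟩ := h
  constructor
  · rintro rfl; exact hy
  · rintro ⟨v, rfl⟩
    have : x = v := h1 hx
    have : y = v := hy
    subst_vars
    exact hy' hx

theorem Decomp.ne {s : Set G.V} {P : LGraph} {f : G.V → P.V} (h : Decomp G s P f) :
    s ≠ ∅ ∧ ¬ ∃ v, s = {v} := by
  have : 0 < Fintype.card P.V := by have := h.card; omega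
  obtain ⟨p⟩ := Fintype.card_pos_iff.1 this
  obtain ⟨x, hx, rfl⟩ := h.surj p
  obtain ⟨d, hd, _⟩ := h.two (f x) (f x)
  obtain ⟨y, hy, rfl⟩ := h.surj d
  constructor
  · rintro rfl; exact hy
  · rintro ⟨v, rfl⟩
    have : x = v := hx
    have : y = v := hy
    subst_vars
    exact hd rfl

theorem mem_neg {b : Bool} {s t : Set G.V} (h : Sep G (!b) s t) {H : LQ} :
    H ∈ Sem G s b ↔ ∀ t, Sep G (!b) s t → ∀ L ∈ Sem G t (!b), H * L ∈ Sem G (s \ t) b := by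
  rw [Sem, if_neg h.ne.1, if_neg h.ne.2, if_pos ⟨t, h⟩]
  rfl

theorem eq_pos {b : Bool} {s t : Set G.V} (h : Sep G b s t) :
    Sem G s b =
      Cl {k | ∃ t, Sep G b s t ∧ ∃ K ∈ Sem G t b, ∃ L ∈ Sem G (s \ t) b, k = K * L} := by
  rw [Sem, if_neg h.ne.1, if_neg h.ne.2, if_neg, if_pos ⟨t, h⟩]
  · congr 1
    ext k
    constructor
    · rintro ⟨t, h, h'⟩; exact ⟨t, h, h'⟩
    · rintro ⟨t, h, h'⟩; exact ⟨t, h, h'⟩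
  · rintro ⟨t', h'⟩; exact sep_excl h h'

def GenA (G : LGraph) (s : Set G.V) (b : Bool) (P : LGraph) (f : G.V → P.V) (k : LQ) : Prop :=
  ∃ K : P.V → LGraph, (∀ p, Nonempty (K p).V) ∧ (∀ p, q (K p) ∈ Sem G (s ∩ f ⁻¹' {p}) b) ∧
        k = q ((pol P (!b)).comp K)

def GenB (G : LGraph) (s : Set G.V) (b : Bool) (P : LGraph) (f : G.V → P.V) (k : LQ) : Prop :=
  ∃ p, ∃ K ∈ Sem G (s ∩ f ⁻¹' {p}) b, ∃ L ∈ Sem G (s \ f ⁻¹' {p}) b, k = K * L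

theorem eq_prime0 {b : Bool} {s : Set G.V} {P : LGraph} {f : G.V → P.V} (h : Decomp G s P f) :
    Sem G s b =
      Cl {k | (∃ (P : LGraph) (f : G.V → P.V), Decomp G s P f ∧ GenA G s b P f k) ∨
        (∃ (P : LGraph) (f : G.V → P.V), Decomp G s P f ∧ GenB G s b P f k)} := by
  rw [Sem, if_neg h.ne.1, if_neg h.ne.2, if_neg, if_neg]
  · congr 1
    ext k
    constructor
    · rintro (⟨P, f, h, h'⟩ | ⟨P, f, h, h'⟩)
      · exact Or.inl ⟨P, f, h, h'⟩
      · exact Or.inr ⟨P, f, h, h'⟩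
    · rintro (⟨P, f, h, h'⟩ | ⟨P, f, h, h'⟩)
      · exact Or.inl ⟨P, f, h, h'⟩
      · exact Or.inr ⟨P, f, h, h'⟩
  · rintro ⟨t', h'⟩; exact h.not_sep h'
  · rintro ⟨t', h'⟩; exact h.not_sep h'

theorem eq_prime {b : Bool} {s : Set G.V} {P : LGraph} {f : G.V → P.V} (h : Decomp G s P f) :
    Sem G s b = Cl {k | GenA G s b P f k ∨ GenB G s b P f k} := by
  rw [eq_prime0 h]
  congr 1
  ext k
  constructor
  · rintro (⟨P', f', h', K, hK1, hK2, rfl⟩ | ⟨P', f', h', p, K, hK, L, hL, rfl⟩)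
    · obtain ⟨e, he, ha⟩ := h.unique h'
      have hfib : ∀ p, s ∩ f ⁻¹' {p} = s ∩ f' ⁻¹' {e p} := by
        intro p
        ext x
        simp only [Set.mem_inter_iff, Set.mem_preimage, Set.mem_singleton_iff]
        refine and_congr_right fun hx => ?_
        rw [he x hx, e.injective.eq_iff]
      refine Or.inl ⟨fun p => K (e p), fun p => hK1 _, fun p => ?_, ?_⟩
      · rw [hfib]; exact hK2 _
      · refine q_eq.2 (iso.symm ?_)
        refine comp_iso (Q := pol P (!b)) (Q' := pol P' (!b)) e ?_ (fun v => iso.refl _)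
        intro v w hvw
        change P.V at v
        change P.V at w
        change P.E _ _ _ ↔ P'.E _ _ _
        exact and_congr e.injective.ne_iff.symm (iff_congr (ha v w) Iff.rfl)
    · obtain ⟨e, he, ha⟩ := h'.unique h
      have hfib : ∀ p, s ∩ f' ⁻¹' {p} = s ∩ f ⁻¹' {e p} := by
        intro p
        ext x
        simp only [Set.mem_inter_iff, Set.mem_preimage, Set.mem_singleton_iff]
        refine and_congr_right fun hx => ?_
        rw [he x hx, e.injective.eq_iff]
      have hfib' : ∀ p, s \ f' ⁻¹' {p} = s \ f ⁻¹' {e p} := by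
        intro p
        rw [← Set.sdiff_self_inter, hfib, Set.sdiff_self_inter]
      rw [hfib] at hK
      rw [hfib'] at hL
      exact Or.inr ⟨e p, K, hK, L, hL, rfl⟩
  · rintro (h' | h')
    · exact Or.inl ⟨P, f, h, h'⟩
    · exact Or.inr ⟨P, f, h, h'⟩

theorem Sem_closed_aux (s : Set G.V) : ∀ b, Closed (Sem G s b) := by
  induction s using WellFoundedLT.induction with
  | ind s ih =>
  intro b
  rcases decomp_exists s with rfl | ⟨v, rfl⟩ | ⟨b', t, h⟩ | ⟨P, f, h⟩
  · rw [Sem_empty]; exact pv_closed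
  · rw [Sem_single]; exact Cl_closed _
  · by_cases hb : b' = b
    · subst hb; rw [eq_pos h]; exact Cl_closed _
    · have : b' = !b := by cases b <;> cases b' <;> simp_all
      subst this
      have : Sem G s b =
          {H | ∀ t, H ∈ {H | Sep G (!b) s t → H ∈ {H | ∀ L, H ∈ {H | L ∈ Sem G t (!b) →
            H ∈ {H | H * L ∈ Sem G (s \ t) b}}}}} := by
        ext H; rw [mem_neg h]; rfl
      rw [this]
      exact Closed.all fun t => Closed.imp fun ht => Closed.all fun L => Closed.imp fun hL =>
        (ih _ ht.ssub' b).shift L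
  · rw [eq_prime h]; exact Cl_closed _

theorem Sem_closed {s : Set G.V} {b : Bool} : Closed (Sem G s b) := Sem_closed_aux s b

/-- elimination in the prime case -/
theorem prime_le {b : Bool} {s : Set G.V} {P : LGraph} {f : G.V → P.V} (h : Decomp G s P f)
    {T : Set LQ} (hT : Closed T)
    (hA : ∀ K : P.V → LGraph, (∀ p, Nonempty (K p).V) →
      (∀ p, q (K p) ∈ Sem G (s ∩ f ⁻¹' {p}) b) → q ((pol P (!b)).comp K) ∈ T)
    (hB : ∀ p, ∀ K ∈ Sem G (s ∩ f ⁻¹' {p}) b, ∀ L ∈ Sem G (s \ f ⁻¹' {p}) b, K * L ∈ T) :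
    Sem G s b ⊆ T := by
  rw [eq_prime h]
  refine Cl_sub hT ?_
  rintro k (⟨K, h1, h2, rfl⟩ | ⟨p, K, hK, L, hL, rfl⟩)
  · exact hA K h1 h2
  · exact hB p K hK L hL

theorem prime_A {b : Bool} {s : Set G.V} {P : LGraph} {f : G.V → P.V} (h : Decomp G s P f)
    {K : P.V → LGraph} (h1 : ∀ p, Nonempty (K p).V)
    (h2 : ∀ p, q (K p) ∈ Sem G (s ∩ f ⁻¹' {p}) b) : q ((pol P (!b)).comp K) ∈ Sem G s b := by
  rw [eq_prime h]
  exact sub_Cl (Or.inl ⟨K, h1, h2, rfl⟩)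

theorem prime_B {b : Bool} {s : Set G.V} {P : LGraph} {f : G.V → P.V} (h : Decomp G s P f)
    {p : P.V} {K L : LQ} (hK : K ∈ Sem G (s ∩ f ⁻¹' {p}) b) (hL : L ∈ Sem G (s \ f ⁻¹' {p}) b) :
    K * L ∈ Sem G s b := by
  rw [eq_prime h]
  exact sub_Cl (Or.inr ⟨p, K, hK, L, hL, rfl⟩)

theorem mul_pv' {T : Set LQ} (hT : Closed T) {k p : LQ} (hp : p ∈ pv) (hk : k ∈ T) : p * k ∈ T := by
  rw [mul_comm]; exact hT.mul_pv hk hp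

theorem Full.symm {b : Bool} {t r : Set G.V} (h : Full G b t r) : Full G b r t :=
  fun x hx y hy => (h y hy x hx).symm

theorem Full.mono {b : Bool} {t r t' r' : Set G.V} (h : Full G b t r) (ht : t' ⊆ t) (hr : r' ⊆ r) :
    Full G b t' r' := fun x hx y hy => h x (ht hx) y (hr hy)

theorem Full.diff {b : Bool} {t r : Set G.V} (h : Full G b t r) : (t ∪ r) \ t = r := by
  ext x
  constructor
  · rintro ⟨h1 | h1, h2⟩
    · exact absurd h1 h2
    · exact h1
  · intro hx
    exact ⟨Or.inr hx, fun hx' => (h x hx' x hx).1 rfl⟩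

theorem Full.sep {b : Bool} {t r : Set G.V} (h : Full G b t r) (ht : t.Nonempty)
    (hr : r.Nonempty) : Sep G b (t ∪ r) t := by
  refine ⟨Set.subset_union_left, ht, ?_, ?_⟩ <;> rw [h.diff]
  · exact hr
  · exact h

theorem S1 {b : Bool} {t r : Set G.V} (h : Full G b t r) {K L : LQ} (hK : K ∈ Sem G t b)
    (hL : L ∈ Sem G r b) : K * L ∈ Sem G (t ∪ r) b := by
  rcases Set.eq_empty_or_nonempty t with rfl | ht
  · rw [Sem_empty] at hK
    rw [Set.empty_union]; exact mul_pv' Sem_closed hK hL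
  rcases Set.eq_empty_or_nonempty r with rfl | hr
  · rw [Sem_empty] at hL
    rw [Set.union_empty]; exact Sem_closed.mul_pv hK hL
  rw [eq_pos (h.sep ht hr)]
  refine sub_Cl ⟨t, h.sep ht hr, K, hK, L, ?_, rfl⟩
  rwa [h.diff]

theorem S2_aux {b : Bool} (s : Set G.V) : ∀ t r, t ∪ r = s → Full G b t r →
    ∀ T : Set LQ, Closed T → (∀ K ∈ Sem G t b, ∀ L ∈ Sem G r b, K * L ∈ T) →
    Sem G s b ⊆ T := by
  induction s using WellFoundedLT.induction with
  | ind s ih =>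
  rintro t r rfl h T hT hTT
  rcases Set.eq_empty_or_nonempty t with rfl | ht
  · rw [Set.empty_union]
    intro L hL
    have := hTT 1 (by rw [Sem_empty]; exact one_pv) L hL
    simpa using this
  rcases Set.eq_empty_or_nonempty r with rfl | hr
  · rw [Set.union_empty]
    intro K hK
    have := hTT K hK 1 (by rw [Sem_empty]; exact one_pv)
    simpa using this
  rw [eq_pos (h.sep ht hr)]
  refine Cl_sub hT ?_
  rintro k ⟨u, hu, K, hK, L, hL, rfl⟩
  have hus := hu.1
  have e1 : (u ∩ t) ∪ (u ∩ r) = u := by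
    rw [← Set.inter_union_distrib_left]; exact Set.inter_eq_left.2 hus
  have e2 : (t \ u) ∪ (r \ u) = (t ∪ r) \ u := by rw [Set.union_sdiff_distrib]
  refine ih u hu.ssub _ _ e1 (h.mono Set.inter_subset_right Set.inter_subset_right)
    {K | K * L ∈ T} (hT.shift L) ?_ hK
  intro K1 hK1 K2 hK2
  have := ih _ hu.ssub' _ _ e2 (h.mono Set.sdiff_subset Set.sdiff_subset)
    {L | L * (K1 * K2) ∈ T} (hT.shift _) ?_ hL
  · change _ * _ ∈ T at this
    change _ * _ ∈ T
    rwa [mul_comm]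
  intro L1 hL1 L2 hL2
  change _ * _ ∈ T
  have f1 : Full G b (u ∩ t) (t \ u) := fun x hx y hy =>
    hu.2.2.2 x hx.1 y ⟨Or.inl hy.1, hy.2⟩
  have f2 : Full G b (u ∩ r) (r \ u) := fun x hx y hy =>
    hu.2.2.2 x hx.1 y ⟨Or.inr hy.1, hy.2⟩
  have g1 := S1 f1 hK1 hL1
  have g2 := S1 f2 hK2 hL2
  have a1 : (u ∩ t) ∪ (t \ u) = t := by rw [Set.inter_comm]; exact Set.inter_union_sdiff t u
  have a2 : (u ∩ r) ∪ (r \ u) = r := by rw [Set.inter_comm]; exact Set.inter_union_sdiff r u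
  rw [a1] at g1
  rw [a2] at g2
  have := hTT _ g1 _ g2
  convert this using 1
  ac_rfl

theorem S2 {b : Bool} {t r : Set G.V} (h : Full G b t r) {T : Set LQ} (hT : Closed T)
    (hTT : ∀ K ∈ Sem G t b, ∀ L ∈ Sem G r b, K * L ∈ T) : Sem G (t ∪ r) b ⊆ T :=
  S2_aux _ t r rfl h T hT hTT

theorem I1 {b : Bool} {t r : Set G.V} (h : Full G (!b) t r) (hr : r.Nonempty) {H L : LQ}
    (hH : H ∈ Sem G (t ∪ r) b) (hL : L ∈ Sem G t (!b)) : H * L ∈ Sem G r b := by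
  rcases Set.eq_empty_or_nonempty t with rfl | ht
  · rw [Sem_empty] at hL
    rw [Set.empty_union] at hH; exact Sem_closed.mul_pv hH hL
  have := (mem_neg (h.sep ht hr)).1 hH t (h.sep ht hr) L hL
  rwa [h.diff] at this

theorem I2_aux {b : Bool} (s : Set G.V) : ∀ t r, t ∪ r = s → Full G (!b) t r → ∀ H : LQ,
    (∀ L ∈ Sem G t (!b), H * L ∈ Sem G r b) → (∀ L ∈ Sem G r (!b), H * L ∈ Sem G t b) →
    H ∈ Sem G s b := by
  induction s using WellFoundedLT.induction with
  | ind s ih =>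
  rintro t r rfl h H h1 h2
  rcases Set.eq_empty_or_nonempty t with rfl | ht
  · rw [Set.empty_union]
    simpa using h1 1 (by rw [Sem_empty]; exact one_pv)
  rcases Set.eq_empty_or_nonempty r with rfl | hr
  · rw [Set.union_empty]
    simpa using h2 1 (by rw [Sem_empty]; exact one_pv)
  rw [mem_neg (h.sep ht hr)]
  intro u hu M hM
  have hus := hu.1
  have e1 : (u ∩ t) ∪ (u ∩ r) = u := by
    rw [← Set.inter_union_distrib_left]; exact Set.inter_eq_left.2 hus
  have e2 : (t \ u) ∪ (r \ u) = (t ∪ r) \ u := by rw [Set.union_sdiff_distrib]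
  have a1 : (u ∩ t) ∪ (t \ u) = t := by rw [Set.inter_comm]; exact Set.inter_union_sdiff t u
  have a2 : (u ∩ r) ∪ (r \ u) = r := by rw [Set.inter_comm]; exact Set.inter_union_sdiff r u
  have f1 : Full G (!b) (u ∩ t) (t \ u) := fun x hx y hy =>
    hu.2.2.2 x hx.1 y ⟨Or.inl hy.1, hy.2⟩
  have f2 : Full G (!b) (u ∩ r) (r \ u) := fun x hx y hy =>
    hu.2.2.2 x hx.1 y ⟨Or.inr hy.1, hy.2⟩
  rw [← e1] at hM
  have := S2 (h.mono Set.inter_subset_right Set.inter_subset_right)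
    ((Sem_closed (s := (t ∪ r) \ u) (b := b)).shift H) ?_ hM
  · change _ * _ ∈ Sem G ((t ∪ r) \ u) b at this
    rwa [mul_comm]
  intro M1 hM1 M2 hM2
  change _ * _ ∈ Sem G ((t ∪ r) \ u) b
  rcases Set.eq_empty_or_nonempty (r \ u) with hr0 | hr0
  · have hte : (t \ u).Nonempty := by
      have := hu.2.2.1
      rw [← e2, hr0, Set.union_empty] at this
      exact this
    rw [← e2, hr0, Set.union_empty]
    rw [hr0, Set.union_empty] at a2
    rw [a2] at hM2
    have h3 := h2 _ hM2
    rw [← a1] at h3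
    have := I1 f1 hte h3 hM1
    convert this using 1
    ac_rfl
  rcases Set.eq_empty_or_nonempty (t \ u) with ht0 | ht0
  · rw [← e2, ht0, Set.empty_union]
    rw [ht0, Set.union_empty] at a1
    rw [a1] at hM1
    have h3 := h1 _ hM1
    rw [← a2] at h3
    have := I1 f2 hr0 h3 hM2
    convert this using 1
    ac_rfl
  refine ih _ hu.ssub' _ _ e2 (h.mono Set.sdiff_subset Set.sdiff_subset) _ ?_ ?_
  · intro L hL
    have g := S1 f1 hM1 hL
    rw [a1] at g
    have h3 := h1 _ g
    rw [← a2] at h3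
    have := I1 f2 hr0 h3 hM2
    convert this using 1
    ac_rfl
  · intro L hL
    have g := S1 f2 hM2 hL
    rw [a2] at g
    have h3 := h2 _ g
    rw [← a1] at h3
    have := I1 f1 ht0 h3 hM1
    convert this using 1
    ac_rfl

theorem I2 {b : Bool} {t r : Set G.V} (h : Full G (!b) t r) {H : LQ}
    (h1 : ∀ L ∈ Sem G t (!b), H * L ∈ Sem G r b) (h2 : ∀ L ∈ Sem G r (!b), H * L ∈ Sem G t b) :
    H ∈ Sem G (t ∪ r) b := I2_aux _ t r rfl h H h1 h2

end

section

theorem mem_iso {X Y : LGraph} {T : Set LQ} (h : X.iso Y) (hX : q X ∈ T) : q Y ∈ T := by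
  rwa [← q_eq.2 h]

def Orth (G : LGraph) (s : Set G.V) : Prop :=
  ∀ b, ∀ K ∈ Sem G s b, ∀ L ∈ Sem G s (!b), K * L ∈ pv

theorem fact4_aux {G Q H : LGraph} {b : Bool} {f : G.V → Q.V} {h : H.V → Q.V} (s : Set G.V) :
    ∀ u : Set H.V, Fib G Q f s → Fib H (pol Q (!b)) h u → (∀ t, t ⊂ s → Orth G t) →
    (∀ v, q (sub H (u ∩ h ⁻¹' {v})) ∈ Sem G (s ∩ f ⁻¹' {v}) b) →
    (∀ x ∈ u, h x ∈ f '' s) → q (sub H u) ∈ Sem G s b := by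
  induction s using WellFoundedLT.induction with
  | ind s ih =>
  intro u hs hu ho hm hsub
  have IH : ∀ J : Set Q.V, s ∩ f ⁻¹' J ⊂ s →
      q (sub H (u ∩ h ⁻¹' J)) ∈ Sem G (s ∩ f ⁻¹' J) b := by
    intro J hJ
    refine ih _ hJ _ (hs.mono Set.inter_subset_left) (hu.mono Set.inter_subset_left)
      (fun t ht => ho t (ht.trans hJ)) ?_ ?_
    · intro v
      by_cases hv : v ∈ J
      · have e1 : u ∩ h ⁻¹' J ∩ h ⁻¹' {v} = u ∩ h ⁻¹' {v} := by
          ext x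
          simp only [Set.mem_inter_iff, Set.mem_preimage, Set.mem_singleton_iff]
          exact ⟨fun h => ⟨h.1.1, h.2⟩, fun h => ⟨⟨h.1, by rw [h.2]; exact hv⟩, h.2⟩⟩
        have e2 : s ∩ f ⁻¹' J ∩ f ⁻¹' {v} = s ∩ f ⁻¹' {v} := by
          ext x
          simp only [Set.mem_inter_iff, Set.mem_preimage, Set.mem_singleton_iff]
          exact ⟨fun h => ⟨h.1.1, h.2⟩, fun h => ⟨⟨h.1, by rw [h.2]; exact hv⟩, h.2⟩⟩
        rw [e1, e2]; exact hm v
      · have e1 : u ∩ h ⁻¹' J ∩ h ⁻¹' {v} = ∅ := by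
          ext x
          simp only [Set.mem_inter_iff, Set.mem_preimage, Set.mem_singleton_iff,
            Set.mem_empty_iff_false, iff_false]
          rintro ⟨⟨_, h1⟩, h2⟩; rw [h2] at h1; exact hv h1
        have e2 : s ∩ f ⁻¹' J ∩ f ⁻¹' {v} = ∅ := by
          ext x
          simp only [Set.mem_inter_iff, Set.mem_preimage, Set.mem_singleton_iff,
            Set.mem_empty_iff_false, iff_false]
          rintro ⟨⟨_, h1⟩, h2⟩; rw [h2] at h1; exact hv h1
        rw [e1, e2, Sem_empty, q_sub_empty]; exact one_pv
    · rintro x ⟨hx, hxJ⟩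
      obtain ⟨y, hy, hyx⟩ := hsub x hx
      exact ⟨y, ⟨hy, by rw [Set.mem_preimage, hyx]; exact hxJ⟩, hyx⟩
  rcases decomp_exists (f '' s) with ht | ⟨v, ht⟩ | ⟨b', t, ht⟩ | ⟨P, g, ht⟩
  · have hs0 : s = ∅ := by simpa using ht
    have hu0 : u = ∅ := by
      ext x; simp only [Set.mem_empty_iff_false, iff_false]
      intro hx; have := hsub x hx; rw [ht] at this; exact this
    rw [hs0, hu0, Sem_empty, q_sub_empty]; exact one_pv
  · have e1 : u ∩ h ⁻¹' {v} = u := by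
      refine Set.inter_eq_left.2 fun x hx => ?_
      have := hsub x hx
      rw [ht] at this; exact this
    have e2 : s ∩ f ⁻¹' {v} = s := by
      refine Set.inter_eq_left.2 fun x hx => ?_
      have : f x ∈ f '' s := ⟨x, hx, rfl⟩
      rw [ht] at this; exact this
    have := hm v
    rwa [e1, e2] at this
  · have hsplit : ∀ w, w ∈ f '' s → w ∈ t ∨ w ∈ tᶜ := fun w _ => Classical.em _
    have es : (s ∩ f ⁻¹' t) ∪ (s ∩ f ⁻¹' tᶜ) = s := by
      ext x; simp only [Set.mem_union, Set.mem_inter_iff, Set.mem_preimage, Set.mem_compl_iff]; tauto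
    have eu : (u ∩ h ⁻¹' t) ∪ (u ∩ h ⁻¹' tᶜ) = u := by
      ext x; simp only [Set.mem_union, Set.mem_inter_iff, Set.mem_preimage, Set.mem_compl_iff]; tauto
    have s1 : s ∩ f ⁻¹' t ⊂ s := by
      refine ⟨Set.inter_subset_left, fun h' => ?_⟩
      obtain ⟨_, ⟨x, hx, rfl⟩, hx'⟩ := ht.2.2.1
      exact hx' (h' hx).2
    have s2 : s ∩ f ⁻¹' tᶜ ⊂ s := by
      refine ⟨Set.inter_subset_left, fun h' => ?_⟩
      obtain ⟨w, hw⟩ := ht.2.1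
      obtain ⟨x, hx, rfl⟩ := ht.1 hw
      exact (h' hx).2 hw
    have I1 := IH _ s1
    have I2' := IH _ s2
    have hF : Full G b' (s ∩ f ⁻¹' t) (s ∩ f ⁻¹' tᶜ) := by
      rintro x ⟨hx, hx'⟩ y ⟨hy, hy'⟩
      have := ht.2.2.2 (f x) hx' (f y) ⟨⟨y, hy, rfl⟩, hy'⟩
      refine ⟨fun e => this.1 (by rw [e]), ?_⟩
      rw [hs x hx y hy this.1]; exact this.2
    have hHd : ∀ x ∈ u ∩ h ⁻¹' t, x ∉ u ∩ h ⁻¹' tᶜ := fun x hx hx' => hx'.2 hx.2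
    have hH : ∀ x ∈ u ∩ h ⁻¹' t, ∀ y ∈ u ∩ h ⁻¹' tᶜ, (H.adj x y ↔ b' = !b) := by
      rintro x ⟨hx, hx'⟩ y ⟨hy, hy'⟩
      have h1 := ht.2.2.2 (h x) hx' (h y) ⟨hsub y hy, hy'⟩
      refine (hu x hx y hy h1.1).trans ?_
      change Q.E (!b) (h x) (h y) ↔ _
      constructor
      · intro h2
        by_contra hne
        have : b' = b := by cases b <;> cases b' <;> simp_all
        subst this
        exact E_excl h1 h2
      · rintro rfl; exact h1
    have hmod : Mod H (u ∩ h ⁻¹' t) (u ∩ h ⁻¹' tᶜ) := by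
      refine ⟨hHd, fun v hv y hy z hz => ?_⟩
      rw [adj_comm, hH y hy v hv, adj_comm, hH z hz v hv]
    have hmod' : Mod H (u ∩ h ⁻¹' tᶜ) (u ∩ h ⁻¹' t) := by
      refine ⟨fun x hx hx' => hHd x hx' hx, fun v hv y hy z hz => ?_⟩
      rw [hH v hv y hy, hH v hv z hz]
    by_cases hb : b' = b
    · subst hb
      have := S1 hF I1 I2'
      rw [es, ← q_sub_par hHd, eu] at this
      · exact this
      · intro x hx y hy hxy
        have := (hH x hx y hy).1 hxy
        simp at this
    · have : b' = !b := by cases b <;> cases b' <;> simp_all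
      subst this
      rw [← es]
      refine I2 hF ?_ ?_
      · intro L hL
        have := K1 Sem_closed hmod I2' (ho _ s1 b _ I1 _ hL)
        rwa [eu] at this
      · intro L hL
        have := K1 Sem_closed hmod' I1 (ho _ s2 b _ I2' _ hL)
        rwa [Set.union_comm, eu] at this
  · have hD : Decomp G s P (g ∘ f) := by
      refine ⟨ht.prime, ht.card, ?_, ?_⟩
      · intro p
        obtain ⟨_, ⟨x, hx, rfl⟩, h2⟩ := ht.surj p
        exact ⟨x, hx, h2⟩
      · intro x hx y hy hne
        have h1 : f x ≠ f y := fun e => hne (by simp [e])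
        rw [hs x hx y hy h1]
        exact ht.fib _ ⟨x, hx, rfl⟩ _ ⟨y, hy, rfl⟩ hne
    have hHf : Fib H (pol P (!b)) (g ∘ h) u := by
      intro x hx y hy hne
      have h1 : h x ≠ h y := fun e => hne (by simp only [Function.comp]; rw [e])
      have h2 := ht.fib _ (hsub x hx) _ (hsub y hy) hne
      refine (hu x hx y hy h1).trans ?_
      exact and_congr (iff_of_true h1 hne) (iff_congr h2 Iff.rfl)
    have hp : ∀ p, q (sub H (u ∩ (g ∘ h) ⁻¹' {p})) ∈ Sem G (s ∩ (g ∘ f) ⁻¹' {p}) b :=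
      fun p => IH (g ⁻¹' {p}) (hD.fiber_ssub p)
    by_cases hne : ∀ p, (u ∩ (g ∘ h) ⁻¹' {p}).Nonempty
    · have := prime_A hD (K := fun p => sub H (u ∩ (g ∘ h) ⁻¹' {p}))
        (fun p => (hne p).to_subtype) hp
      exact mem_iso (sub_comp hHf) this
    · push Not at hne
      obtain ⟨p, hp0⟩ := hne
      have h1 := hp p
      rw [hp0, q_sub_empty] at h1
      have hc := hD.compl_ssub p
      have e1 : s \ (g ∘ f) ⁻¹' {p} = s ∩ f ⁻¹' (g ⁻¹' {p})ᶜ := rfl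
      rw [e1] at hc
      have h2 := IH _ hc
      have e2 : u ∩ h ⁻¹' (g ⁻¹' {p})ᶜ = u := by
        refine Set.inter_eq_left.2 fun x hx hx' => ?_
        have : x ∈ u ∩ (g ∘ h) ⁻¹' {p} := ⟨hx, hx'⟩
        rw [hp0] at this; exact this
      rw [e2] at h2
      have := prime_B hD (p := p) h1 h2
      rwa [one_mul] at this

theorem fact4 {G Q H : LGraph} {b : Bool} {f : G.V → Q.V} {h : H.V → Q.V} {s : Set G.V}
    {u : Set H.V} (hs : Fib G Q f s) (hu : Fib H (pol Q (!b)) h u)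
    (ho : ∀ t, t ⊂ s → Orth G t)
    (hm : ∀ v, q (sub H (u ∩ h ⁻¹' {v})) ∈ Sem G (s ∩ f ⁻¹' {v}) b) :
    q (sub H u) ∈ Sem G s b := by
  classical
  obtain ⟨I, hI⟩ : ∃ I : Finset Q.V, (I : Set Q.V)ᶜ = f '' s :=
    ⟨Finset.univ.filter fun v => v ∉ f '' s, by ext x; simp⟩
  have hpv : ∀ v, v ∉ f '' s → s ∩ f ⁻¹' {v} = ∅ := by
    intro v hv
    ext x
    simp only [Set.mem_inter_iff, Set.mem_preimage, Set.mem_singleton_iff,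
      Set.mem_empty_iff_false, iff_false]
    rintro ⟨h1, h2⟩
    exact hv ⟨x, h1, h2⟩
  refine fib_kill (Q := pol Q (!b)) Sem_closed hu I ?_ ?_
  · change q (sub H (u ∩ h ⁻¹' (I : Set Q.V)ᶜ)) ∈ _
    have e0 : h ⁻¹' (I : Set Q.V)ᶜ = h ⁻¹' (f '' s) := by rw [hI]
    refine (congrArg (fun z => q (sub H (u ∩ z)) ∈ Sem G s b) e0).mpr ?_
    refine fact4_aux (f := f) (h := h) s _ hs (hu.mono Set.inter_subset_left) ho ?_ ?_
    · intro v
      by_cases hv : v ∈ f '' s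
      · have e1 : u ∩ h ⁻¹' (f '' s) ∩ h ⁻¹' {v} = u ∩ h ⁻¹' {v} := by
          ext x
          simp only [Set.mem_inter_iff, Set.mem_preimage, Set.mem_singleton_iff]
          exact ⟨fun h => ⟨h.1.1, h.2⟩, fun h => ⟨⟨h.1, by rw [h.2]; exact hv⟩, h.2⟩⟩
        rw [e1]; exact hm v
      · have e1 : u ∩ h ⁻¹' (f '' s) ∩ h ⁻¹' {v} = ∅ := by
          ext x
          simp only [Set.mem_inter_iff, Set.mem_preimage, Set.mem_singleton_iff,
            Set.mem_empty_iff_false, iff_false]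
          rintro ⟨⟨_, h1⟩, h2⟩; rw [h2] at h1; exact hv h1
        rw [e1, hpv v hv, Sem_empty, q_sub_empty]; exact one_pv
    · rintro x ⟨hx, hx'⟩
      exact hx'
  · intro v hv
    change Q.V at v
    have hv' : v ∉ f '' s := by
      rw [← hI]; intro h'; exact h' hv
    have := hm v
    rwa [hpv v hv', Sem_empty] at this

end

section

variable {G : LGraph}

theorem Mod.mono {x c x' c' : Set G.V} (h : Mod G x c) (hx : x' ⊆ x) (hc : c' ⊆ c) : Mod G x' c' :=
  ⟨fun v hv hv' => h.1 v (hx hv) (hc hv'),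
    fun v hv y hy z hz => h.2 v (hc hv) y (hx hy) z (hx hz)⟩

structure FF (G : LGraph) (s : Set G.V) : Prop where
  f2 : ∀ {x c : Set G.V} {b d : Bool} {K L : LQ}, x ∪ c = s → Mod G x c → d = !b →
    K ∈ Sem G s b → L ∈ Sem G x d → K * L ∈ Sem G c b
  f2' : ∀ {x c : Set G.V} {b d : Bool} {K L : LQ}, x ∪ c = s → Mod G x c → d = !b →
    K ∈ Sem G s b → L ∈ Sem G c d → K * L ∈ Sem G x b
  f3 : ∀ {x c : Set G.V} {b : Bool} {K L : LQ}, x ∪ c = s → Mod G x c →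
    K ∈ Sem G x b → L ∈ Sem G c b → K * L ∈ Sem G s b
  orth : ∀ {b d : Bool} {K L : LQ}, d = !b → K ∈ Sem G s b → L ∈ Sem G s d → K * L ∈ pv

theorem FF.orth' {s : Set G.V} (h : FF G s) : Orth G s := fun _ _ hK _ hL => h.orth rfl hK hL

theorem I1o {b d : Bool} {t r : Set G.V} (hd : d = !b) (h : Full G d t r) (ho : FF G t) {H L : LQ}
    (hH : H ∈ Sem G (t ∪ r) b) (hL : L ∈ Sem G t d) : H * L ∈ Sem G r b := by
  subst hd
  rcases Set.eq_empty_or_nonempty r with rfl | hr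
  · rw [Set.union_empty] at hH
    rw [Sem_empty]; exact ho.orth rfl hH hL
  · exact I1 h hr hH hL

theorem sub_of_union {x c s : Set G.V} (hs : x ∪ c = s) : x ⊆ s ∧ c ⊆ s := by
  subst hs; exact ⟨Set.subset_union_left, Set.subset_union_right⟩

theorem sep_choice {s x c t : Set G.V} {b' : Bool} (hs : x ∪ c = s) (hM : Mod G x c)
    (hc : c.Nonempty) (ht : Sep G b' s t) :
    ∃ e c', e.Nonempty ∧ e ∪ c' = c ∧ (∀ v ∈ e, v ∉ c') ∧ Full G b' e (x ∪ c') := by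
  obtain ⟨h1, h2, h3, h4⟩ := ht
  subst hs
  by_cases hx1 : x ⊆ t
  · refine ⟨(x ∪ c) \ t, c ∩ t, h3, ?_, ?_, ?_⟩
    · ext v
      have := @hx1 v
      simp only [Set.mem_union, Set.mem_sdiff, Set.mem_inter_iff]; tauto
    · intro v hv hv'; exact hv.2 hv'.2
    · intro v hv w hw
      exact (h4 w (hw.elim (fun h => hx1 h) (fun h => h.2)) v hv).symm
  by_cases hx2 : ∀ v ∈ x, v ∉ t
  · refine ⟨t, c \ t, h2, ?_, ?_, ?_⟩
    · ext v
      have := hx2 v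
      have := @h1 v
      simp only [Set.mem_union, Set.mem_sdiff] at *; tauto
    · intro v hv hv'; exact hv'.2 hv
    · intro v hv w hw
      refine h4 v hv w ?_
      rcases hw with hw | hw
      · exact ⟨Or.inl hw, hx2 w hw⟩
      · exact ⟨Or.inr hw.1, hw.2⟩
  · refine ⟨c, ∅, hc, Set.union_empty c, fun _ _ h => h, ?_⟩
    rw [Set.union_empty]
    push Not at hx2
    obtain ⟨y, hy, hyt⟩ := hx2
    obtain ⟨z, hz, hzt⟩ := Set.not_subset.1 hx1
    have key : ∀ v ∈ c, ∀ w ∈ x, ∀ w' ∈ x, G.E b' v w → G.E b' v w' := by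
      intro v hv w hw w' hw' h
      refine ⟨fun e => hM.1 w' hw' (e ▸ hv), ?_⟩
      rw [hM.2 v hv w' hw' w hw]; exact h.2
    intro v hv w hw
    by_cases hvt : v ∈ t
    · exact key v hv z hz w hw (h4 v hvt z ⟨Or.inl hz, hzt⟩)
    · exact key v hv y hy w hw (h4 y hyt v ⟨Or.inr hv, hvt⟩).symm

section sepcase
variable {x e c' : Set G.V} {b b' d : Bool}

theorem sep_cases (hd : d = !b) : b' = b ∨ b' = d := by
  cases b <;> cases b' <;> simp_all

theorem f2_sep (ih : ∀ t, t ⊂ e ∪ (x ∪ c') → FF G t) (he : e.Nonempty) (hx : x.Nonempty)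
    (hM : Mod G x c') (hF : Full G b' e (x ∪ c')) (hd : d = !b) {K L : LQ}
    (hK : K ∈ Sem G (e ∪ (x ∪ c')) b) (hL : L ∈ Sem G x d) : K * L ∈ Sem G (e ∪ c') b := by
  have hD : x ∪ c' ⊂ e ∪ (x ∪ c') := by
    refine ⟨Set.subset_union_right, fun h => ?_⟩
    obtain ⟨v, hv⟩ := he
    exact (hF v hv v (h (Or.inl hv))).1 rfl
  have hFc := hF.mono (le_refl e) (Set.subset_union_right : c' ⊆ x ∪ c')
  rcases sep_cases (b' := b') hd with rfl | rfl
  · refine S2 hF (Sem_closed.shift L) ?_ hK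
    intro M hM' N hN
    change M * N * L ∈ Sem G (e ∪ c') b'
    rw [mul_assoc]
    exact S1 hFc hM' ((ih _ hD).f2 rfl hM hd hN hL)
  · subst hd
    refine I2 hFc ?_ ?_
    · intro M hM'
      have h1 := I1 hF (hx.mono Set.subset_union_left) hK hM'
      have h2 := (ih _ hD).f2 rfl hM rfl h1 hL
      rwa [mul_right_comm]
    · intro M hM'
      have h1 := (ih _ hD).f3 rfl hM hL hM'
      rw [Set.union_comm] at hK
      rw [mul_assoc]
      exact I1 hF.symm he hK h1

theorem f2'_sep (ih : ∀ t, t ⊂ e ∪ (x ∪ c') → FF G t) (he : e.Nonempty) (hx : x.Nonempty)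
    (hM : Mod G x c') (hF : Full G b' e (x ∪ c')) (hd : d = !b) {K L : LQ}
    (hK : K ∈ Sem G (e ∪ (x ∪ c')) b) (hL : L ∈ Sem G (e ∪ c') d) : K * L ∈ Sem G x b := by
  have hD : x ∪ c' ⊂ e ∪ (x ∪ c') := by
    refine ⟨Set.subset_union_right, fun h => ?_⟩
    obtain ⟨v, hv⟩ := he
    exact (hF v hv v (h (Or.inl hv))).1 rfl
  have hE : e ⊂ e ∪ (x ∪ c') := by
    refine ⟨Set.subset_union_left, fun h => ?_⟩
    obtain ⟨v, hv⟩ := hx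
    exact (hF v (h (Or.inr (Or.inl hv))) v (Or.inl hv)).1 rfl
  have hFc := hF.mono (le_refl e) (Set.subset_union_right : c' ⊆ x ∪ c')
  rcases sep_cases (b' := b') hd with rfl | rfl
  · refine S2 hF (Sem_closed.shift L) ?_ hK
    intro M hM' N hN
    change M * N * L ∈ Sem G x b'
    have h1 := I1o (by simp [hd]) hFc (ih _ hE) hL hM'
    have h2 := (ih _ hD).f2' rfl hM hd hN h1
    convert h2 using 1
    ac_rfl
  · rw [mul_comm]
    refine S2 hFc (Sem_closed.shift K) ?_ hL
    intro M hM' N hN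
    change M * N * K ∈ Sem G x b
    have h1 := I1o hd hF (ih _ hE) hK hM'
    have h2 := (ih _ hD).f2' rfl hM hd h1 hN
    convert h2 using 1
    ac_rfl

theorem f3_sep (ih : ∀ t, t ⊂ e ∪ (x ∪ c') → FF G t) (he : e.Nonempty) (hx : x.Nonempty)
    (hM : Mod G x c') (hF : Full G b' e (x ∪ c')) {K L : LQ}
    (hK : K ∈ Sem G x b) (hL : L ∈ Sem G (e ∪ c') b) : K * L ∈ Sem G (e ∪ (x ∪ c')) b := by
  have hD : x ∪ c' ⊂ e ∪ (x ∪ c') := by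
    refine ⟨Set.subset_union_right, fun h => ?_⟩
    obtain ⟨v, hv⟩ := he
    exact (hF v hv v (h (Or.inl hv))).1 rfl
  have hE : e ⊂ e ∪ (x ∪ c') := by
    refine ⟨Set.subset_union_left, fun h => ?_⟩
    obtain ⟨v, hv⟩ := hx
    exact (hF v (h (Or.inr (Or.inl hv))) v (Or.inl hv)).1 rfl
  have hFc := hF.mono (le_refl e) (Set.subset_union_right : c' ⊆ x ∪ c')
  rcases sep_cases (b' := b') (rfl : (!b) = !b) with rfl | rfl
  · rw [mul_comm]
    refine S2 hFc (Sem_closed.shift K) ?_ hL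
    intro M hM' N hN
    change M * N * K ∈ Sem G _ b'
    rw [mul_assoc, mul_comm N]
    exact S1 hF hM' ((ih _ hD).f3 rfl hM hK hN)
  · refine I2 hF ?_ ?_
    · intro M hM'
      have h1 := I1o rfl hFc (ih _ hE) hL hM'
      rw [mul_assoc]
      exact (ih _ hD).f3 rfl hM hK h1
    · intro M hM'
      have h1 := (ih _ hD).f2 rfl hM (by simp) hM' hK
      rw [Set.union_comm] at hL
      have h2 := I1 hFc.symm he hL h1
      convert h2 using 1
      ac_rfl
end sepcase

section prime
variable {s : Set G.V} {P : LGraph} {f : G.V → P.V} {b d : Bool}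

theorem prime_A1 (h : Decomp G s P f) {K : P.V → LGraph} (i : P.V) {l : LQ}
    (h1 : ∀ p, Nonempty (K p).V)
    (h2 : ∀ p, p ≠ i → q (K p) ∈ Sem G (s ∩ f ⁻¹' {p}) b)
    (h3 : q (K i) * l ∈ Sem G (s ∩ f ⁻¹' {i}) b) :
    q ((pol P (!b)).comp K) * l ∈ Sem G s b := by
  classical
  obtain ⟨M, rfl⟩ := q_surj l
  let N : P.V → LGraph := fun v => if v = i then M else LGraph.empty
  have h4 : q ((pol P (!b)).comp fun v => (K v).par (N v)) ∈ Sem G s b := by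
    refine prime_A (K := fun v => (K v).par (N v)) h (fun p => ?_) (fun p => ?_)
    · obtain ⟨x⟩ := h1 p
      exact ⟨Sum.inl x⟩
    · by_cases hp : p = i
      · subst hp
        have : N p = M := if_pos rfl
        rw [this]; exact h3
      · have : N p = LGraph.empty := if_neg hp
        rw [this, ← q_mul, ← q_one, mul_one]; exact h2 p hp
  have h5 := comp_par (Q := pol P (!b)) (K := K) (M := N) Sem_closed h4
  have h6 : ∏ v : P.V, q (N v) = q M := by
    rw [Finset.prod_eq_single i]
    · rw [show N i = M from if_pos rfl]
    · intro v _ hv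
      rw [show N v = LGraph.empty from if_neg hv]; rfl
    · simp
  exact h6 ▸ h5

theorem comp_rest (h : Decomp G s P f) (ih : ∀ t, t ⊂ s → FF G t) {K : P.V → LGraph} (i : P.V)
    (h2 : ∀ p, q (K p) ∈ Sem G (s ∩ f ⁻¹' {p}) b) :
    q (sub ((pol P (!b)).comp K) {x | x.1 ≠ i}) ∈ Sem G (s \ f ⁻¹' {i}) b := by
  refine fact4 (Q := P) (H := (pol P (!b)).comp K) (f := f) (h := fun x => x.1)
    (h.fib.mono Set.sdiff_subset) ((comp_fib (pol P (!b)) K).mono (Set.subset_univ _))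
    (fun t ht => (ih t (ht.trans (h.compl_ssub i))).orth') ?_
  intro v
  by_cases hv : v = i
  · subst hv
    have e1 : s \ f ⁻¹' {v} ∩ f ⁻¹' {v} = ∅ := by
      ext x; simp
    have e2 : ({x | x.1 ≠ v} ∩ (fun x => x.1) ⁻¹' {v} : Set ((pol P (!b)).comp K).V) = ∅ := by
      ext x
      constructor
      · rintro ⟨h1, h2⟩; exact h1 h2
      · intro h; exact h.elim
    rw [e1, Sem_empty]
    refine (congrArg (fun z => q (sub ((pol P (!b)).comp K) z) ∈ pv) e2).mpr ?_
    rw [q_sub_empty]; exact one_pv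
  · have e1 : s \ f ⁻¹' {i} ∩ f ⁻¹' {v} = s ∩ f ⁻¹' {v} := by
      ext x
      simp only [Set.mem_inter_iff, Set.mem_sdiff, Set.mem_preimage, Set.mem_singleton_iff]
      exact ⟨fun h => ⟨h.1.1, h.2⟩, fun h => ⟨⟨h.1, fun h' => hv (by rw [← h.2, h'])⟩, h.2⟩⟩
    have e2 : ({x | x.1 ≠ i} ∩ (fun x => x.1) ⁻¹' {v} : Set ((pol P (!b)).comp K).V) =
        Set.univ ∩ (fun x => x.1) ⁻¹' {v} := by
      ext x
      constructor
      · rintro ⟨h1, h2⟩; exact ⟨trivial, h2⟩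
      · rintro ⟨h1, h2⟩; exact ⟨fun h => hv (h2.symm.trans h), h2⟩
    rw [e1]
    refine (congrArg (fun z => q (sub ((pol P (!b)).comp K) z) ∈ Sem G _ b) e2).mpr ?_
    exact mem_iso (comp_fiber (pol P (!b)) K v) (h2 v)

theorem rest_union {Q : LGraph} {K : Q.V → LGraph} (i : Q.V) :
    (Set.univ ∩ (fun x => x.1) ⁻¹' {i}) ∪ {x | x.1 ≠ i} = (Set.univ : Set (Q.comp K).V) := by
  ext x
  refine iff_of_true ?_ trivial
  by_cases hx : x.1 = i
  · exact Or.inl ⟨trivial, hx⟩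
  · exact Or.inr hx

theorem rest_mod {Q : LGraph} {K : Q.V → LGraph} (i : Q.V) :
    Mod (Q.comp K) (Set.univ ∩ (fun x => x.1) ⁻¹' {i}) {x | x.1 ≠ i} := by
  have := (comp_fib Q K).mod (j := i) (J := {i}ᶜ) (by simp)
  exact this.mono (le_refl _) fun x hx => ⟨trivial, hx⟩

theorem comp_K1 {T : Set LQ} (hT : Closed T) {Q : LGraph} {K : Q.V → LGraph} (i : Q.V) {l : LQ}
    (h3 : q (sub (Q.comp K) {x | x.1 ≠ i}) ∈ T) (h4 : q (K i) * l ∈ pv) :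
    q (Q.comp K) * l ∈ T := by
  rw [q_eq.2 (comp_fiber Q K i)] at h4
  have := K1 hT (rest_mod i) h3 h4
  rw [rest_union] at this
  rwa [q_eq.2 (sub_univ _)]

theorem comp_K2 {T : Set LQ} (hT : Closed T) {Q : LGraph} {K : Q.V → LGraph} (i : Q.V) {l : LQ}
    (h5 : q (K i) ∈ T) (h4 : q (sub (Q.comp K) {x | x.1 ≠ i}) * l ∈ pv) :
    q (Q.comp K) * l ∈ T := by
  rw [q_eq.2 (comp_fiber Q K i)] at h5
  have := K2 hT (rest_mod i) h5 h4
  rw [rest_union] at this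
  rwa [q_eq.2 (sub_univ _)]

theorem f2_fib (h : Decomp G s P f) (ih : ∀ t, t ⊂ s → FF G t) {K : P.V → LGraph} (i : P.V)
    (hd : d = !b) (h2 : ∀ p, q (K p) ∈ Sem G (s ∩ f ⁻¹' {p}) b) {L : LQ}
    (hL : L ∈ Sem G (s ∩ f ⁻¹' {i}) d) :
    q ((pol P (!b)).comp K) * L ∈ Sem G (s \ f ⁻¹' {i}) b :=
  comp_K1 (Q := pol P (!b)) Sem_closed i (comp_rest h ih i h2)
    ((ih _ (h.fiber_ssub i)).orth hd (h2 i) hL)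

theorem f2'_fib (h : Decomp G s P f) (ih : ∀ t, t ⊂ s → FF G t) {K : P.V → LGraph} (i : P.V)
    (hd : d = !b) (h2 : ∀ p, q (K p) ∈ Sem G (s ∩ f ⁻¹' {p}) b) {L : LQ}
    (hL : L ∈ Sem G (s \ f ⁻¹' {i}) d) :
    q ((pol P (!b)).comp K) * L ∈ Sem G (s ∩ f ⁻¹' {i}) b :=
  comp_K2 (Q := pol P (!b)) Sem_closed i (h2 i)
    ((ih _ (h.compl_ssub i)).orth hd (comp_rest h ih i h2) hL)

end prime

end

section

variable {G : LGraph}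

section
variable {s x c : Set G.V} {P : LGraph} {f : G.V → P.V} {b d : Bool} {i : P.V}

theorem Decomp.mono (h : Decomp G s P f) (hc : c ⊆ s) (hi : ∀ p, (c ∩ f ⁻¹' {p}).Nonempty) :
    Decomp G c P f :=
  ⟨h.prime, h.card, fun p => by obtain ⟨v, hv, hv'⟩ := hi p; exact ⟨v, hv, hv'⟩, h.fib.mono hc⟩

theorem pe1 (hs : x ∪ c = s) (hx : ∀ v ∈ x, f v = i) : x ∪ (c ∩ f ⁻¹' {i}) = s ∩ f ⁻¹' {i} := by
  subst hs; ext v; have := hx v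
  simp only [Set.mem_union, Set.mem_inter_iff, Set.mem_preimage, Set.mem_singleton_iff]; tauto

theorem pe2 (hs : x ∪ c = s) (hx : ∀ v ∈ x, f v = i) : c \ f ⁻¹' {i} = s \ f ⁻¹' {i} := by
  subst hs; ext v; have := hx v
  simp only [Set.mem_union, Set.mem_sdiff, Set.mem_preimage, Set.mem_singleton_iff]; tauto

theorem pe3 (hs : x ∪ c = s) (hx : ∀ v ∈ x, f v = i) {j : P.V} (hj : j ≠ i) :
    c ∩ f ⁻¹' {j} = s ∩ f ⁻¹' {j} := by
  subst hs; ext v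
  have : v ∈ x → f v ≠ j := fun hv e => hj (by rw [← e, hx v hv])
  simp only [Set.mem_union, Set.mem_inter_iff, Set.mem_preimage, Set.mem_singleton_iff]; tauto

theorem pe4 (hs : x ∪ c = s) (hx : ∀ v ∈ x, f v = i) {j : P.V} (hj : j ≠ i) :
    x ∪ (c \ f ⁻¹' {j}) = s \ f ⁻¹' {j} := by
  subst hs; ext v
  have : v ∈ x → f v ≠ j := fun hv e => hj (by rw [← e, hx v hv])
  simp only [Set.mem_union, Set.mem_sdiff, Set.mem_preimage, Set.mem_singleton_iff]; tauto

theorem pe5 {j : P.V} : (c ∩ f ⁻¹' {j}) ∪ (c \ f ⁻¹' {j}) = c := Set.inter_union_sdiff _ _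

theorem pm5 (h : Decomp G s P f) (hc : c ⊆ s) {j : P.V} :
    Mod G (c ∩ f ⁻¹' {j}) (c \ f ⁻¹' {j}) :=
  (h.fiber_mod j).mono (Set.inter_subset_inter_left _ hc)
    (fun _ hv => ⟨hc hv.1, fun h' => hv.2 h'.2⟩)

theorem pssub (hs : x ∪ c = s) (hM : Mod G x c) (hxn : x.Nonempty) : c ⊂ s := by
  subst hs
  refine ⟨Set.subset_union_right, fun h => ?_⟩
  obtain ⟨v, hv⟩ := hxn
  exact hM.1 v hv (h (Or.inl hv))

theorem pnon (h : Decomp G s P f) (hs : x ∪ c = s) (hx : ∀ v ∈ x, f v = i)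
    (hi : (c ∩ f ⁻¹' {i}).Nonempty) : Decomp G c P f := by
  refine h.mono (sub_of_union hs).2 fun p => ?_
  by_cases hp : p = i
  · rwa [hp]
  · rw [pe3 hs hx hp]; exact h.fiber_nonempty p

theorem f3_prime (h : Decomp G s P f) (ih : ∀ t, t ⊂ s → FF G t) (hs : x ∪ c = s)
    (hM : Mod G x c) (hx : ∀ v ∈ x, f v = i) {K L : LQ}
    (hK : K ∈ Sem G x b) (hL : L ∈ Sem G c b) : K * L ∈ Sem G s b := by
  have e1 := pe1 hs hx
  have e2 := pe2 hs hx
  have hA := ih _ (h.fiber_ssub i)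
  rcases Set.eq_empty_or_nonempty (c ∩ f ⁻¹' {i}) with h0 | h0
  · rw [h0, Set.union_empty] at e1
    have e3 : c \ f ⁻¹' {i} = c := by
      have := pe5 (c := c) (f := f) (j := i)
      rwa [h0, Set.empty_union] at this
    rw [e1] at hK
    rw [← e3, e2] at hL
    exact prime_B h hK hL
  have hc := pnon h hs hx h0
  have hm1 := hM.mono (le_refl x) (Set.inter_subset_left : c ∩ f ⁻¹' {i} ⊆ c)
  rw [mul_comm]
  refine prime_le hc (Sem_closed.shift K) ?_ ?_ hL
  · intro N hN1 hN2
    refine prime_A1 h i hN1 (fun p hp => ?_) ?_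
    · rw [← pe3 hs hx hp]; exact hN2 p
    · rw [mul_comm]
      exact hA.f3 e1 hm1 hK (hN2 i)
  · intro j M hM' N hN
    change M * N * K ∈ Sem G s b
    by_cases hj : j = i
    · subst hj
      rw [e2] at hN
      have := prime_B h (hA.f3 e1 hm1 hK hM') hN
      convert this using 1
      ac_rfl
    · rw [pe3 hs hx hj] at hM'
      have h1 := (ih _ (h.compl_ssub j)).f3 (pe4 hs hx hj) (hM.mono (le_refl _) Set.sdiff_subset) hK hN
      have := prime_B h hM' h1
      convert this using 1
      ac_rfl

theorem f2_prime (h : Decomp G s P f) (ih : ∀ t, t ⊂ s → FF G t) (hs : x ∪ c = s)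
    (hM : Mod G x c) (hx : ∀ v ∈ x, f v = i) (hxn : x.Nonempty) (hd : d = !b) {K L : LQ}
    (hK : K ∈ Sem G s b) (hL : L ∈ Sem G x d) : K * L ∈ Sem G c b := by
  have e1 := pe1 hs hx
  have e2 := pe2 hs hx
  have hA := ih _ (h.fiber_ssub i)
  have hc := ih _ (pssub hs hM hxn)
  have hcs := (sub_of_union hs).2
  have hm1 := hM.mono (le_refl x) (Set.inter_subset_left : c ∩ f ⁻¹' {i} ⊆ c)
  refine prime_le h (Sem_closed.shift L) ?_ ?_ hK
  · intro N hN1 hN2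
    change q _ * L ∈ Sem G c b
    rcases Set.eq_empty_or_nonempty (c ∩ f ⁻¹' {i}) with h0 | h0
    · rw [h0, Set.union_empty] at e1
      have e3 : c \ f ⁻¹' {i} = c := by
        have := pe5 (c := c) (f := f) (j := i)
        rwa [h0, Set.empty_union] at this
      rw [e1] at hL
      rw [← e3, e2]
      exact f2_fib h ih i hd hN2 hL
    · refine prime_A1 (pnon h hs hx h0) i hN1 (fun p hp => ?_) ?_
      · rw [pe3 hs hx hp]; exact hN2 p
      · exact hA.f2 e1 hm1 hd (hN2 i) hL
  · intro j M hM' N hN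
    change M * N * L ∈ Sem G c b
    by_cases hj : j = i
    · subst hj
      have h1 := hA.f2 e1 hm1 hd hM' hL
      rw [← e2] at hN
      have := hc.f3 pe5 (pm5 h hcs) h1 hN
      convert this using 1
      ac_rfl
    · have h1 := (ih _ (h.compl_ssub j)).f2 (pe4 hs hx hj) (hM.mono (le_refl _) Set.sdiff_subset)
        hd hN hL
      rw [← pe3 hs hx hj] at hM'
      have := hc.f3 pe5 (pm5 h hcs) hM' h1
      convert this using 1
      ac_rfl

/-- `f2'` for a fiber -/
theorem f2'_prime0 (h : Decomp G s P f) (ih : ∀ t, t ⊂ s → FF G t) (hd : d = !b) {K L : LQ}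
    (hK : K ∈ Sem G s b) (hL : L ∈ Sem G (s \ f ⁻¹' {i}) d) : K * L ∈ Sem G (s ∩ f ⁻¹' {i}) b := by
  refine prime_le h (Sem_closed.shift L) ?_ ?_ hK
  · intro N hN1 hN2
    exact f2'_fib h ih i hd hN2 hL
  · intro j M hM' N hN
    change M * N * L ∈ Sem G _ b
    have hB := ih _ (h.compl_ssub i)
    by_cases hj : j = i
    · subst hj
      rw [mul_assoc]
      exact Sem_closed.mul_pv hM' (hB.orth hd hN hL)
    · have hs : (s ∩ f ⁻¹' {i}) ∪ (s \ f ⁻¹' {i}) = s := pe5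
      have hx : ∀ v ∈ s ∩ f ⁻¹' {i}, f v = i := fun v hv => hv.2
      rw [← pe3 hs hx hj] at hM'
      have h1 := hB.f2 pe5 (pm5 h Set.sdiff_subset) (by simp [hd]) hL hM'
      have h2 := (ih _ (h.compl_ssub j)).f2' (pe4 hs hx hj)
        ((pm5 h (le_refl s)).mono (le_refl _) Set.sdiff_subset) hd hN h1
      convert h2 using 1
      ac_rfl

theorem f2'_prime (h : Decomp G s P f) (ih : ∀ t, t ⊂ s → FF G t) (hs : x ∪ c = s)
    (hM : Mod G x c) (hx : ∀ v ∈ x, f v = i) (hxn : x.Nonempty) (hd : d = !b) {K L : LQ}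
    (hK : K ∈ Sem G s b) (hL : L ∈ Sem G c d) : K * L ∈ Sem G x b := by
  have e1 := pe1 hs hx
  have e2 := pe2 hs hx
  have hA := ih _ (h.fiber_ssub i)
  have hc := ih _ (pssub hs hM hxn)
  have hcs := (sub_of_union hs).2
  have hm1 := hM.mono (le_refl x) (Set.inter_subset_left : c ∩ f ⁻¹' {i} ⊆ c)
  rcases Set.eq_empty_or_nonempty (c ∩ f ⁻¹' {i}) with h0 | h0
  · rw [h0, Set.union_empty] at e1
    have e3 : c \ f ⁻¹' {i} = c := by
      have := pe5 (c := c) (f := f) (j := i)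
      rwa [h0, Set.empty_union] at this
    rw [e1]
    rw [← e3, e2] at hL
    exact f2'_prime0 h ih hd hK hL
  have hcD := pnon h hs hx h0
  have hd' : b = !d := by simp [hd]
  refine prime_le h (Sem_closed.shift L) ?_ ?_ hK
  · intro N hN1 hN2
    change q _ * L ∈ Sem G x b
    have hN3 := prime_A h hN1 hN2
    rw [mul_comm]
    refine prime_le hcD (Sem_closed.shift _) ?_ ?_ hL
    · intro N' hN1' hN2'
      change q _ * q _ ∈ Sem G x b
      rw [mul_comm, ← hd']
      refine p_rule Sem_closed h.prime h.card hN1 hN1' b ?_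
      refine comp_kill (Q := kgr P.V true) Sem_closed i ?_ ?_
      · exact hA.f2' e1 hm1 hd (hN2 i) (hN2' i)
      · intro j hj
        have h1 := hN2' j
        rw [pe3 hs hx hj] at h1
        exact (ih _ (h.fiber_ssub j)).orth hd (hN2 j) h1
    · intro j M' hM' N' hN'
      change M' * N' * q _ ∈ Sem G x b
      by_cases hj : j = i
      · subst hj
        rw [e2] at hN'
        have h1 := f2'_prime0 h ih hd hN3 hN'
        have h2 := hA.f2' e1 hm1 hd h1 hM'
        convert h2 using 1
        ac_rfl
      · rw [pe3 hs hx hj] at hM'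
        have h1 := f2_prime h ih (pe5 (j := j)) (pm5 h (le_refl s)) (fun v hv => hv.2)
          (h.fiber_nonempty j) hd hN3 hM'
        have h2 := (ih _ (h.compl_ssub j)).f2' (pe4 hs hx hj)
          (hM.mono (le_refl _) Set.sdiff_subset) hd h1 hN'
        convert h2 using 1
        ac_rfl
  · intro j M hM' N hN
    change M * N * L ∈ Sem G x b
    by_cases hj : j = i
    · subst hj
      rw [← e2] at hN
      have h1 := hc.f2' pe5 (pm5 h hcs) hd' hL hN
      have h2 := hA.f2' e1 hm1 hd hM' h1
      convert h2 using 1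
      ac_rfl
    · rw [← pe3 hs hx hj] at hM'
      have h1 := hc.f2 pe5 (pm5 h hcs) hd' hL hM'
      have h2 := (ih _ (h.compl_ssub j)).f2' (pe4 hs hx hj)
          (hM.mono (le_refl _) Set.sdiff_subset) hd hN h1
      convert h2 using 1
      ac_rfl

theorem orth_prime (h : Decomp G s P f) (ih : ∀ t, t ⊂ s → FF G t) (hd : d = !b) {K L : LQ}
    (hK : K ∈ Sem G s b) (hL : L ∈ Sem G s d) : K * L ∈ pv := by
  have hd' : b = !d := by simp [hd]
  refine prime_le h (pv_closed.shift L) ?_ ?_ hK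
  · intro N hN1 hN2
    change q _ * L ∈ pv
    have hN3 := prime_A h hN1 hN2
    rw [mul_comm]
    refine prime_le h (pv_closed.shift _) ?_ ?_ hL
    · intro N' hN1' hN2'
      change q _ * q _ ∈ pv
      rw [mul_comm, ← hd']
      refine p_rule pv_closed h.prime h.card hN1 hN1' b ?_
      exact comp_kill_all (Q := kgr P.V true) fun j =>
        (ih _ (h.fiber_ssub j)).orth hd (hN2 j) (hN2' j)
    · intro j M' hM' N' hN'
      change M' * N' * q _ ∈ pv
      have h1 := f2_prime h ih (pe5 (j := j)) (pm5 h (le_refl s)) (fun v hv => hv.2)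
          (h.fiber_nonempty j) hd hN3 hM'
      have h2 := (ih _ (h.compl_ssub j)).orth hd h1 hN'
      convert h2 using 1
      ac_rfl
  · intro j M hM' N hN
    change M * N * L ∈ pv
    have h1 := f2_prime h ih (pe5 (j := j)) (pm5 h (le_refl s)) (fun v hv => hv.2)
          (h.fiber_nonempty j) hd' hL hM'
    have h2 := (ih _ (h.compl_ssub j)).orth hd hN h1
    convert h2 using 1
    ac_rfl
end

theorem orth_sep {s t : Set G.V} {b d : Bool} (ht : Sep G b s t) (ih : ∀ t, t ⊂ s → FF G t)
    (hd : d = !b) {K L : LQ}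
    (hK : K ∈ Sem G s b) (hL : L ∈ Sem G s d) : K * L ∈ pv := by
  have e : t ∪ (s \ t) = s := Set.union_sdiff_cancel ht.1
  rw [← e] at hK hL
  refine S2 (T := {K | K * L ∈ pv}) ht.2.2.2 (pv_closed.shift L) ?_ hK
  intro M hM N hN
  change M * N * L ∈ pv
  have h1 := I1o (by simp [hd]) ht.2.2.2 (ih _ ht.ssub) hL hM
  have h2 := (ih _ ht.ssub').orth hd hN h1
  convert h2 using 1
  ac_rfl

theorem ai_pv (a : Atom) : q (single (dualAtom a)) * q (single a) ∈ pv := by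
  rw [q_mul, pv_iff]; exact rule_D (GSRule.ai a)

theorem orth_single {v : G.V} {b d : Bool} (hd : d = !b) {K L : LQ}
    (hK : K ∈ Sem G {v} b) (hL : L ∈ Sem G {v} d) : K * L ∈ pv := by
  rw [Sem_single] at hK hL
  refine Cl_sub (pv_closed.shift L) ?_ hK
  rintro _ rfl
  change q _ * L ∈ pv
  rw [mul_comm]
  refine Cl_sub (pv_closed.shift _) ?_ hL
  rintro _ rfl
  change q _ * q _ ∈ pv
  subst hd
  cases b
  · exact ai_pv _
  · rw [mul_comm]; exact ai_pv _

theorem FF_all (s : Set G.V) : FF G s := by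
  induction s using WellFoundedLT.induction with
  | ind s ih =>
  have ho : ∀ {b d : Bool} {K L : LQ}, d = !b → K ∈ Sem G s b → L ∈ Sem G s d → K * L ∈ pv := by
    intro b d K L hd hK hL
    rcases decomp_exists s with rfl | ⟨v, rfl⟩ | ⟨b', t, h⟩ | ⟨P, f, h⟩
    · rw [Sem_empty] at hK hL; exact pv_closed.mul_pv hK hL
    · exact orth_single hd hK hL
    · rcases sep_cases (b' := b') hd with rfl | rfl
      · exact orth_sep h ih hd hK hL
      · rw [mul_comm]; exact orth_sep h ih (by simp [hd]) hL hK
    · exact orth_prime h ih hd hK hL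
  have key : ∀ {x c : Set G.V}, x ∪ c = s → Mod G x c → x.Nonempty → c.Nonempty →
      (∃ b' e c', e.Nonempty ∧ e ∪ c' = c ∧ s = e ∪ (x ∪ c') ∧ Full G b' e (x ∪ c') ∧ Mod G x c')
      ∨ (∃ (P : LGraph) (f : G.V → P.V) (i : P.V), Decomp G s P f ∧ ∀ v ∈ x, f v = i) := by
    intro x c hs hM hx hc
    rcases decomp_exists s with rfl | ⟨v, rfl⟩ | ⟨b', t, h⟩ | ⟨P, f, h⟩
    · obtain ⟨v, hv⟩ := hx
      exact absurd ((sub_of_union hs).1 hv) id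
    · obtain ⟨y, hy⟩ := hx
      obtain ⟨z, hz⟩ := hc
      have h1 : y = v := (sub_of_union hs).1 hy
      have h2 : z = v := (sub_of_union hs).2 hz
      subst h1; subst h2
      exact absurd hz (hM.1 _ hy)
    · obtain ⟨e, c', h1, h2, h3, h4⟩ := sep_choice hs hM hc h
      refine Or.inl ⟨b', e, c', h1, h2, ?_, h4, hM.mono (le_refl _) (sub_of_union h2).2⟩
      rw [← hs, ← h2]
      ext v; simp only [Set.mem_union]; tauto
    · have e : s \ x = c := by
        subst hs
        ext v; have := hM.1 v
        simp only [Set.mem_union, Set.mem_sdiff]; tauto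
      obtain ⟨i, hi⟩ := h.mod_fiber (x := x) (sub_of_union hs).1 (by rwa [e]) (by
        rintro rfl
        rw [← e] at hc; simp at hc)
      exact Or.inr ⟨P, f, i, h, hi⟩
  refine ⟨?_, ?_, ?_, ho⟩
  · intro x c b d K L hs hM hd hK hL
    rcases Set.eq_empty_or_nonempty x with rfl | hx
    · rw [Set.empty_union] at hs; subst hs
      rw [Sem_empty] at hL; exact Sem_closed.mul_pv hK hL
    rcases Set.eq_empty_or_nonempty c with rfl | hc
    · rw [Set.union_empty] at hs; subst hs
      rw [Sem_empty]; exact ho hd hK hL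
    rcases key hs hM hx hc with ⟨b', e, c', h1, rfl, rfl, h3, h4⟩ | ⟨P, f, i, h, hi⟩
    · exact f2_sep ih h1 hx h4 h3 hd hK hL
    · exact f2_prime h ih hs hM hi hx hd hK hL
  · intro x c b d K L hs hM hd hK hL
    rcases Set.eq_empty_or_nonempty c with rfl | hc
    · rw [Set.union_empty] at hs; subst hs
      rw [Sem_empty] at hL; exact Sem_closed.mul_pv hK hL
    rcases Set.eq_empty_or_nonempty x with rfl | hx
    · rw [Set.empty_union] at hs; subst hs
      rw [Sem_empty]; exact ho hd hK hL
    rcases key hs hM hx hc with ⟨b', e, c', h1, rfl, rfl, h3, h4⟩ | ⟨P, f, i, h, hi⟩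
    · exact f2'_sep ih h1 hx h4 h3 hd hK hL
    · exact f2'_prime h ih hs hM hi hx hd hK hL
  · intro x c b K L hs hM hK hL
    rcases Set.eq_empty_or_nonempty c with rfl | hc
    · rw [Set.union_empty] at hs; subst hs
      rw [Sem_empty] at hL; exact Sem_closed.mul_pv hK hL
    rcases Set.eq_empty_or_nonempty x with rfl | hx
    · rw [Set.empty_union] at hs; subst hs
      rw [Sem_empty] at hK; exact mul_pv' Sem_closed hK hL
    rcases key hs hM hx hc with ⟨b', e, c', h1, rfl, rfl, h3, h4⟩ | ⟨P, f, i, h, hi⟩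
    · exact f3_sep ih h1 hx h4 h3 hK hL
    · exact f3_prime h ih hs hM hi hK hL

end

section

section
variable {G : LGraph} {x c s : Set G.V} {b d : Bool} {K L : LQ}

theorem F2 (hs : x ∪ c = s) (hM : Mod G x c) (hd : d = !b)
    (hK : K ∈ Sem G s b) (hL : L ∈ Sem G x d) : K * L ∈ Sem G c b := (FF_all s).f2 hs hM hd hK hL

theorem F2' (hs : x ∪ c = s) (hM : Mod G x c) (hd : d = !b)
    (hK : K ∈ Sem G s b) (hL : L ∈ Sem G c d) : K * L ∈ Sem G x b := (FF_all s).f2' hs hM hd hK hL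

theorem F3 (hs : x ∪ c = s) (hM : Mod G x c)
    (hK : K ∈ Sem G x b) (hL : L ∈ Sem G c b) : K * L ∈ Sem G s b := (FF_all s).f3 hs hM hK hL

theorem orth (hd : d = !b) (hK : K ∈ Sem G s b) (hL : L ∈ Sem G s d) : K * L ∈ pv :=
  (FF_all s).orth hd hK hL

theorem J1 {t r : Set G.V} (hs : t ∪ r = s) (hd : d = !b) (h : Full G d t r)
    (hK : K ∈ Sem G s b) (hL : L ∈ Sem G t d) : K * L ∈ Sem G r b := by
  subst hs; exact I1o hd h (FF_all t) hK hL

theorem okada : q G ∈ Sem G Set.univ false := by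
  have : q (sub G Set.univ) ∈ Sem G Set.univ false := by
    refine fact4 (Q := G) (f := fun v => v) (h := fun v => v) (fun v _ w _ _ => Iff.rfl)
      (fun v _ w _ _ => E_true.symm) (fun t _ => (FF_all t).orth') ?_
    intro v
    have e : Set.univ ∩ (fun v => v) ⁻¹' {v} = {v} := by ext w; simp
    rw [e, Sem_single]
    refine mem_iso (X := single (G.label v)) ?_ (sub_Cl rfl)
    refine iso_sub (fun _ => v) (fun _ _ _ => rfl) ?_ ?_ ?_
    · intro y
      exact ⟨fun h => ⟨(), Eq.symm h⟩, fun ⟨_, h⟩ => h.symm⟩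
    · intro _ _
      exact iff_of_false (fun h => h) (G.irrefl v)
    · intro _; rfl
  rwa [q_eq.2 (sub_univ G)]
end

def Le (G : LGraph) (s : Set G.V) (H : LGraph) (s' : Set H.V) (b : Bool) : Prop :=
  Sem G s b ⊆ Sem H s' b ∧ Sem H s' (!b) ⊆ Sem G s (!b)

theorem Le.swap {G H : LGraph} {s : Set G.V} {s' : Set H.V} {b : Bool} (h : Le G s H s' b) :
    Le H s' G s (!b) := ⟨h.2, by rw [Bool.not_not]; exact h.1⟩

theorem Le.swap' {G H : LGraph} {s : Set G.V} {s' : Set H.V} {b : Bool} (h : Le G s H s' (!b)) :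
    Le H s' G s b := by
  have := h.swap; rwa [Bool.not_not] at this

theorem Le.refl {G : LGraph} {s : Set G.V} {b : Bool} : Le G s G s b := ⟨subset_rfl, subset_rfl⟩

theorem Le.trans {G H K : LGraph} {s : Set G.V} {s' : Set H.V} {s'' : Set K.V} {b : Bool}
    (h : Le G s H s' b) (h' : Le H s' K s'' b) : Le G s K s'' b :=
  ⟨h.1.trans h'.1, h'.2.trans h.2⟩

theorem Le_sep0 {G H : LGraph} {t r : Set G.V} {t' r' : Set H.V} {b b' : Bool}
    (hF : Full G b' t r) (hF' : Full H b' t' r') (ht : Le G t H t' b) (hr : Le G r H r' b) :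
    Sem G (t ∪ r) b ⊆ Sem H (t' ∪ r') b := by
  rcases sep_cases (b' := b') (rfl : (!b) = !b) with rfl | rfl
  · exact S2 hF Sem_closed fun K hK L hL => S1 hF' (ht.1 hK) (hr.1 hL)
  · intro K hK
    refine I2 hF' (fun L hL => hr.1 (J1 rfl rfl hF hK (ht.2 hL))) (fun L hL => ht.1 ?_)
    rw [Set.union_comm] at hK
    exact J1 rfl rfl hF.symm hK (hr.2 hL)

theorem Le_sep {G H : LGraph} {t r : Set G.V} {t' r' : Set H.V} {b b' : Bool}
    (hF : Full G b' t r) (hF' : Full H b' t' r') (ht : Le G t H t' b) (hr : Le G r H r' b) :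
    Le G (t ∪ r) H (t' ∪ r') b :=
  ⟨Le_sep0 hF hF' ht hr, Le_sep0 hF' hF ht.swap hr.swap⟩

theorem Le_prime0 {G H P : LGraph} {s : Set G.V} {s' : Set H.V} {f : G.V → P.V} {f' : H.V → P.V}
    {b : Bool} (h : Decomp G s P f) (h' : Decomp H s' P f')
    (h1 : ∀ p, Le G (s ∩ f ⁻¹' {p}) H (s' ∩ f' ⁻¹' {p}) b)
    (h2 : ∀ p, Le G (s \ f ⁻¹' {p}) H (s' \ f' ⁻¹' {p}) b) : Sem G s b ⊆ Sem H s' b :=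
  prime_le h Sem_closed (fun _ hK1 hK2 => prime_A h' hK1 fun p => (h1 p).1 (hK2 p))
    fun p _ hK _ hL => prime_B h' ((h1 p).1 hK) ((h2 p).1 hL)

theorem Le_prime {G H P : LGraph} {s : Set G.V} {s' : Set H.V} {f : G.V → P.V} {f' : H.V → P.V}
    {b : Bool} (h : Decomp G s P f) (h' : Decomp H s' P f')
    (h1 : ∀ p, Le G (s ∩ f ⁻¹' {p}) H (s' ∩ f' ⁻¹' {p}) b)
    (h2 : ∀ p, Le G (s \ f ⁻¹' {p}) H (s' \ f' ⁻¹' {p}) b) : Le G s H s' b :=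
  ⟨Le_prime0 h h' h1 h2, Le_prime0 h' h (fun p => (h1 p).swap) (fun p => (h2 p).swap)⟩

theorem Le_of_single {G H : LGraph} {v : G.V} {w : H.V} (h : G.label v = H.label w) {b : Bool} :
    Le G {v} H {w} b := by
  refine ⟨?_, ?_⟩ <;> rw [Sem_single, Sem_single, h]

theorem Sem_map {G H : LGraph} (f : G.V → H.V) {b : Bool} (s : Set G.V) :
    Set.InjOn f s → (∀ x ∈ s, ∀ y ∈ s, (G.adj x y ↔ H.adj (f x) (f y))) →
    (∀ x ∈ s, G.label x = H.label (f x)) → Le G s H (f '' s) b := by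
  induction s using WellFoundedLT.induction with
  | ind s ih =>
  intro hi ha hl
  have IH : ∀ t, t ⊂ s → Le G t H (f '' t) b := fun t ht => ih t ht (hi.mono ht.1)
    (fun x hx y hy => ha x (ht.1 hx) y (ht.1 hy)) (fun x hx => hl x (ht.1 hx))
  rcases decomp_exists s with rfl | ⟨v, rfl⟩ | ⟨b', t, h⟩ | ⟨P, g, h⟩
  · rw [Set.image_empty]; exact ⟨by rw [Sem_empty, Sem_empty], by rw [Sem_empty, Sem_empty]⟩
  · rw [Set.image_singleton]; exact Le_of_single (hl v rfl)
  · have e : t ∪ (s \ t) = s := Set.union_sdiff_cancel h.1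
    have e' : f '' t ∪ f '' (s \ t) = f '' s := by rw [← Set.image_union, e]
    have := Le_sep (G := G) (H := H) (t' := f '' t) (r' := f '' (s \ t)) h.2.2.2 ?_
      (IH _ h.ssub) (IH _ h.ssub')
    · rwa [e, e'] at this
    · rintro _ ⟨x, hx, rfl⟩ _ ⟨y, hy, rfl⟩
      have h1 := h.2.2.2 x hx y hy
      refine ⟨fun e => h1.1 (hi (h.1 hx) hy.1 e), ?_⟩
      rw [← ha x (h.1 hx) y hy.1]; exact h1.2
  · obtain ⟨v0, _⟩ : s.Nonempty := Set.nonempty_iff_ne_empty.2 h.ne.1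
    have : Nonempty G.V := ⟨v0⟩
    let f' : H.V → P.V := fun y => g (Function.invFunOn f s y)
    have hf' : ∀ x ∈ s, f' (f x) = g x := fun x hx => congrArg g (hi.leftInvOn_invFunOn hx)
    have e1 : ∀ p, f '' s ∩ f' ⁻¹' {p} = f '' (s ∩ g ⁻¹' {p}) := by
      intro p; ext y
      constructor
      · rintro ⟨⟨x, hx, rfl⟩, h2⟩
        exact ⟨x, ⟨hx, (hf' x hx).symm.trans h2⟩, rfl⟩
      · rintro ⟨x, ⟨hx, hx'⟩, rfl⟩
        exact ⟨⟨x, hx, rfl⟩, (hf' x hx).trans hx'⟩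
    have e2 : ∀ p, f '' s \ f' ⁻¹' {p} = f '' (s \ g ⁻¹' {p}) := by
      intro p; ext y
      constructor
      · rintro ⟨⟨x, hx, rfl⟩, h2⟩
        exact ⟨x, ⟨hx, fun h' => h2 ((hf' x hx).trans h')⟩, rfl⟩
      · rintro ⟨x, ⟨hx, hx'⟩, rfl⟩
        exact ⟨⟨x, hx, rfl⟩, fun h' => hx' ((hf' x hx).symm.trans h')⟩
    refine Le_prime (f := g) (f' := f') h ⟨h.prime, h.card, ?_, ?_⟩ ?_ ?_
    · intro p
      obtain ⟨x, hx, rfl⟩ := h.surj p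
      exact ⟨f x, ⟨x, hx, rfl⟩, hf' x hx⟩
    · rintro _ ⟨x, hx, rfl⟩ _ ⟨y, hy, rfl⟩ hne
      rw [hf' x hx, hf' y hy] at *
      rw [← ha x hx y hy]; exact h.fib x hx y hy hne
    · intro p; rw [e1]; exact IH _ (h.fiber_ssub p)
    · intro p; rw [e2]; exact IH _ (h.compl_ssub p)

theorem Le_iso {G H : LGraph} (h : G.iso H) {b : Bool} : Le G Set.univ H Set.univ b := by
  obtain ⟨e, ha, hl⟩ := h
  have := Sem_map (b := b) e (Set.univ : Set G.V) e.injective.injOn (fun x _ y _ => ha x y)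
    (fun x _ => (hl x).symm)
  rwa [Set.image_univ, e.surjective.range_eq] at this

/-! contexts -/

theorem Le_one0 {G : LGraph} {x c s : Set G.V} {b : Bool} (hs : x ∪ c = s) (hM : Mod G x c)
    (h : (1 : LQ) ∈ Sem G x b) : Le G c G s b := by
  refine ⟨fun K hK => ?_, fun K hK => ?_⟩
  · simpa using F3 hs hM h hK
  · simpa using F2 (d := b) hs hM (by simp) hK h

def bg (C : LGraph) (R : Set C.V) (X : LGraph) (c : Set C.V) : Set (C.plug R X).V :=
  Set.range Sum.inr ∪ Sum.inl '' c

theorem bg_inl {C : LGraph} {R : Set C.V} {X : LGraph} {c : Set C.V} {u : C.V} :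
    (Sum.inl u : (C.plug R X).V) ∈ bg C R X c ↔ u ∈ c := by
  constructor
  · rintro (⟨w, hw⟩ | ⟨w, hw, e⟩)
    · cases hw
    · cases e; exact hw
  · intro h; exact Or.inr ⟨u, h, rfl⟩

theorem bg_inr {C : LGraph} {R : Set C.V} {X : LGraph} {c : Set C.V} {u : X.V} :
    (Sum.inr u : (C.plug R X).V) ∈ bg C R X c := Or.inl ⟨u, rfl⟩

theorem bg_mod {C : LGraph} {R : Set C.V} {X : LGraph} {c : Set C.V} :
    Mod (C.plug R X) (Set.range Sum.inr) (Sum.inl '' c) := by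
  constructor
  · rintro _ ⟨w, rfl⟩ ⟨u, _, e⟩; cases e
  · rintro _ ⟨u, _, rfl⟩ _ ⟨y, rfl⟩ _ ⟨z, rfl⟩
    exact Iff.rfl

theorem Le_inl {C : LGraph} (R R' : Set C.V) (X X' : LGraph) (c : Set C.V) {b : Bool} :
    Le (C.plug R X) (Sum.inl '' c) (C.plug R' X') (Sum.inl '' c) b := by
  have h : ∀ R X b, Le C c (C.plug R X) (Sum.inl '' c) b := fun R X b =>
    Sem_map (H := C.plug R X) Sum.inl c Sum.inl_injective.injOn (fun _ _ _ _ => Iff.rfl)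
      (fun _ _ => rfl)
  exact (h R X (!b)).swap'.trans (h R' X' b)

theorem Le_inr (C : LGraph) (R : Set C.V) (X : LGraph) {b : Bool} :
    Le X Set.univ (C.plug R X) (Set.range Sum.inr) b := by
  have := Sem_map (b := b) (H := C.plug R X) Sum.inr (Set.univ : Set X.V) Sum.inr_injective.injOn
    (fun _ _ _ _ => Iff.rfl) (fun _ _ => rfl)
  have e : (Sum.inr '' Set.univ : Set (C.plug R X).V) = Set.range Sum.inr := Set.image_univ
  exact (congrArg (fun z => Le X Set.univ (C.plug R X) z b) e).mp this

theorem Le_inr' (C : LGraph) (R : Set C.V) (X : LGraph) {b : Bool} :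
    Le (C.plug R X) (Set.range Sum.inr) X Set.univ b := (Le_inr C R X).swap'

theorem mono_empty {C X X' : LGraph} {R : Set C.V} {c : Set C.V} {b : Bool}
    (h : Le X Set.univ X' Set.univ b) (hX : IsEmpty X.V) :
    Le (C.plug R X) (bg C R X c) (C.plug R X') (bg C R X' c) b := by
  have e : bg C R X c = Sum.inl '' c := by
    ext v
    constructor
    · rintro (⟨w, _⟩ | hv)
      · exact hX.elim w
      · exact hv
    · exact fun hv => Or.inr hv
  have h1 : (1 : LQ) ∈ Sem X Set.univ b := by
    rw [Set.univ_eq_empty_iff.2 hX, Sem_empty]; exact one_pv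
  have h2 := (Le_inr C R X').1 (h.1 h1)
  rw [e]
  exact (Le_inl R R X X' c).trans (Le_one0 rfl bg_mod h2)

theorem mono_aux {C X X' : LGraph} {R : Set C.V} {b : Bool} (h : Le X Set.univ X' Set.univ b)
    (hX : Nonempty X.V) (hX' : Nonempty X'.V) (c : Set C.V) :
    Le (C.plug R X) (bg C R X c) (C.plug R X') (bg C R X' c) b := by
  induction c using WellFoundedLT.induction with
  | ind c ih =>
  obtain ⟨w0⟩ := hX
  obtain ⟨w0'⟩ := hX'
  rcases Set.eq_empty_or_nonempty c with rfl | hc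
  · have e : ∀ X, bg C R X ∅ = Set.range Sum.inr := by
      intro X; ext v
      constructor
      · rintro (hv | ⟨w, hw, _⟩)
        · exact hv
        · exact hw.elim
      · exact fun hv => Or.inl hv
    rw [e, e]
    exact ((Le_inr' C R X).trans h).trans (Le_inr C R X')
  rcases decomp_exists (bg C R X c) with h0 | ⟨v, h0⟩ | ⟨b', t, h0⟩ | ⟨P, f, h0⟩
  · have : (Sum.inr w0 : (C.plug R X).V) ∈ bg C R X c := bg_inr
    rw [h0] at this; exact this.elim
  · obtain ⟨u, hu⟩ := hc
    have h1 : (Sum.inr w0 : (C.plug R X).V) ∈ bg C R X c := bg_inr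
    have h2 : (Sum.inl u : (C.plug R X).V) ∈ bg C R X c := bg_inl.2 hu
    rw [h0] at h1 h2
    have : (Sum.inr w0 : (C.plug R X).V) = Sum.inl u := h1.trans h2.symm
    cases this
  · obtain ⟨e, c', he, hec, hdis, hF⟩ := sep_choice rfl bg_mod (hc.image _) h0
    have hsub : ∀ z : Set (C.plug R X).V, z ⊆ Sum.inl '' c → ∃ z0 ⊆ c, Sum.inl '' z0 = z :=
      fun z hz => Set.subset_image_iff.1 hz
    obtain ⟨e0, he0, rfl⟩ := hsub e (by rw [← hec]; exact Set.subset_union_left)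
    obtain ⟨c0, hc0, rfl⟩ := hsub c' (by rw [← hec]; exact Set.subset_union_right)
    have hs : c0 ⊂ c := by
      refine ⟨hc0, fun hh => ?_⟩
      obtain ⟨_, u, hu, rfl⟩ := he
      exact hdis _ ⟨u, hu, rfl⟩ ⟨u, hh (he0 hu), rfl⟩
    have hec' : e0 ∪ c0 = c := by
      ext u
      constructor
      · rintro (hu | hu)
        · exact he0 hu
        · exact hc0 hu
      · intro hu
        have : (Sum.inl u : (C.plug R X).V) ∈ (Sum.inl '' e0 ∪ Sum.inl '' c0 : Set (C.plug R X).V) :=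
          hec.symm ▸ ⟨u, hu, rfl⟩
        rcases this with ⟨w, hw, hw'⟩ | ⟨w, hw, hw'⟩
        · cases hw'; exact Or.inl hw
        · cases hw'; exact Or.inr hw
    have e1 : ∀ X, bg C R X c = Sum.inl '' e0 ∪ bg C R X c0 := by
      intro X
      ext v
      constructor
      · rintro (hv | ⟨u, hu, rfl⟩)
        · exact Or.inr (Or.inl hv)
        · rw [← hec'] at hu
          rcases hu with hu | hu
          · exact Or.inl ⟨u, hu, rfl⟩
          · exact Or.inr (Or.inr ⟨u, hu, rfl⟩)
      · rintro (⟨u, hu, rfl⟩ | hv | ⟨u, hu, rfl⟩)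
        · exact Or.inr ⟨u, he0 hu, rfl⟩
        · exact Or.inl hv
        · exact Or.inr ⟨u, hc0 hu, rfl⟩
    rw [e1, e1]
    refine Le_sep (b' := b') (G := C.plug R X) (H := C.plug R X') hF ?_ (Le_inl R R X X' e0) (ih _ hs)
    rintro _ ⟨u, hu, rfl⟩ v hv
    rcases hv with ⟨w, rfl⟩ | ⟨w, hw, rfl⟩
    · exact ⟨fun h => (by cases h), (hF _ ⟨u, hu, rfl⟩ _ (Or.inl ⟨w0, rfl⟩)).2⟩
    · have := hF _ ⟨u, hu, rfl⟩ _ (Or.inr ⟨w, hw, rfl⟩)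
      exact ⟨fun h => (by cases h; exact this.1 rfl), this.2⟩
  · obtain ⟨i, hi⟩ := h0.mod_fiber (x := Set.range Sum.inr) Set.subset_union_left (by
        refine Mod.mono (bg_mod (c := c)) subset_rfl ?_
        rintro v ⟨hv | hv, hv'⟩
        · exact absurd hv hv'
        · exact hv) (by
        intro e
        obtain ⟨u, hu⟩ := hc
        have : (Sum.inl u : (C.plug R X).V) ∈ bg C R X c := bg_inl.2 hu
        rw [← e] at this
        obtain ⟨w, hw⟩ := this
        cases hw)
    have hi' : ∀ w, f (Sum.inr w) = i := fun w => hi _ ⟨w, rfl⟩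
    let f' : (C.plug R X').V → P.V := Sum.elim (fun u => f (Sum.inl u)) (fun _ => i)
    have k1 : ∀ X (g : (C.plug R X).V → P.V), (∀ u, g (Sum.inl u) = f (Sum.inl u)) →
        (∀ w, g (Sum.inr w) = i) → ∀ p, p ≠ i → bg C R X c ∩ g ⁻¹' {p} =
          Sum.inl '' {u ∈ c | f (Sum.inl u) = p} := by
      intro X g hg1 hg2 p hp
      ext v
      constructor
      · rintro ⟨⟨w, rfl⟩ | ⟨u, hu, rfl⟩, h2⟩
        · exact absurd ((hg2 w).symm.trans h2) (Ne.symm hp)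
        · exact ⟨u, ⟨hu, (hg1 u).symm.trans h2⟩, rfl⟩
      · rintro ⟨u, ⟨hu, hu'⟩, rfl⟩
        exact ⟨bg_inl.2 hu, (hg1 u).trans hu'⟩
    have k2 : ∀ X (g : (C.plug R X).V → P.V), (∀ u, g (Sum.inl u) = f (Sum.inl u)) →
        (∀ w, g (Sum.inr w) = i) → bg C R X c ∩ g ⁻¹' {i} =
          bg C R X {u ∈ c | f (Sum.inl u) = i} := by
      intro X g hg1 hg2
      ext v
      constructor
      · rintro ⟨⟨w, rfl⟩ | ⟨u, hu, rfl⟩, h2⟩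
        · exact bg_inr
        · exact bg_inl.2 ⟨hu, (hg1 u).symm.trans h2⟩
      · rintro (⟨w, rfl⟩ | ⟨u, ⟨hu, hu'⟩, rfl⟩)
        · exact ⟨bg_inr, hg2 w⟩
        · exact ⟨bg_inl.2 hu, (hg1 u).trans hu'⟩
    have k3 : ∀ X (g : (C.plug R X).V → P.V), (∀ u, g (Sum.inl u) = f (Sum.inl u)) →
        (∀ w, g (Sum.inr w) = i) → bg C R X c \ g ⁻¹' {i} =
          Sum.inl '' {u ∈ c | f (Sum.inl u) ≠ i} := by
      intro X g hg1 hg2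
      ext v
      constructor
      · rintro ⟨⟨w, rfl⟩ | ⟨u, hu, rfl⟩, h2⟩
        · exact absurd (hg2 w) h2
        · exact ⟨u, ⟨hu, fun h' => h2 ((hg1 u).trans h')⟩, rfl⟩
      · rintro ⟨u, ⟨hu, hu'⟩, rfl⟩
        exact ⟨bg_inl.2 hu, fun h' => hu' ((hg1 u).symm.trans h')⟩
    have k4 : ∀ X (g : (C.plug R X).V → P.V), (∀ u, g (Sum.inl u) = f (Sum.inl u)) →
        (∀ w, g (Sum.inr w) = i) → ∀ p, p ≠ i → bg C R X c \ g ⁻¹' {p} =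
          bg C R X {u ∈ c | f (Sum.inl u) ≠ p} := by
      intro X g hg1 hg2 p hp
      ext v
      constructor
      · rintro ⟨⟨w, rfl⟩ | ⟨u, hu, rfl⟩, h2⟩
        · exact bg_inr
        · exact bg_inl.2 ⟨hu, fun h' => h2 ((hg1 u).trans h')⟩
      · rintro (⟨w, rfl⟩ | ⟨u, ⟨hu, hu'⟩, rfl⟩)
        · exact ⟨bg_inr, fun h' => hp (h'.symm.trans (hg2 w))⟩
        · exact ⟨bg_inl.2 hu, fun h' => hu' ((hg1 u).symm.trans h')⟩
    have hex : ∀ p, p ≠ i → ∃ u ∈ c, f (Sum.inl u) = p := by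
      intro p hp
      obtain ⟨v, hv, hvp⟩ := h0.surj p
      rcases hv with ⟨w, rfl⟩ | ⟨u, hu, rfl⟩
      · exact absurd (hvp.symm.trans (hi' w)) hp
      · exact ⟨u, hu, hvp⟩
    refine Le_prime (f := f) (f' := f') h0 ⟨h0.prime, h0.card, ?_, ?_⟩ ?_ ?_
    · intro p
      by_cases hp : p = i
      · exact ⟨Sum.inr w0', bg_inr, hp.symm⟩
      · obtain ⟨u, hu, hup⟩ := hex p hp
        exact ⟨Sum.inl u, bg_inl.2 hu, hup⟩
    · rintro (u | w) hv (u' | w') hv' hne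
      · exact h0.fib (Sum.inl u) (bg_inl.2 (bg_inl.1 hv)) (Sum.inl u') (bg_inl.2 (bg_inl.1 hv')) hne
      · have := h0.fib (Sum.inl u) (bg_inl.2 (bg_inl.1 hv)) (Sum.inr w0) bg_inr
          (by rw [hi']; exact hne)
        rw [hi'] at this
        exact this
      · have := h0.fib (Sum.inr w0) bg_inr (Sum.inl u') (bg_inl.2 (bg_inl.1 hv'))
          (by rw [hi']; exact hne)
        rw [hi'] at this
        exact this
      · exact absurd rfl hne
    · intro p
      by_cases hp : p = i
      · subst hp
        rw [k2 X f (fun _ => rfl) hi', k2 X' f' (fun _ => rfl) (fun _ => rfl)]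
        refine ih _ ⟨fun _ h => h.1, fun hh => ?_⟩
        obtain ⟨p', hp', _⟩ := h0.two p p
        obtain ⟨u, hu, hup⟩ := hex p' hp'
        exact hp' (hup.symm.trans (hh hu).2)
      · rw [k1 X f (fun _ => rfl) hi' p hp, k1 X' f' (fun _ => rfl) (fun _ => rfl) p hp]
        exact Le_inl R R X X' _
    · intro p
      by_cases hp : p = i
      · subst hp
        rw [k3 X f (fun _ => rfl) hi', k3 X' f' (fun _ => rfl) (fun _ => rfl)]
        exact Le_inl R R X X' _
      · rw [k4 X f (fun _ => rfl) hi' p hp, k4 X' f' (fun _ => rfl) (fun _ => rfl) p hp]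
        refine ih _ ⟨fun _ h => h.1, fun hh => ?_⟩
        obtain ⟨u, hu, hup⟩ := hex p hp
        exact (hh hu).2 hup

theorem mono {C X X' : LGraph} {R : Set C.V} {b : Bool} (h : Le X Set.univ X' Set.univ b) :
    Le (C.plug R X) Set.univ (C.plug R X') Set.univ b := by
  have e : ∀ X, bg C R X Set.univ = Set.univ := by
    intro X
    ext v
    refine iff_of_true ?_ trivial
    rcases v with u | w
    · exact bg_inl.2 trivial
    · exact bg_inr
  rw [← e, ← e]
  by_cases h1 : IsEmpty X.V
  · exact mono_empty h h1
  by_cases h2 : IsEmpty X'.V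
  · exact (mono_empty h.swap h2).swap'
  exact mono_aux h (not_isEmpty_iff.1 h1) (not_isEmpty_iff.1 h2) _

end

section

section
variable {G : LGraph} {x c s t r : Set G.V} {b d : Bool} {K L : LQ}

theorem S1e (hs : t ∪ r = s) (h : Full G b t r) (hK : K ∈ Sem G t b) (hL : L ∈ Sem G r b) :
    K * L ∈ Sem G s b := hs ▸ S1 h hK hL

theorem S2e (hs : t ∪ r = s) (h : Full G b t r) {T : Set LQ} (hT : Closed T)
    (hh : ∀ K ∈ Sem G t b, ∀ L ∈ Sem G r b, K * L ∈ T) : Sem G s b ⊆ T := hs ▸ S2 h hT hh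

theorem I2e (hs : t ∪ r = s) (hd : d = !b) (h : Full G d t r)
    (h1 : ∀ L ∈ Sem G t d, K * L ∈ Sem G r b) (h2 : ∀ L ∈ Sem G r d, K * L ∈ Sem G t b) :
    K ∈ Sem G s b := by
  subst hs hd; exact I2 h h1 h2

end

/-! identity -/

theorem Sem_univ_empty {G : LGraph} (h : IsEmpty G.V) {b : Bool} : Sem G Set.univ b = pv := by
  rw [Set.univ_eq_empty_iff.2 h, Sem_empty]

theorem Le_ai {G : LGraph} {v w : G.V} {b : Bool} (h : E G (!b) v w)
    (hl : G.label v = dualAtom (G.label w)) (hu : ({v} ∪ {w} : Set G.V) = Set.univ) :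
    Le LGraph.empty Set.univ G Set.univ b := by
  have hF : Full G (!b) {v} {w} := by rintro _ rfl _ rfl; exact h
  have e : ∀ b, Sem G {v} b = Sem G {w} (!b) := by
    intro b
    rw [Sem_single, Sem_single, hl]
    congr 4
    cases b
    · rfl
    · change dualAtom (dualAtom _) = _
      unfold dualAtom; simp [atb]
  have e' : Sem G {w} (!b) = Sem G {v} b := (e b).symm
  have h1 : (1 : LQ) ∈ Sem G Set.univ b := by
    refine I2e hu rfl hF (fun L hL => ?_) (fun L hL => ?_)
    · rw [e, Bool.not_not] at hL; simpa using hL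
    · rw [e'] at hL; simpa using hL
  have h2 := Le_one0 (c := ∅) (Set.union_empty _) (by
    constructor
    · intro v _ h; exact h
    · intro v h; exact h.elim) h1
  refine Le.trans ?_ h2
  constructor <;> rw [Sem_empty, Sem_univ_empty (show IsEmpty LGraph.empty.V from inferInstanceAs (IsEmpty Empty))]

/-! switch -/
section
variable {G : LGraph} {m n u1 u2 s : Set G.V} {b : Bool} {K L : LQ}

theorem sw_a (h1 : m ∪ n = u1) (hs : m ∪ (n ∪ u2) = s) (hF : Full G (!b) m (n ∪ u2))
    (hM : Mod G n u2) (hK : K ∈ Sem G u1 b) (hL : L ∈ Sem G u2 b) : K * L ∈ Sem G s b := by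
  have hF1 : Full G (!b) m n := fun x hx y hy => hF x hx y (Or.inl hy)
  refine I2e hs rfl hF (fun X hX => ?_) (fun X hX => ?_)
  · have h3 := J1 h1 rfl hF1 hK hX
    have := F3 rfl hM h3 hL
    convert this using 1; ac_rfl
  · have h3 := F2' (b := !b) (d := b) rfl hM (by simp) hX hL
    have := J1 (b := b) (by rw [Set.union_comm]; exact h1) rfl hF1.symm hK h3
    convert this using 1; ac_rfl

theorem sw_b (h1 : m ∪ n = u1) (hs : m ∪ (n ∪ u2) = s) (hF : Full G (!b) m (n ∪ u2))
    (hM : Mod G n u2) (hK : K ∈ Sem G s (!b)) (hL : L ∈ Sem G u1 b) :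
    K * L ∈ Sem G u2 (!b) := by
  have hF1 : Full G (!b) m n := fun x hx y hy => hF x hx y (Or.inl hy)
  refine S2e (T := {K | K * L ∈ Sem G u2 (!b)}) hs hF (Sem_closed.shift L) (fun X hX Y hY => ?_) hK
  change X * Y * L ∈ Sem G u2 (!b)
  have h3 := J1 h1 rfl hF1 hL hX
  have := F2 (d := b) rfl hM (by simp) hY h3
  convert this using 1; ac_rfl

theorem sw_c (h1 : m ∪ n = u1) (hs : m ∪ (n ∪ u2) = s) (hF : Full G (!b) m (n ∪ u2))
    (hM : Mod G n u2) (hK : K ∈ Sem G s (!b)) (hL : L ∈ Sem G u2 b) :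
    K * L ∈ Sem G u1 (!b) := by
  have hF1 : Full G (!b) m n := fun x hx y hy => hF x hx y (Or.inl hy)
  refine S2e (T := {K | K * L ∈ Sem G u1 (!b)}) hs hF (Sem_closed.shift L) (fun X hX Y hY => ?_) hK
  change X * Y * L ∈ Sem G u1 (!b)
  have h3 := F2' (d := b) rfl hM (by simp) hY hL
  have := S1e h1 hF1 hX h3
  convert this using 1; ac_rfl

end

/-- switch as an inequality -/
theorem Le_sw {G H : LGraph} {m n u1 u2 s : Set G.V} {t1 t2 t : Set H.V} {b : Bool}
    (h1 : m ∪ n = u1) (hs : m ∪ (n ∪ u2) = s)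
    (hF : Full G (!b) m (n ∪ u2)) (hM : Mod G n u2) (ht : t1 ∪ t2 = t) (hF' : Full H b t1 t2)
    (k1 : Le H t1 G u1 b) (k2 : Le H t2 G u2 b) : Le H t G s b := by
  refine ⟨?_, fun K hK => ?_⟩
  · exact S2e ht hF' Sem_closed fun K hK L hL => sw_a h1 hs hF hM (k1.1 hK) (k2.1 hL)
  · refine I2e (d := b) ht (by simp) hF' (fun L hL => k2.2 (sw_b h1 hs hF hM hK (k1.1 hL)))
      (fun L hL => k1.2 (sw_c h1 hs hF hM hK (k2.1 hL)))

theorem Le_sw0 {G H : LGraph} {n u2 s : Set G.V} {t1 t2 t : Set H.V} {b : Bool}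
    (hs : n ∪ u2 = s) (hM : Mod G n u2) (ht : t1 ∪ t2 = t) (hF' : Full H b t1 t2)
    (k1 : Le H t1 G n b) (k2 : Le H t2 G u2 b) : Le H t G s b :=
  Le_sw (m := ∅) (Set.empty_union _) (by rw [Set.empty_union]; exact hs) (fun _ h => h.elim) hM ht
    hF' k1 k2

theorem Le_ss (A B : LGraph) (S S' : Set B.V) (b : Bool) (h : ∀ v, v ∈ S' ↔ b = true) :
    Le (B.plug S' A) Set.univ (B.plug S A) Set.univ b := by
  have e : ∀ S, (Set.range Sum.inr ∪ Sum.inl '' Set.univ : Set (B.plug S A).V) = Set.univ := by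
    intro S; ext v
    refine iff_of_true ?_ trivial
    rcases v with u | w
    · exact Or.inr ⟨u, trivial, rfl⟩
    · exact Or.inl ⟨w, rfl⟩
  refine Le_sw0 (e S) bg_mod (e S') ?_ ((Le_inr' B S' A).trans (Le_inr B S A)) (Le_inl _ _ _ _ _)
  rintro _ ⟨w, rfl⟩ _ ⟨u, _, rfl⟩
  exact ⟨fun h => (by cases h), h u⟩

end

section

theorem mem_par {T : Set LQ} {X Y : LGraph} {k : LQ} (h : q Y = k) (hk : k * q X ∈ T) :
    q (X.par Y) ∈ T := by
  rw [← q_mul, h, mul_comm]; exact hk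

theorem pol_prime {P : LGraph} (h : P.Prime) (b : Bool) : (pol P b).Prime := by
  refine ⟨h.1, fun M hM => h.2 M ?_⟩
  intro v hv x hx y hy
  have := hM v hv x hx y hy
  have h1 : v ≠ x := fun e => hv (e ▸ hx)
  have h2 : v ≠ y := fun e => hv (e ▸ hy)
  have k : E P b v x ↔ E P b v y := this
  unfold E at k
  cases b <;> simp [h1, h2] at k <;> tauto

theorem pol_pol_iso {P : LGraph} {i c d : Bool} (hd : d = (i == c)) {K : P.V → LGraph} :
    ((pol (pol P i) c).comp K).iso ((pol P d).comp K) := by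
  refine comp_iso (Q := pol (pol P i) c) (Q' := pol P d) (Equiv.refl P.V) ?_ (fun v => iso.refl _)
  intro v w hne
  have hne' : (v : P.V) ≠ w := hne
  change (v ≠ w ∧ ((v ≠ w ∧ (P.adj v w ↔ i = true)) ↔ c = true)) ↔ (v ≠ w ∧ (P.adj v w ↔ d = true))
  subst hd
  cases i <;> cases c <;> simp [hne']

section
variable {G P : LGraph} {f : G.V → P.V} {b : Bool}

/-- n-ary product -/
theorem SN0 {u : Set G.V} (hF : ∀ x ∈ u, ∀ y ∈ u, f x ≠ f y → E G b x y) (w : Finset P.V) :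
    ∀ {T : Set LQ}, Closed T →
    (∀ A : P.V → LQ, (∀ p, A p ∈ Sem G (u ∩ f ⁻¹' {p}) b ∨ p ∉ w) → ∏ p ∈ w, A p ∈ T) →
    Sem G (u ∩ f ⁻¹' w) b ⊆ T := by
  classical
  induction w using Finset.induction_on with
  | empty =>
    intro T hT h
    have e : u ∩ f ⁻¹' ((∅ : Finset P.V) : Set P.V) = ∅ := by simp
    rw [e, Sem_empty]
    intro K hK
    have := h (fun _ => 1) (fun p => Or.inr (by simp))
    simpa using mul_pv' hT hK this
  | insert p w hp ih =>
    intro T hT h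
    refine S2e (t := u ∩ f ⁻¹' {p}) (r := u ∩ f ⁻¹' w) ?_ ?_ hT ?_
    · ext v; simp; tauto
    · rintro x ⟨hx, hx'⟩ y ⟨hy, hy'⟩
      refine hF x hx y hy fun e => hp ?_
      have hx' : f x = p := hx'
      rw [← hx', e]; exact hy'
    · intro K hK L hL
      rw [mul_comm]
      refine ih (T := {L | L * K ∈ T}) (hT.shift K) (fun A hA => ?_) hL
      have := h (Function.update A p K) (fun p' => ?_)
      · rw [Finset.prod_insert hp, Function.update_self] at this
        have e : ∏ x ∈ w, Function.update A p K x = ∏ x ∈ w, A x :=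
          Finset.prod_congr rfl fun x hx => Function.update_of_ne (fun e : x = p => hp (e ▸ hx)) _ _
        rw [e, mul_comm] at this
        exact this
      · by_cases e : p' = p
        · subst e; left; simpa using hK
        · rw [Function.update_of_ne e]
          rcases hA p' with h' | h'
          · exact Or.inl h'
          · right; simp [e, h']

theorem SN {u : Set G.V} (hF : ∀ x ∈ u, ∀ y ∈ u, f x ≠ f y → E G b x y)
    {T : Set LQ} (hT : Closed T)
    (h : ∀ A : P.V → LQ, (∀ p, A p ∈ Sem G (u ∩ f ⁻¹' {p}) b) → ∏ p, A p ∈ T) :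
    Sem G u b ⊆ T := by
  have := SN0 hF Finset.univ hT (fun A hA => h A fun p => (hA p).resolve_right (by simp))
  simpa using this

variable {m n u : Set G.V}

theorem PB {i : Bool} (hm : Decomp G m (pol P i) f) (hn : Decomp G n (pol P !i) f)
    (hmn : m ∪ n = u) (hF : Full G (!b) m n) {H L : LQ}
    (hN : ∀ T, Closed T → (∀ A : P.V → LQ, (∀ p, A p ∈ Sem G (u ∩ f ⁻¹' {p}) b) → ∏ p, A p ∈ T) →
      H ∈ T)
    (h2 : ∀ p T, Closed T → (∀ A ∈ Sem G (u ∩ f ⁻¹' {p}) b, ∀ B ∈ Sem G (u \ f ⁻¹' {p}) b,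
      A * B ∈ T) → H ∈ T)
    (hL : L ∈ Sem G m (!b)) : H * L ∈ Sem G n b := by
  have d1 : ∀ p, (m ∩ f ⁻¹' {p}) ∪ (n ∩ f ⁻¹' {p}) = u ∩ f ⁻¹' {p} := fun p => by
    rw [← Set.union_inter_distrib_right, hmn]
  have d2 : ∀ p, (m \ f ⁻¹' {p}) ∪ (n \ f ⁻¹' {p}) = u \ f ⁻¹' {p} := fun p => by
    rw [← Set.union_sdiff_distrib, hmn]
  have f1 : ∀ p, Full G (!b) (m ∩ f ⁻¹' {p}) (n ∩ f ⁻¹' {p}) := fun p x hx y hy =>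
    hF x hx.1 y hy.1
  have f2 : ∀ p, Full G (!b) (m \ f ⁻¹' {p}) (n \ f ⁻¹' {p}) := fun p x hx y hy =>
    hF x hx.1 y hy.1
  have n1 : ∀ p, (n ∩ f ⁻¹' {p}) ∪ (n \ f ⁻¹' {p}) = n := fun p => Set.inter_union_sdiff _ _
  have n2 : ∀ p, Mod G (n ∩ f ⁻¹' {p}) (n \ f ⁻¹' {p}) := fun p =>
    (hn.fiber_mod p).mono subset_rfl (fun v hv => ⟨hv.1, fun h => hv.2 h.2⟩)
  rw [mul_comm]
  refine prime_le (T := {L | L * H ∈ Sem G n b}) hm (Sem_closed.shift H) ?_ ?_ hL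
  · intro K hK0 hK
    change q _ * H ∈ Sem G n b
    rw [mul_comm]
    refine hN {H | H * q ((pol (pol P i) (!!b)).comp K) ∈ Sem G n b} (Sem_closed.shift _) ?_
    intro A hA
    change _ * _ ∈ Sem G n b
    rw [mul_comm]
    choose A' hA' using fun p => q_surj (A p)
    have : ∏ p, A p = ∏ p, q (A' p) := Finset.prod_congr rfl fun p _ => (hA' p).symm
    rw [this]
    refine comp_par (Q := pol (pol P i) (!!b)) Sem_closed ?_
    have k := prime_A (b := b) hn (K := fun p => (K p).par (A' p))
      (fun p => ⟨Sum.inl (hK0 p).some⟩) (fun p => ?_)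
    · refine mem_iso ?_ k
      refine (pol_pol_iso (d := (i == b)) ?_).trans (pol_pol_iso (d := (i == b)) ?_).symm
      · cases i <;> cases b <;> rfl
      · cases i <;> cases b <;> rfl
    · exact mem_par (hA' p) (J1 (d1 p) rfl (f1 p) (hA p) (hK p))
  · intro p K hK L hL
    change K * L * H ∈ Sem G n b
    rw [mul_comm]
    refine h2 p {H | H * (K * L) ∈ Sem G n b} (Sem_closed.shift _) ?_
    intro A hA B hB
    change A * B * (K * L) ∈ Sem G n b
    have k1 := J1 (d1 p) rfl (f1 p) hA hK
    have k2 := J1 (d2 p) rfl (f2 p) hB hL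
    have := F3 (n1 p) (n2 p) k1 k2
    convert this using 1; ac_rfl

theorem PNB {i : Bool} (hn : Decomp G n (pol P !i) f)
    (hmn : m ∪ n = u) (hF : Full G (!b) m n) {T : Set LQ}
    (hI : ∀ p H, (∀ Y ∈ Sem G (u ∩ f ⁻¹' {p}) b, H * Y ∈ Sem G (u \ f ⁻¹' {p}) (!b)) →
      (∀ Y ∈ Sem G (u \ f ⁻¹' {p}) b, H * Y ∈ Sem G (u ∩ f ⁻¹' {p}) (!b)) → H ∈ T)
    {p : P.V} {K L X : LQ} (hK : K ∈ Sem G (m ∩ f ⁻¹' {p}) (!b))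
    (hL : L ∈ Sem G (m \ f ⁻¹' {p}) (!b)) (hX : X ∈ Sem G n (!b)) : K * L * X ∈ T := by
  have d1 : (m ∩ f ⁻¹' {p}) ∪ (n ∩ f ⁻¹' {p}) = u ∩ f ⁻¹' {p} := by
    rw [← Set.union_inter_distrib_right, hmn]
  have d2 : (m \ f ⁻¹' {p}) ∪ (n \ f ⁻¹' {p}) = u \ f ⁻¹' {p} := by
    rw [← Set.union_sdiff_distrib, hmn]
  have f1 : Full G (!b) (m ∩ f ⁻¹' {p}) (n ∩ f ⁻¹' {p}) := fun x hx y hy =>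
    hF x hx.1 y hy.1
  have f2 : Full G (!b) (m \ f ⁻¹' {p}) (n \ f ⁻¹' {p}) := fun x hx y hy =>
    hF x hx.1 y hy.1
  have n1 : (n ∩ f ⁻¹' {p}) ∪ (n \ f ⁻¹' {p}) = n := Set.inter_union_sdiff _ _
  have n2 : Mod G (n ∩ f ⁻¹' {p}) (n \ f ⁻¹' {p}) :=
    (hn.fiber_mod p).mono subset_rfl (fun v hv => ⟨hv.1, fun h => hv.2 h.2⟩)
  refine hI p _ (fun Y hY => ?_) (fun Y hY => ?_)
  · have k1 := J1 d1 rfl f1 hY hK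
    have k2 := F2 (d := b) n1 n2 (by simp) hX k1
    have := S1e d2 f2 hL k2
    convert this using 1; ac_rfl
  · have k1 := J1 d2 rfl f2 hY hL
    have k2 := F2' (d := b) n1 n2 (by simp) hX k1
    have := S1e d1 f1 hK k2
    convert this using 1; ac_rfl

theorem PN (hP : P.Prime) (h4 : 4 ≤ Fintype.card P.V) {i : Bool} (hm : Decomp G m (pol P i) f) (hn : Decomp G n (pol P !i) f)
    (hmn : m ∪ n = u) (hF : Full G (!b) m n) {T : Set LQ} (hT : Closed T)
    (hI : ∀ p H, (∀ Y ∈ Sem G (u ∩ f ⁻¹' {p}) b, H * Y ∈ Sem G (u \ f ⁻¹' {p}) (!b)) →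
      (∀ Y ∈ Sem G (u \ f ⁻¹' {p}) b, H * Y ∈ Sem G (u ∩ f ⁻¹' {p}) (!b)) → H ∈ T)
    (hA : ∀ K L : P.V → LGraph, (∀ p, q (K p) * q (L p) ∈ Sem G (u ∩ f ⁻¹' {p}) (!b)) →
      q ((kgr P.V true).comp fun v => (K v).par (L v)) ∈ T) : Sem G u (!b) ⊆ T := by
  refine S2e hmn hF hT fun X hX Y hY => ?_
  refine prime_le (T := {X | X * Y ∈ T}) hm (hT.shift Y) ?_ ?_ hX
  · intro K hK0 hK
    change q _ * Y ∈ T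
    rw [mul_comm]
    refine prime_le (T := {Y | Y * q ((pol (pol P i) (!!b)).comp K) ∈ T}) hn (hT.shift _) ?_ ?_ hY
    · intro L hL0 hL
      change q _ * q _ ∈ T
      have := p_rule hT hP h4 (K := L) (L := K) hL0 hK0 (i == b) (hA L K fun p => ?_)
      · have e1 : q ((pol (pol P !i) (!!b)).comp L) = q ((pol P (!(i == b))).comp L) :=
          q_eq.2 (pol_pol_iso (by cases i <;> cases b <;> rfl))
        have e2 : q ((pol (pol P i) (!!b)).comp K) = q ((pol P (i == b)).comp K) :=
          q_eq.2 (pol_pol_iso (by cases i <;> cases b <;> rfl))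
        exact (congrArg₂ (fun y z => y * z ∈ T) e1 e2).mpr this
      · rw [mul_comm]
        refine S1e (t := m ∩ f ⁻¹' {p}) (r := n ∩ f ⁻¹' {p}) ?_ (fun x hx y hy => hF x hx.1 y hy.1) (hK p) (hL p)
        rw [← Set.union_inter_distrib_right, hmn]
    · intro p L hL M hM
      change L * M * q ((pol (pol P i) (!!b)).comp K) ∈ T
      have hm' : Decomp G m (pol P !!i) f := by rw [Bool.not_not]; exact hm
      refine PNB hm' (by rw [Set.union_comm]; exact hmn) hF.symm hI hL hM ?_
      exact prime_A hm hK0 hK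
  · intro p K hK L hL
    change K * L * Y ∈ T
    exact PNB hn hmn hF hI hK hL hY

end

end

section

/-- the same vertices and labels with another adjacency -/
@[reducible] def re (G : LGraph) (a : G.V → G.V → Prop) (hs : ∀ {v w}, a v w → a w v)
    (hi : ∀ v, ¬ a v v) : LGraph where
  V := G.V
  adj := a
  symm := hs
  irrefl := hi
  label := G.label

theorem GP {G : LGraph} {a : G.V → G.V → Prop} {hs : ∀ {v w}, a v w → a w v}
    {hi : ∀ v, ¬ a v v} {b : Bool} {Q : LGraph} (h : G.V → Q.V) (σ : G.V → Bool)
    (H1 : ∀ x y, h x ≠ h y → E G b x y)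
    (H2 : ∀ x y, h x = h y → σ x ≠ σ y → E G (!b) x y)
    (H3 : ∀ x y, σ x ≠ σ y → E (re G a hs hi) (!b) x y)
    (H4 : ∀ x y, σ x = σ y → h x ≠ h y → (a x y ↔ E Q (σ x) (h x) (h y)))
    (H5 : ∀ x y, h x = h y → σ x = σ y → (G.adj x y ↔ a x y)) (u : Set G.V) :
    Le G u (re G a hs hi) u b := by
  induction u using WellFoundedLT.induction with
  | ind u ih =>
  -- pieces lying in one fibre agree
  have agree : ∀ w : Set G.V, (∀ x ∈ w, ∀ y ∈ w, h x = h y) → Le G w (re G a hs hi) w b := by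
    intro w hw
    have := Sem_map (G := G) (H := (re G a hs hi)) (fun v => v) (b := b) w (fun _ _ _ _ e => e) ?_
      (fun _ _ => rfl)
    · have e : (fun v : G.V => v) '' w = w := Set.image_id w
      exact (congrArg (fun z => Le G w (re G a hs hi) z b) e).mp this
    · intro x hx y hy
      by_cases hxy : σ x = σ y
      · exact H5 x y (hw x hx y hy) hxy
      · exact (H2 x y (hw x hx y hy) hxy).2.trans (H3 x y hxy).2.symm
  rcases decomp_exists (h '' u) with h0 | ⟨v, h0⟩ | ⟨b', t, h0⟩ | ⟨P, g, h0⟩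
  · refine agree u fun x hx => ?_
    have : h x ∈ h '' u := ⟨x, hx, rfl⟩
    rw [h0] at this; exact this.elim
  · refine agree u fun x hx y hy => ?_
    have k1 : h x ∈ h '' u := ⟨x, hx, rfl⟩
    have k2 : h y ∈ h '' u := ⟨y, hy, rfl⟩
    rw [h0] at k1 k2
    exact k1.trans k2.symm
  · obtain ⟨hsub, ⟨z1, hz1⟩, ⟨z2, hz2⟩, hE⟩ := h0
    obtain ⟨x1, hx1, rfl⟩ := hsub hz1
    obtain ⟨x2, hx2, rfl⟩ := hz2.1
    have hE' : ∀ x ∈ u, ∀ y ∈ u, h x ∈ t → h y ∉ t → E Q b' (h x) (h y) := fun x hx y hy hxt hyt =>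
      hE _ hxt _ ⟨⟨y, hy, rfl⟩, hyt⟩
    have key : ∀ x ∈ u, ∀ y ∈ u, h x ∈ t → h y ∉ t → σ x = σ y → E (re G a hs hi) (σ x == b') x y := by
      intro x hx y hy hxt hyt hxy
      have hne : h x ≠ h y := fun e => hyt (e ▸ hxt)
      have hne' : x ≠ y := fun e => hne (e ▸ rfl)
      have k := hE' x hx y hy hxt hyt
      refine ⟨hne', ?_⟩
      have k4 := H4 x y hxy hne
      refine k4.trans ?_
      unfold E at k ⊢
      generalize σ x = c at *
      have k2 := k.2
      cases c <;> cases b' <;> simp_all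
    let i : Bool := (b' == !b)
    have hib : ∀ c, c = i → (c == b') = !b := by
      intro c hc; subst hc; cases b <;> cases b' <;> rfl
    have hib' : ∀ c, c ≠ i → (c == b') = b := by
      intro c hc; revert hc; cases b <;> cases b' <;> cases c <;> simp [i]
    have e1 : (u ∩ h ⁻¹' t) ∪ (u \ h ⁻¹' t) = u := Set.inter_union_sdiff _ _
    refine Le_sw (G := (re G a hs hi)) (H := G) (m := {x ∈ u ∩ h ⁻¹' t | σ x = i})
      (n := {x ∈ u ∩ h ⁻¹' t | σ x ≠ i}) (u1 := u ∩ h ⁻¹' t) (u2 := u \ h ⁻¹' t)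
      (t1 := u ∩ h ⁻¹' t) (t2 := u \ h ⁻¹' t) ?_ ?_ ?_ ?_ e1 ?_ (ih _ ?_) (ih _ ?_)
    · ext x
      constructor
      · rintro (hx | hx) <;> exact hx.1
      · intro hx
        by_cases hxi : σ x = i
        · exact Or.inl ⟨hx, hxi⟩
        · exact Or.inr ⟨hx, hxi⟩
    · ext x
      constructor
      · rintro (hx | hx | hx)
        · exact hx.1.1
        · exact hx.1.1
        · exact hx.1
      · intro hx
        by_cases hxt : h x ∈ t
        · by_cases hxi : σ x = i
          · exact Or.inl ⟨⟨hx, hxt⟩, hxi⟩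
          · exact Or.inr (Or.inl ⟨⟨hx, hxt⟩, hxi⟩)
        · exact Or.inr (Or.inr ⟨hx, hxt⟩)
    · rintro x ⟨⟨hx, hxt⟩, hxi⟩ y (hy | hy)
      · exact H3 x y fun e => hy.2 (e ▸ hxi)
      · by_cases hxy : σ x = σ y
        · have := key x hx y hy.1 hxt hy.2 hxy
          rw [hib _ hxi] at this
          exact this
        · exact H3 x y hxy
    · constructor
      · intro v hv hv'
        exact hv'.2 hv.1.2
      · intro v hv y hy z hz
        have aux : ∀ y, y ∈ {x ∈ u ∩ h ⁻¹' t | σ x ≠ i} →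
            (a v y ↔ (if σ v = i then !b else b) = true) := by
          intro y hy
          by_cases hvi : σ v = i
          · rw [if_pos hvi]
            exact (H3 v y fun e => hy.2 (e ▸ hvi)).2
          · rw [if_neg hvi]
            have hxy : σ y = σ v := by
              have := hy.2
              generalize σ y = c at *
              generalize σ v = c' at *
              revert this hvi
              generalize i = c''
              cases c <;> cases c' <;> cases c'' <;> simp
            have := key y hy.1.1 v hv.1 hy.1.2 hv.2 hxy
            rw [hib' _ hy.2] at this
            exact this.symm.2
        exact (aux y hy).trans (aux z hz).symm
    · intro x hx y hy
      exact H1 x y fun e => hy.2 (show h y ∈ t from e ▸ hx.2)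
    · exact ⟨Set.inter_subset_left, fun hh => hz2.2 (hh hx2).2⟩
    · exact ⟨Set.sdiff_subset, fun hh => (hh hx1).2 hz1⟩
  · let f : G.V → P.V := fun x => g (h x)
    have hne : ∀ x y, f x ≠ f y → h x ≠ h y := fun x y k e => k (congrArg g e)
    have hfib : ∀ x ∈ u, ∀ y ∈ u, f x ≠ f y → σ x = σ y → (a x y ↔ E P (σ x) (f x) (f y)) := by
      intro x hx y hy hxy hσ
      have k1 := H4 x y hσ (hne x y hxy)
      have k2 := h0.fib (h x) ⟨x, hx, rfl⟩ (h y) ⟨y, hy, rfl⟩ hxy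
      refine k1.trans ?_
      unfold E
      rw [k2]
      exact and_congr_left fun _ => iff_of_true (hne x y hxy) hxy
    have hsurj : ∀ p, ∃ x ∈ u, f x = p := by
      intro p
      obtain ⟨_, ⟨x, hx, rfl⟩, hp⟩ := h0.surj p
      exact ⟨x, hx, hp⟩
    have i1 : ∀ p, u ∩ f ⁻¹' {p} ⊂ u := by
      intro p
      refine ⟨Set.inter_subset_left, fun hh => ?_⟩
      obtain ⟨p', hp', _⟩ := h0.two p p
      obtain ⟨x, hx, rfl⟩ := hsurj p'
      exact hp' (hh hx).2
    have i2 : ∀ p, u \ f ⁻¹' {p} ⊂ u := by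
      intro p
      refine ⟨Set.sdiff_subset, fun hh => ?_⟩
      obtain ⟨x, hx, hxp⟩ := hsurj p
      exact (hh hx).2 hxp
    have j1 : ∀ p, (u ∩ f ⁻¹' {p}) ∪ (u \ f ⁻¹' {p}) = u := fun p => Set.inter_union_sdiff _ _
    have j2 : ∀ p, Full G b (u ∩ f ⁻¹' {p}) (u \ f ⁻¹' {p}) := fun p x hx y hy =>
      H1 x y (hne x y fun e => hy.2 (e.symm.trans hx.2))
    by_cases hone : ∃ p i, ∀ x ∈ u, f x = p → σ x = i
    · obtain ⟨p, i, hpi⟩ := hone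
      refine Le_sw0 (G := (re G a hs hi)) (H := G) (j1 p) ?_ (j1 p) (j2 p) (ih _ (i1 p)) (ih _ (i2 p))
      constructor
      · intro v hv hv'
        exact hv'.2 hv.2
      · intro v hv y hy z hz
        have aux : ∀ y ∈ u ∩ f ⁻¹' {p}, (a v y ↔ if σ v = i then E P i (f v) p else (!b) = true) := by
          intro y hy
          have hyp : f y = p := hy.2
          have hy' := hpi y hy.1 hyp
          by_cases hvi : σ v = i
          · rw [if_pos hvi]
            have := hfib v hv.1 y hy.1 (fun e => hv.2 (e.trans hyp)) (hvi.trans hy'.symm)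
            rw [hvi, hyp] at this
            exact this
          · rw [if_neg hvi]
            exact (H3 v y fun e => hvi (e.trans hy')).2
        exact (aux y hy).trans (aux z hz).symm
    · push Not at hone
      have hd : ∀ i, Decomp (re G a hs hi) {x ∈ u | σ x = i} (pol P i) f := by
        intro i
        refine ⟨pol_prime h0.prime i, h0.card, ?_, ?_⟩
        · intro p
          obtain ⟨x, hx, hxp, hxi⟩ := hone p (!i)
          refine ⟨x, ⟨hx, ?_⟩, hxp⟩
          revert hxi
          generalize σ x = c
          cases c <;> cases i <;> simp
        · rintro x ⟨hx, hxi⟩ y ⟨hy, hyi⟩ hxy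
          have := hfib x hx y hy hxy (hxi.trans hyi.symm)
          rw [hxi] at this
          exact this
      have hun : ∀ i, {x ∈ u | σ x = i} ∪ {x ∈ u | σ x = !i} = u := by
        intro i
        ext x
        constructor
        · rintro (hx | hx) <;> exact hx.1
        · intro hx
          by_cases hxi : σ x = i
          · exact Or.inl ⟨hx, hxi⟩
          · refine Or.inr ⟨hx, ?_⟩
            revert hxi
            generalize σ x = c
            cases c <;> cases i <;> simp
      have hfull : ∀ i, Full (re G a hs hi) (!b) {x ∈ u | σ x = i} {x ∈ u | σ x = !i} := by
        rintro i x ⟨hx, hxi⟩ y ⟨hy, hyi⟩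
        refine H3 x y fun e => ?_
        rw [hxi, hyi] at e
        cases i <;> simp at e
      refine ⟨fun H hH => ?_, ?_⟩
      · have pb : ∀ i, ∀ L ∈ Sem (re G a hs hi) {x ∈ u | σ x = i} (!b),
            H * L ∈ Sem (re G a hs hi) {x ∈ u | σ x = !i} b := by
          intro i L hL
          refine PB (G := (re G a hs hi)) (P := P) (hd i) (hd (!i)) (hun i) (hfull i) (fun T hT hh => ?_)
            (fun p T hT hh => ?_) hL
          · refine SN (G := G) (u := u) (f := f) (fun x _ y _ k => H1 x y (hne x y k)) hT ?_ hH
            intro A hA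
            exact hh A fun p => (ih _ (i1 p)).1 (hA p)
          · exact S2e (j1 p) (j2 p) hT (fun K hK L hL => hh K ((ih _ (i1 p)).1 hK) L
              ((ih _ (i2 p)).1 hL)) hH
        refine I2e (G := (re G a hs hi)) (hun true) rfl (hfull true) (pb true) ?_
        exact pb false
      · refine PN (G := (re G a hs hi)) (P := P) h0.prime h0.card (hd true) (hd false) (hun true) (hfull true)
          Sem_closed ?_ ?_
        · intro p H k1 k2
          exact I2e (d := b) (j1 p) (by simp) (j2 p) (fun L hL => (ih _ (i2 p)).2 (k1 L ((ih _ (i1 p)).1 hL)))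
            (fun L hL => (ih _ (i1 p)).2 (k2 L ((ih _ (i2 p)).1 hL)))
        · intro K L hKL
          have hK : ∀ p, q ((K p).par (L p)) ∈ Sem G (u ∩ f ⁻¹' {p}) (!b) := fun p =>
            (ih _ (i1 p)).2 (hKL p)
          have := fact4 (G := G) (Q := kgr P.V b) (H := (kgr P.V true).comp fun v => (K v).par (L v))
            (b := !b) (f := f) (h := fun x => x.1) (s := u) (u := Set.univ) ?_ ?_
            (fun t _ => (FF_all t).orth') ?_
          · exact mem_iso (sub_univ _).symm this
          · intro x _ y _ hxy
            refine (H1 x y (hne x y hxy)).2.trans ?_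
            exact ⟨fun e => ⟨hxy, e⟩, fun e => e.2⟩
          · intro x _ y _ hxy
            refine (compAdj_diff hxy).trans ?_
            rw [Bool.not_not]
            change (x.1 ≠ y.1 ∧ true = true) ↔ (x.1 ≠ y.1 ∧ ((x.1 ≠ y.1 ∧ b = true) ↔ b = true))
            have hxy' : (x.1 : P.V) ≠ y.1 := hxy
            simp [hxy']
          · intro p
            exact mem_iso (comp_fiber (kgr P.V true) (fun v => (K v).par (L v)) p) (hK p)

end

section

theorem GP' {G H : LGraph} {b : Bool} {Q : LGraph} (φ : G.V → H.V) (hφ : Function.Bijective φ)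
    (hl : ∀ v, H.label (φ v) = G.label v) (h : G.V → Q.V) (σ : G.V → Bool)
    (H1 : ∀ x y, h x ≠ h y → (G.adj x y ↔ b = true))
    (H2 : ∀ x y, h x = h y → σ x ≠ σ y → (G.adj x y ↔ (!b) = true))
    (H3 : ∀ x y, σ x ≠ σ y → (H.adj (φ x) (φ y) ↔ (!b) = true))
    (H4 : ∀ x y, σ x = σ y → h x ≠ h y → (H.adj (φ x) (φ y) ↔ E Q (σ x) (h x) (h y)))
    (H5 : ∀ x y, h x = h y → σ x = σ y → (G.adj x y ↔ H.adj (φ x) (φ y))) :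
    Le G Set.univ H Set.univ b := by
  have k := GP (G := G) (a := fun x y => H.adj (φ x) (φ y)) (hs := fun h => H.symm h)
    (hi := fun v => H.irrefl _) (b := b) h σ
    (fun x y hxy => ⟨fun e => hxy (e ▸ rfl), H1 x y hxy⟩)
    (fun x y hxy hs => ⟨fun e => hs (e ▸ rfl), H2 x y hxy hs⟩)
    (fun x y hs => ⟨fun e => hs (e ▸ rfl), H3 x y hs⟩) H4 H5 Set.univ
  refine k.trans (Le_iso ?_)
  exact iso_of (G := re G (fun x y => H.adj (φ x) (φ y)) (fun h => H.symm h) (fun v => H.irrefl _))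
    φ hφ (fun _ _ => Iff.rfl) hl

theorem Le_p {P : LGraph} {b : Bool} (M N : P.V → LGraph) (S : ∀ v, Set (M v).V)
    (hS : ∀ v x, x ∈ S v ↔ (!b) = true) (S' : Set ((pol P (!b)).comp M).V)
    (hS' : ∀ x, x ∈ S' ↔ (!b) = true) :
    Le ((kgr P.V b).comp fun v => (M v).plug (S v) (N v)) Set.univ
      (((pol P (!b)).comp M).plug S' ((pol P b).comp N)) Set.univ b := by
  refine GP' (Q := P)
    (fun x => match x with
      | ⟨v, .inl m⟩ => Sum.inl ⟨v, m⟩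
      | ⟨v, .inr m⟩ => Sum.inr ⟨v, m⟩) ⟨?_, ?_⟩ ?_
    (fun x => x.1)
    (fun x => match x with
      | ⟨_, .inl _⟩ => !b
      | ⟨_, .inr _⟩ => b) ?_ ?_ ?_ ?_ ?_
  · rintro ⟨v, m | m⟩ ⟨w, m' | m'⟩ h
    · have h := Sum.inl.inj h
      cases h; rfl
    · cases h
    · cases h
    · have h := Sum.inr.inj h
      cases h; rfl
  · rintro (⟨v, m⟩ | ⟨v, m⟩)
    · exact ⟨⟨v, Sum.inl m⟩, rfl⟩
    · exact ⟨⟨v, Sum.inr m⟩, rfl⟩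
  · rintro ⟨v, m | m⟩ <;> rfl
  · intro x y hxy
    refine (compAdj_diff hxy).trans ?_
    exact ⟨fun e => e.2, fun e => ⟨hxy, e⟩⟩
  · rintro ⟨v, m⟩ ⟨w, m'⟩ hxy hs
    have hxy : v = w := hxy
    subst hxy
    refine compAdj_same.trans ?_
    rcases m with m | m <;> rcases m' with m' | m'
    · exact absurd rfl hs
    · exact hS v m
    · exact hS v m'
    · exact absurd rfl hs
  · rintro ⟨v, m | m⟩ ⟨w, m' | m'⟩ hs
    · exact absurd rfl hs
    · exact hS' _
    · exact hS' _
    · exact absurd rfl hs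
  · rintro ⟨v, m | m⟩ ⟨w, m' | m'⟩ hs hxy
    · exact cd (pol P (!b)) M hxy m m'
    · cases b <;> cases hs
    · cases b <;> cases hs
    · exact cd (pol P b) N hxy m m'
  · rintro ⟨v, m⟩ ⟨w, m'⟩ hxy hs
    have hxy : v = w := hxy
    subst hxy
    refine compAdj_same.trans ?_
    rcases m with m | m <;> rcases m' with m' | m'
    · exact (cs (pol P (!b)) M v m m').symm
    · cases b <;> cases hs
    · cases b <;> cases hs
    · exact (cs (pol P b) N v m m').symm

theorem kgr_reindex {P : LGraph} {n : ℕ} (e : P.V ≃ Fin n) (F : Fin n → LGraph) (b : Bool) :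
    ((kgr (Fin n) b).comp F).iso ((kgr P.V b).comp fun v => F (e v)) := by
  refine iso.symm (comp_iso (Q := kgr P.V b) (Q' := kgr (Fin n) b) e ?_ (fun v => iso.refl _))
  intro v w hvw
  exact ⟨fun h => ⟨fun h' => hvw (e.injective h'), h.2⟩, fun h => ⟨hvw, h.2⟩⟩

theorem pol_false_iso (P : LGraph) (K : P.V → LGraph) :
    ((pol P false).comp K).iso (P.dual.comp K) := by
  refine comp_iso (Q := pol P false) (Q' := P.dual) (Equiv.refl P.V) ?_ (fun v => iso.refl _)
  intro v w hvw
  exact ⟨fun h => ⟨hvw, fun h' => Bool.false_ne_true (h.2.1 h')⟩,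
    fun h => ⟨hvw, fun h' => absurd h' h.2, fun h' => absurd h' Bool.false_ne_true⟩⟩

theorem pol_true_iso (P : LGraph) (K : P.V → LGraph) :
    ((pol P true).comp K).iso (P.comp K) := by
  refine comp_iso (Q := pol P true) (Q' := P) (Equiv.refl P.V) ?_ (fun v => iso.refl _)
  intro v w hvw
  exact ⟨fun h => h.2.2 rfl, fun h => ⟨hvw, fun _ => rfl, fun _ => h⟩⟩

theorem pair_univ : ({Sum.inl ()} ∪ {Sum.inr ()} : Set (Unit ⊕ Unit)) = Set.univ := by
  ext v
  refine iff_of_true ?_ trivial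
  rcases v with _ | _
  · exact Or.inl rfl
  · exact Or.inr rfl

theorem gs_le {X Y : LGraph} (h : GSRule X Y) : Le X Set.univ Y Set.univ true := by
  cases h with
  | ai a =>
    refine Le_ai (G := (single (dualAtom a)).par (single a)) (v := Sum.inl ()) (w := Sum.inr ())
      ⟨fun h => (by cases h), ?_⟩ rfl pair_univ
    exact iff_of_false (fun h => h) Bool.false_ne_true
  | ss A B S _ _ =>
    rw [par_eq_plug]
    exact (Le_ss A B S ∅ false (fun v => iff_of_false (fun h => h) Bool.false_ne_true)).swap
  | p n P e M N _ _ _ =>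
    refine ((Le_iso (bigTensor_iso n _)).trans (Le_iso (kgr_reindex e _ true))).trans ?_
    have e1 : (fun v => (M (e v)).par (N (e v))) = fun v => (M (e v)).plug ∅ (N (e v)) :=
      funext fun v => par_eq_plug _ _
    have k := Le_p (P := P) (b := true) (fun v => M (e v)) (fun v => N (e v)) (fun v => ∅)
      (fun v x => iff_of_false (fun h => h) Bool.false_ne_true) ∅
      (fun x => iff_of_false (fun h => h) Bool.false_ne_true)
    rw [← par_eq_plug] at k
    have k' : Le ((kgr P.V true).comp fun v => (M (e v)).par (N (e v))) Set.univ _ _ _ := e1 ▸ k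
    exact k'.trans (Le_iso (par_congr (pol_false_iso P _) (pol_true_iso P _)))

theorem up_le {X Y : LGraph} (h : UpRule X Y) : Le X Set.univ Y Set.univ true := by
  cases h with
  | ai a =>
    refine Le.swap' (b := true) (Le_ai (G := (single a).tensor (single (dualAtom a))) (b := false)
      (v := Sum.inl ()) (w := Sum.inr ())
      ⟨fun h => (by cases h), ?_⟩ ?_ pair_univ)
    · exact iff_of_true trivial rfl
    · change a = dualAtom (dualAtom a)
      unfold dualAtom; simp
  | ss A B S _ _ =>
    rw [tensor_eq_plug]
    exact Le_ss A B S Set.univ true (fun v => iff_of_true trivial rfl)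
  | p n P e M N _ _ _ =>
    refine Le.swap' (b := true) ?_
    refine ((Le_iso (bigPar_iso n _)).trans (Le_iso (kgr_reindex e _ false))).trans ?_
    have e1 : (fun v => (M (e v)).tensor (N (e v))) = fun v => (M (e v)).plug Set.univ (N (e v)) :=
      funext fun v => tensor_eq_plug _ _
    have k := Le_p (P := P) (b := false) (fun v => M (e v)) (fun v => N (e v)) (fun v => Set.univ)
      (fun v x => iff_of_true trivial rfl) Set.univ
      (fun x => iff_of_true trivial rfl)
    rw [← tensor_eq_plug] at k
    have k' : Le ((kgr P.V false).comp fun v => (M (e v)).tensor (N (e v))) Set.univ _ _ _ := e1 ▸ k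
    exact k'.trans (Le_iso (tensor_congr (pol_true_iso P _) (pol_false_iso P _)))

theorem sound {G : LGraph} (h : Provable GSRule G) : (1 : LQ) ∈ Sem G Set.univ true := by
  have h' : Relation.ReflTransGen (fun X Y => X.iso Y ∨ Step GSRule X Y) LGraph.empty G := h
  induction h' with
  | refl =>
    rw [Sem_univ_empty (show IsEmpty LGraph.empty.V from inferInstanceAs (IsEmpty Empty))]
    exact one_pv
  | tail h1 h2 ih =>
    rcases h2 with h2 | ⟨C, R, p, c, hr, i1, i2⟩
    · exact (Le_iso h2).1 (ih h1)
    · exact (((Le_iso i1).trans (mono (gs_le hr))).trans (Le_iso i2.symm)).1 (ih h1)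

theorem complete {G : LGraph} (h : (1 : LQ) ∈ Sem G Set.univ true) : Provable GSRule G := by
  have := orth (b := true) (d := false) rfl h okada
  rw [one_mul] at this
  exact pv_iff.1 this

end

/-- Each of the rules `ai↑`, `ss↑`, `p↑` is admissible for GS:
for every instance with premise `Q` and conclusion `Q'` and every context `C[·]_R`,
if `C[Q]_R` is provable in GS then `C[Q']_R` is provable in GS. -/
theorem up_rules_admissible (Q Q' : LGraph) (hrule : UpRule Q Q')
    (C : LGraph) (R : Set C.V) (h : Provable GSRule (C.plug R Q)) :
    Provable GSRule (C.plug R Q') := by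
  exact complete ((mono (up_le hrule)).1 (sound h))
end GSP
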